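/- arXiv:1702.02115 — 7 statements merged into one kernel-verified Lean document; each statement's English description precedes it below -/
import Mathlib

section
/- Let c₁, c₂, c₃ ∈ ℂ be three points that are not collinear and satisfy c₁ + c₂ + c₃ = 0. Then for every η > 0 there exist ε₀ ∈ (0,η) and α₀ ∈ (0,η) such that for every ρ ∈ ℂ with 1−α₀ ≤ |ρ| ≤ 1+α₀, setting φⱼ(z) := ρz + ε₀cⱼ for j ∈ {1,2,3}: (i) closure(𝔻) ⊆ φ₁(𝔻) ∪ φ₂(𝔻) ∪ φ₃(𝔻); and (ii) there exist open sets H₁, H₂, H₃ ⊆ ℂ such that 𝔻 = H₁ ∪ H₂ ∪ H₃, closure(φⱼ(Hⱼ)) ⊆ 𝔻 and closure(φⱼ((1/3)·Hⱼ)) ⊆ (1/3)·𝔻 for each j. -/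
open Metric Set
open scoped Pointwise


def dotc (w c : ℂ) : ℝ := w.re * c.re + w.im * c.im

lemma dotc_cont (c : ℂ) : Continuous (fun w => dotc w c) := by
  unfold dotc
  fun_prop

lemma exists_kappa (c₁ c₂ c₃ : ℂ)
    (hcol : ¬ Collinear ℝ ({c₁, c₂, c₃} : Set ℂ))
    (hsum : c₁ + c₂ + c₃ = 0) :
    ∃ κ : ℝ, 0 < κ ∧ κ ≤ 1 ∧ ∀ w : ℂ, dotc w c₁ ≤ -κ * ‖w‖ ∨ dotc w c₂ ≤ -κ * ‖w‖ ∨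
      dotc w c₃ ≤ -κ * ‖w‖ := by
  obtain ⟨u, hu, hmax⟩ := (isCompact_sphere (0:ℂ) 1).exists_isMaxOn
    (NormedSpace.sphere_nonempty.mpr zero_le_one)
    (f := fun w => min (dotc w c₁) (min (dotc w c₂) (dotc w c₃)))
    (((dotc_cont c₁).min ((dotc_cont c₂).min (dotc_cont c₃))).continuousOn)
  have hu1 : u.re * u.re + u.im * u.im = 1 := by
    have : ‖u‖ = 1 := by simpa using hu
    rw [← Complex.normSq_apply, Complex.normSq_eq_norm_sq, this]; norm_num
  have hre := congrArg Complex.re hsum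
  have him := congrArg Complex.im hsum
  simp only [Complex.add_re, Complex.add_im, Complex.zero_re, Complex.zero_im] at hre him
  have hneg : min (dotc u c₁) (min (dotc u c₂) (dotc u c₃)) < 0 := by
    by_contra! h
    simp only [le_min_iff] at h
    obtain ⟨h1, h2, h3⟩ := h
    have hs : dotc u c₁ + dotc u c₂ + dotc u c₃ = 0 := by
      unfold dotc
      linear_combination u.re * hre + u.im * him
    apply hcol
    rw [collinear_iff_exists_forall_eq_smul_vadd]
    refine ⟨0, Complex.I * u, ?_⟩
    have key : ∀ c : ℂ, dotc u c = 0 → ∃ r : ℝ, c = r • (Complex.I * u) +ᵥ (0:ℂ) := by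
      intro c hc
      unfold dotc at hc
      refine ⟨c.im * u.re - c.re * u.im, ?_⟩
      apply Complex.ext
      · simp
        linear_combination (-c.re) * hu1 + u.re * hc
      · simp
        linear_combination (-c.im) * hu1 + u.im * hc
    intro p hp
    simp only [mem_insert_iff, mem_singleton_iff] at hp
    rcases hp with rfl | rfl | rfl <;> apply key <;> linarith
  set m := min (dotc u c₁) (min (dotc u c₂) (dotc u c₃)) with hm
  refine ⟨min 1 (-m), lt_min one_pos (by linarith), min_le_left _ _, ?_⟩
  intro w
  have hk : m ≤ -(min 1 (-m)) := by linarith [min_le_right 1 (-m)]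
  by_cases hw : w = 0
  · left; simp [hw, dotc]
  have hwn : 0 < ‖w‖ := norm_pos_iff.mpr hw
  have hv : ((‖w‖⁻¹ : ℝ) : ℂ) * w ∈ sphere (0:ℂ) 1 := by
    simp [hwn.ne']
  have h := hmax hv
  simp only [mem_ofPred_eq] at h
  have hd : ∀ c, dotc (((‖w‖⁻¹ : ℝ) : ℂ) * w) c = ‖w‖⁻¹ * dotc w c := by
    intro c
    simp only [dotc, Complex.re_ofReal_mul, Complex.im_ofReal_mul]
    ring
  have hc : ∀ c, dotc (((‖w‖⁻¹ : ℝ) : ℂ) * w) c ≤ m → dotc w c ≤ -(min 1 (-m)) * ‖w‖ := by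
    intro c h
    rw [hd, inv_mul_le_iff₀ hwn] at h
    nlinarith
  rw [min_le_iff, min_le_iff] at h
  rcases h with h | h | h
  · exact Or.inl (hc _ h)
  · exact Or.inr (Or.inl (hc _ h))
  · exact Or.inr (Or.inr (hc _ h))

lemma norm_bound (w c : ℂ) (κ M e α : ℝ) (hκ : 0 < κ) (hκ1 : κ ≤ 1) (hM : 1 ≤ M)
    (hc : ‖c‖ ≤ M) (he : 0 < e) (heM : e * M ^ 2 ≤ κ / 2) (hα : 0 < α) (hαe : α ≤ e * κ / 6)
    (hd : dotc w c ≤ -κ * ‖w‖) (hw : ‖w‖ ≤ 1 + α) : ‖w + (e : ℂ) * c‖ < 1 - α := by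
  have he2 : e ≤ 1 / 2 := by
    have : 1 ≤ M ^ 2 := one_le_pow₀ hM
    nlinarith
  have hα2 : α ≤ 1 / 12 := by nlinarith
  have hsq : ‖w + (e : ℂ) * c‖ ^ 2 = ‖w‖ ^ 2 + 2 * e * dotc w c + e ^ 2 * ‖c‖ ^ 2 := by
    rw [Complex.sq_norm, Complex.sq_norm, Complex.sq_norm]
    simp only [Complex.normSq_apply, dotc, Complex.add_re, Complex.add_im,
      Complex.re_ofReal_mul, Complex.im_ofReal_mul]
    ring
  have hc2 : e ^ 2 * ‖c‖ ^ 2 ≤ e * (κ / 2) := by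
    have : ‖c‖ ^ 2 ≤ M ^ 2 := by gcongr
    nlinarith [mul_le_mul_of_nonneg_left this (sq_nonneg e)]
  have h1 : ‖w + (e : ℂ) * c‖ ^ 2 ≤ ‖w‖ * (‖w‖ - 2 * e * κ) + e * (κ / 2) := by
    rw [hsq]; nlinarith
  have hek : e * κ ≤ 1 / 2 := by nlinarith
  have hek0 : 0 < e * κ := by positivity
  have h2 : ‖w + (e : ℂ) * c‖ ^ 2 < (1 - α) ^ 2 := by
    refine lt_of_le_of_lt h1 ?_
    by_cases hr : ‖w‖ ≤ 2 * e * κ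
    · nlinarith [norm_nonneg w]
    · push Not at hr
      have : ‖w‖ * (‖w‖ - 2 * e * κ) ≤ (1 + α) * (1 + α - 2 * e * κ) := by
        apply mul_le_mul hw (by linarith) (by linarith) (by linarith)
      nlinarith
  exact lt_of_pow_lt_pow_left₀ 2 (by linarith) h2

/-- The sets H. -/
def HH (ρ c : ℂ) (ε s : ℝ) : Set ℂ :=
  {z | ‖z‖ < 1 ∧ ‖ρ * z + (ε : ℂ) * c‖ < s ∧ ‖ρ * z + ((3 * ε : ℝ) : ℂ) * c‖ < s}

lemma HH_open (ρ c : ℂ) (ε s : ℝ) : IsOpen (HH ρ c ε s) := by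
  have h1 : IsOpen {z : ℂ | ‖z‖ < 1} := isOpen_lt (by fun_prop) (by fun_prop)
  have h2 : ∀ d : ℂ, IsOpen {z : ℂ | ‖ρ * z + d‖ < s} :=
    fun d => isOpen_lt (by fun_prop) (by fun_prop)
  exact h1.inter ((h2 _).inter (h2 _))

lemma HH_cl (ρ c : ℂ) (ε s : ℝ) (hs : s < 1) :
    closure ((fun z => ρ * z + (ε : ℂ) * c) '' HH ρ c ε s) ⊆ ball 0 1 := by
  refine Subset.trans (closure_minimal (t := closedBall 0 s) ?_ isClosed_closedBall)
    (closedBall_subset_ball hs)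
  rintro _ ⟨z, hz, rfl⟩
  simpa using hz.2.1.le

lemma HH_cl3 (ρ c : ℂ) (ε s : ℝ) (hs : s < 1) :
    closure ((fun z => ρ * z + (ε : ℂ) * c) '' ((3:ℂ)⁻¹ • HH ρ c ε s)) ⊆
      (3:ℂ)⁻¹ • ball (0:ℂ) 1 := by
  rw [_root_.smul_ball (by norm_num)]
  refine Subset.trans (closure_minimal (t := closedBall 0 (s / 3)) ?_ isClosed_closedBall) ?_
  · rintro _ ⟨_, ⟨z, hz, rfl⟩, rfl⟩
    have h := hz.2.2
    have e : ρ * ((3:ℂ)⁻¹ * z) + (ε : ℂ) * c = 3⁻¹ * (ρ * z + ((3 * ε : ℝ) : ℂ) * c) := by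
      push_cast; ring
    simp only [smul_eq_mul, mem_closedBall, dist_zero_right]
    rw [e, norm_mul]
    have : ‖(3:ℂ)⁻¹‖ = 1 / 3 := by simp
    rw [this]
    linarith
  · simp only [smul_zero]
    apply closedBall_subset_ball
    have : ‖(3:ℂ)⁻¹‖ = 1 / 3 := by simp
    rw [this]; linarith

/-- Lemma 3.2: given three non-collinear points `c₁, c₂, c₃` summing to `0`, for every `η > 0`
there are arbitrarily small `ε₀, α₀ ∈ (0, η)` such that for every `ρ` with
`1 - α₀ ≤ |ρ| ≤ 1 + α₀`, the maps `φⱼ z = ρ z + ε₀ cⱼ` satisfy the covering and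
contraction properties of the statement. -/
theorem stmt_0 (c₁ c₂ c₃ : ℂ)
    (hcol : ¬ Collinear ℝ ({c₁, c₂, c₃} : Set ℂ))
    (hsum : c₁ + c₂ + c₃ = 0) (η : ℝ) (hη : 0 < η) :
    ∃ ε₀ α₀ : ℝ, 0 < ε₀ ∧ ε₀ < η ∧ 0 < α₀ ∧ α₀ < η ∧
      ∀ ρ : ℂ, 1 - α₀ ≤ ‖ρ‖ → ‖ρ‖ ≤ 1 + α₀ →
        (closure (ball (0:ℂ) 1) ⊆
            (fun z => ρ * z + (ε₀ : ℂ) * c₁) '' ball 0 1 ∪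
            (fun z => ρ * z + (ε₀ : ℂ) * c₂) '' ball 0 1 ∪
            (fun z => ρ * z + (ε₀ : ℂ) * c₃) '' ball 0 1) ∧
        ∃ H₁ H₂ H₃ : Set ℂ, IsOpen H₁ ∧ IsOpen H₂ ∧ IsOpen H₃ ∧
          ball (0:ℂ) 1 = H₁ ∪ H₂ ∪ H₃ ∧
          closure ((fun z => ρ * z + (ε₀ : ℂ) * c₁) '' H₁) ⊆ ball 0 1 ∧
          closure ((fun z => ρ * z + (ε₀ : ℂ) * c₂) '' H₂) ⊆ ball 0 1 ∧
          closure ((fun z => ρ * z + (ε₀ : ℂ) * c₃) '' H₃) ⊆ ball 0 1 ∧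
          closure ((fun z => ρ * z + (ε₀ : ℂ) * c₁) '' (((3:ℂ)⁻¹) • H₁)) ⊆ ((3:ℂ)⁻¹) • ball (0:ℂ) 1 ∧
          closure ((fun z => ρ * z + (ε₀ : ℂ) * c₂) '' (((3:ℂ)⁻¹) • H₂)) ⊆ ((3:ℂ)⁻¹) • ball (0:ℂ) 1 ∧
          closure ((fun z => ρ * z + (ε₀ : ℂ) * c₃) '' (((3:ℂ)⁻¹) • H₃)) ⊆ ((3:ℂ)⁻¹) • ball (0:ℂ) 1 := by
  obtain ⟨κ, hκ, hκ1, hdir⟩ := exists_kappa c₁ c₂ c₃ hcol hsum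
  obtain ⟨M, hM, hM1, hM2, hM3⟩ : ∃ M : ℝ, 1 ≤ M ∧ ‖c₁‖ ≤ M ∧ ‖c₂‖ ≤ M ∧ ‖c₃‖ ≤ M :=
    ⟨1 + ‖c₁‖ + ‖c₂‖ + ‖c₃‖, by linarith [norm_nonneg c₁, norm_nonneg c₂, norm_nonneg c₃],
      by linarith [norm_nonneg c₁, norm_nonneg c₂, norm_nonneg c₃],
      by linarith [norm_nonneg c₁, norm_nonneg c₂, norm_nonneg c₃],
      by linarith [norm_nonneg c₁, norm_nonneg c₂, norm_nonneg c₃]⟩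
  obtain ⟨ε, hε, hεη, hεM⟩ : ∃ ε : ℝ, 0 < ε ∧ ε < η ∧ ε * M ^ 2 ≤ κ / 6 := by
    have hM0 : 0 < M ^ 2 := by positivity
    refine ⟨min (η / 2) (κ / 6 / M ^ 2), lt_min (by linarith) (by positivity),
      lt_of_le_of_lt (min_le_left _ _) (by linarith), ?_⟩
    rw [← le_div_iff₀ hM0]
    exact min_le_right _ _
  have hα : 0 < ε * κ / 6 := by positivity
  have hαη : ε * κ / 6 < η := by nlinarith
  obtain ⟨α, hαd⟩ : ∃ α, α = ε * κ / 6 := ⟨_, rfl⟩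
  rw [← hαd] at hα hαη
  have hα1 : α < 1 := by nlinarith
  have B : ∀ w c : ℂ, ‖c‖ ≤ M → ‖w‖ ≤ 1 + α → dotc w c ≤ -κ * ‖w‖ →
      ‖w + (ε : ℂ) * c‖ < 1 - α ∧ ‖w + ((3 * ε : ℝ) : ℂ) * c‖ < 1 - α := by
    intro w c hc hw hd
    exact ⟨norm_bound w c κ M ε α hκ hκ1 hM hc hε (by linarith) hα hαd.le hd hw,
      norm_bound w c κ M (3 * ε) α hκ hκ1 hM hc (by linarith) (by linarith) hα
        (by nlinarith) hd hw⟩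
  refine ⟨ε, α, hε, hεη, hα, hαη, ?_⟩
  intro ρ hρ1 hρ2
  constructor
  · intro y hy
    have hy1 : ‖y‖ ≤ 1 := by simpa using closure_ball_subset_closedBall hy
    have hρ0 : 0 < ‖ρ‖ := by linarith
    have hρ : ρ ≠ 0 := norm_pos_iff.mp hρ0
    have key : ∀ c : ℂ, ‖c‖ ≤ M → dotc (-y) c ≤ -κ * ‖-y‖ →
        y ∈ (fun z => ρ * z + (ε : ℂ) * c) '' ball 0 1 := by
      intro c hc hd
      have h := (B (-y) c hc (by rw [norm_neg]; linarith) hd).1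
      refine ⟨(y - ε * c) / ρ, ?_, ?_⟩
      · rw [mem_ball_zero_iff, norm_div, div_lt_one hρ0, ← norm_neg]
        have e : -(y - ε * c) = -y + ε * c := by ring
        rw [e]; linarith
      · simp only
        field_simp
        ring
    rcases hdir (-y) with h | h | h
    · exact Or.inl (Or.inl (key _ hM1 h))
    · exact Or.inl (Or.inr (key _ hM2 h))
    · exact Or.inr (key _ hM3 h)
  · have hs : 1 - α < 1 := by linarith
    refine ⟨HH ρ c₁ ε (1 - α), HH ρ c₂ ε (1 - α), HH ρ c₃ ε (1 - α), HH_open _ _ _ _,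
      HH_open _ _ _ _, HH_open _ _ _ _, ?_, HH_cl _ _ _ _ hs, HH_cl _ _ _ _ hs,
      HH_cl _ _ _ _ hs, HH_cl3 _ _ _ _ hs, HH_cl3 _ _ _ _ hs, HH_cl3 _ _ _ _ hs⟩
    apply Subset.antisymm
    · intro z hz
      have hz1 : ‖z‖ < 1 := by simpa using hz
      have hw : ‖ρ * z‖ ≤ 1 + α := by
        rw [norm_mul]
        nlinarith [norm_nonneg z, norm_nonneg ρ]
      rcases hdir (ρ * z) with h | h | h
      · exact Or.inl (Or.inl ⟨hz1, B _ _ hM1 hw h⟩)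
      · exact Or.inl (Or.inr ⟨hz1, B _ _ hM2 hw h⟩)
      · exact Or.inr ⟨hz1, B _ _ hM3 hw h⟩
    · rintro z ((h | h) | h) <;> simpa using h.1
end

section
/- Let c₁, c₂, c₃ ∈ ℂ be three points that are not collinear and satisfy c₁ + c₂ + c₃ = 0 (in particular each cⱼ ≠ 0). Then for every z ∈ ℂ∖{0} there exists j ∈ {1,2,3} with Re(z·cⱼ⁻¹) > 0; equivalently, the three open half-planes {z ∈ ℂ : Re(z·cⱼ⁻¹) > 0}, j = 1,2,3, cover ℂ∖{0}. -/
lemma aux_inner (z c : ℂ) (h : (z * c⁻¹).re ≤ 0) : z.re * c.re + z.im * c.im ≤ 0 := by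
  by_cases hc : c = 0
  · simp [hc]
  have hp : 0 < Complex.normSq c := Complex.normSq_pos.2 hc
  have e : (z * c⁻¹).re = (z.re * c.re + z.im * c.im) / Complex.normSq c := by
    simp only [Complex.mul_re, Complex.inv_re, Complex.inv_im]
    ring
  rw [e, div_le_iff₀ hp] at h
  linarith

lemma aux_line (z c : ℂ) (hz : z ≠ 0) (h : z.re * c.re + z.im * c.im = 0) :
    ∃ r : ℝ, c = r • (Complex.I * z) +ᵥ (0 : ℂ) := by
  have hp : Complex.normSq z ≠ 0 := (Complex.normSq_pos.2 hz).ne'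
  refine ⟨(c.im * z.re - c.re * z.im) / Complex.normSq z, ?_⟩
  apply Complex.ext
  · simp
    field_simp
    rw [Complex.normSq_apply]
    linear_combination z.re * h
  · simp
    field_simp
    rw [Complex.normSq_apply]
    linear_combination z.im * h

/-- The covering claim from the proof of Lemma 3.2: if `c₁, c₂, c₃` are non-collinear and
sum to `0`, then the three open half-planes `{z | Re (z cⱼ⁻¹) > 0}` cover `ℂ ∖ {0}`. -/
theorem stmt_1 (c₁ c₂ c₃ : ℂ)
    (hcol : ¬ Collinear ℝ ({c₁, c₂, c₃} : Set ℂ))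
    (hsum : c₁ + c₂ + c₃ = 0) (z : ℂ) (hz : z ≠ 0) :
    0 < (z * c₁⁻¹).re ∨ 0 < (z * c₂⁻¹).re ∨ 0 < (z * c₃⁻¹).re := by
  by_contra hcon
  simp only [not_or, not_lt] at hcon
  obtain ⟨h1, h2, h3⟩ := hcon
  have h1 := aux_inner _ _ h1
  have h2 := aux_inner _ _ h2
  have h3 := aux_inner _ _ h3
  have hre : c₁.re + c₂.re + c₃.re = 0 := by simpa using congrArg Complex.re hsum
  have him : c₁.im + c₂.im + c₃.im = 0 := by simpa using congrArg Complex.im hsum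
  have hs : (z.re * c₁.re + z.im * c₁.im) + (z.re * c₂.re + z.im * c₂.im)
      + (z.re * c₃.re + z.im * c₃.im) = 0 := by
    linear_combination z.re * hre + z.im * him
  apply hcol
  rw [collinear_iff_exists_forall_eq_smul_vadd]
  refine ⟨0, Complex.I * z, ?_⟩
  intro p hp
  simp only [Set.mem_insert_iff, Set.mem_singleton_iff] at hp
  rcases hp with rfl | rfl | rfl <;> exact aux_line _ _ hz (by linarith)
end

section
/- Let q be a polynomial of degree d ≥ 2, m₁ ≥ 1, and let r₁, r₂, r₃ be three distinct points with q^{m₁}(rᵢ) = rᵢ and |χᵢ| > 1, where χᵢ := (q^{m₁})'(rᵢ), such that no rᵢ belongs to the postcritical set P(q). Then there exist A > 0, l₀ ≥ 1, a₁ > 0, a₂ ∈ (0,1), and for each i ∈ {1,2,3} a sequence (Vᵢ^l)_{l ≥ 0} of connected open neighborhoods of rᵢ such that: q^{m₁}(Vᵢ^{l+1}) = Vᵢ^l for all l ≥ 0; diam(Vᵢ^l) ≤ a₁·a₂^l for all l ≥ 0; and for every l ≥ l₀: (i) |(q^{l·m₁})'(w)| ≥ A·|χᵢ|^l > 1 for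 all w ∈ Vᵢ^l; (ii) closure(V₁^l ∪ V₂^l ∪ V₃^l) ⊆ q^{l·m₁}(Vᵢ^l); (iii) for all i, j ∈ {1,2,3}, the map q^{l·m₁} restricted to Wᵢⱼ^l := Vᵢ^l ∩ (q^{l·m₁})⁻¹(Vⱼ^l) is injective with image exactly Vⱼ^l. -/
open Metric Set

lemma aux_root {g : ℂ → ℂ} {c : ℂ} {ε : ℝ} (hε : 0 < ε) (hg : DifferentiableOn ℂ g (ball c ε))
    (h0 : ∀ z ∈ ball c ε, g z ≠ 0) (k : ℕ) (hk : k ≠ 0) :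
    ∃ h : ℂ → ℂ, DifferentiableOn ℂ h (ball c ε) ∧ ∀ z ∈ ball c ε, h z ^ k = g z := by
  have hd : DifferentiableOn ℂ (fun z => deriv g z / g z) (ball c ε) :=
    (hg.deriv isOpen_ball).div hg h0
  obtain ⟨H, hH0, hH⟩ := hd.isExactOn_ball.with_val_at c (Complex.log (g c))
  have hc : c ∈ ball c ε := mem_ball_self hε
  have key : ∀ z ∈ ball c ε, HasDerivAt (fun z => g z * Complex.exp (-H z)) 0 z := by
    intro z hz
    have h1 := (hg.differentiableAt (isOpen_ball.mem_nhds hz)).hasDerivAt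
    have h2 := (hH z hz)
    convert! h1.mul (h2.neg.cexp) using 1
    have := h0 z hz
    field_simp
    ring
  have hconst : ∀ z ∈ ball c ε, g z = Complex.exp (H z) := by
    intro z hz
    have := (convex_ball c ε).is_const_of_fderivWithin_eq_zero (𝕜 := ℂ)
      (f := fun z => g z * Complex.exp (-H z))
      (fun z hz => (key z hz).differentiableAt.differentiableWithinAt)
      (fun z hz => by
        rw [fderivWithin_of_isOpen isOpen_ball hz]
        ext; simp [(key z hz).deriv]) hz hc
    simp only [hH0, Complex.exp_neg, Complex.exp_log (h0 c hc)] at this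
    rw [mul_inv_cancel₀ (h0 c hc)] at this
    have h3 := Complex.exp_ne_zero (H z)
    field_simp at this
    exact this
  refine ⟨fun z => Complex.exp (H z / k), ?_, ?_⟩
  · intro z hz
    exact ((hH z hz).differentiableAt.div_const _).cexp.differentiableWithinAt
  · intro z hz
    rw [← Complex.exp_nat_mul, hconst z hz]
    congr 1
    have : (k : ℂ) ≠ 0 := by exact_mod_cast hk
    field_simp

open Filter Topology in
lemma aux_limit {F : ℕ → ℂ → ℂ} {c : ℂ} {ε C : ℝ} (U : Ultrafilter ℕ)
    (hF : ∀ n, DifferentiableOn ℂ (F n) (ball c ε)) (hC : ∀ n, ∀ z ∈ ball c ε, ‖F n z‖ ≤ C) :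
    ∃ G : ℂ → ℂ, DifferentiableOn ℂ G (ball c ε) ∧
      ∀ z ∈ ball c ε, Tendsto (fun n => F n z) U (𝓝 (G z)) := by
  have h1 : ∀ z, ∃ y, z ∈ ball c ε → Tendsto (fun n => F n z) U (𝓝 y) := by
    intro z
    by_cases hz : z ∈ ball c ε
    · have hcomp : IsCompact (closedBall (0:ℂ) C) := isCompact_closedBall 0 C
      have := hcomp.ultrafilter_le_nhds (U.map (fun n => F n z)) (by
        rw [le_principal_iff, Ultrafilter.coe_map, Filter.mem_map]
        exact Filter.Eventually.of_forall (fun n => by simpa using hC n z hz))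
      obtain ⟨y, -, hy⟩ := this
      exact ⟨y, fun _ => hy⟩
    · exact ⟨0, fun h => absurd h hz⟩
  choose G hG using h1
  refine ⟨G, ?_, hG⟩
  have hloc : TendstoLocallyUniformlyOn F G (U : Filter ℕ) (ball c ε) := by
    rw [Metric.tendstoLocallyUniformlyOn_iff]
    intro e he x hx
    obtain ⟨ρ, hρ, hρs⟩ := Metric.isOpen_iff.1 isOpen_ball x hx
    have hC0 : 0 ≤ C := (norm_nonneg _).trans (hC 0 x hx)
    set M := (2 * C + 1) / ρ with hM
    have hM0 : 0 < M := by positivity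
    have hlip : ∀ n, ∀ y ∈ ball x ρ, dist (F n y) (F n x) ≤ M * dist y x := by
      intro n y hy
      refine Complex.dist_le_div_mul_dist_of_mapsTo_ball ((hF n).mono hρs) ?_ hy
      intro w hw
      rw [mem_closedBall, dist_eq_norm]
      have := norm_sub_le (F n w) (F n x)
      have := hC n w (hρs hw)
      have := hC n x hx
      linarith
    have hlipG : ∀ y ∈ ball x ρ, dist (G y) (G x) ≤ M * dist y x := by
      intro y hy
      exact le_of_tendsto ((hG y (hρs hy)).dist (hG x hx))
        (Eventually.of_forall fun n => hlip n y hy)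
    refine ⟨ball x (min ρ (e / (3 * M))), mem_nhdsWithin_of_mem_nhds (ball_mem_nhds x (by positivity)), ?_⟩
    have hev := (Metric.tendsto_nhds.1 (hG x hx)) (e / 3) (by positivity)
    filter_upwards [hev] with n hn y hy
    rw [mem_ball, lt_min_iff] at hy
    have a1 := hlip n y hy.1
    have a2 := hlipG y hy.1
    have a3 : M * dist y x < e / 3 := by
      have := mul_lt_mul_of_pos_left hy.2 hM0
      have h4 : M * (e / (3 * M)) = e / 3 := by field_simp
      linarith
    have t1 := dist_triangle4 (G y) (G x) (F n x) (F n y)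
    rw [dist_comm (G x), dist_comm (F n x) (F n y)] at t1
    linarith
  exact hloc.differentiableOn (Eventually.of_forall hF) isOpen_ball

lemma aux_upper (f : Polynomial ℂ) : ∃ M : ℝ, 1 ≤ M ∧
    ∀ w : ℂ, max 1 ‖f.eval w‖ ≤ M * max 1 ‖w‖ ^ f.natDegree := by
  refine ⟨1 + ∑ k ∈ Finset.range (f.natDegree + 1), ‖f.coeff k‖, ?_, ?_⟩
  · have : 0 ≤ ∑ k ∈ Finset.range (f.natDegree + 1), ‖f.coeff k‖ := by positivity
    linarith
  · intro w
    have hx : (1:ℝ) ≤ max 1 ‖w‖ := le_max_left _ _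
    have hxp : (1:ℝ) ≤ max 1 ‖w‖ ^ f.natDegree := one_le_pow₀ hx
    have hS : 0 ≤ ∑ k ∈ Finset.range (f.natDegree + 1), ‖f.coeff k‖ := by positivity
    have h2 : ‖f.eval w‖ ≤ (∑ k ∈ Finset.range (f.natDegree + 1), ‖f.coeff k‖) * max 1 ‖w‖ ^ f.natDegree := by
      rw [Polynomial.eval_eq_sum_range, Finset.sum_mul]
      refine (norm_sum_le _ _).trans (Finset.sum_le_sum fun k hk => ?_)
      rw [norm_mul, norm_pow]
      gcongr
      calc ‖w‖ ^ k ≤ max 1 ‖w‖ ^ k := by gcongr; exact le_max_right _ _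
        _ ≤ _ := pow_le_pow_right₀ hx (by simp at hk; omega)
    refine max_le ?_ ?_ <;> nlinarith

open Filter Topology in
lemma aux_lower (f : Polynomial ℂ) (hf : f ≠ 0) : ∃ m R : ℝ, 0 < m ∧ m ≤ 1 ∧
    ∀ w : ℂ, R ≤ ‖w‖ → m * ‖w‖ ^ f.natDegree ≤ ‖f.eval w‖ := by
  have hl : 0 < ‖f.leadingCoeff‖ := by simpa using hf
  have hc : Tendsto (fun w => ‖f.reverse.eval w‖) (𝓝 0) (𝓝 ‖f.leadingCoeff‖) := by
    have : f.leadingCoeff = f.reverse.eval 0 := by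
      rw [← Polynomial.coeff_zero_eq_eval_zero, Polynomial.coeff_zero_reverse]
    rw [this]
    exact (f.reverse.continuous.norm.tendsto 0)
  have hev := hc.eventually (lt_mem_nhds (half_lt_self hl))
  obtain ⟨δ, hδ, hδb⟩ := Metric.eventually_nhds_iff.1 hev
  refine ⟨min 1 (‖f.leadingCoeff‖ / 2), 2 / δ, by positivity, min_le_left _ _, ?_⟩
  intro w hw
  have hw0 : 0 < ‖w‖ := lt_of_lt_of_le (by positivity) hw
  have hwne : w ≠ 0 := norm_pos_iff.1 hw0
  have h1 : dist w⁻¹ 0 < δ := by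
    rw [dist_zero_right, norm_inv, inv_lt_comm₀ hw0 hδ]
    refine lt_of_lt_of_le ?_ hw
    rw [div_eq_mul_inv]
    have : 0 < δ⁻¹ := by positivity
    linarith
  have h2 := hδb h1
  have h3 : f.reverse.eval w⁻¹ * w ^ f.natDegree = f.eval w := by
    let := invertibleOfNonzero hwne
    have := Polynomial.eval₂_reverse_mul_pow (RingHom.id ℂ) w f
    simpa using this
  rw [← h3, norm_mul, norm_pow]
  gcongr
  exact (min_le_right _ _).trans h2.le

open Filter Topology in
lemma aux_lt_one {D : ℕ} (hD : 2 ≤ D) {U : Filter ℕ} (hU : U ≤ atTop) {a : ℕ → ℝ} {L : ℝ}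
    (ha : ∀ n, 0 ≤ a n) (h : Tendsto a U (𝓝 L)) (hL : L < 1) :
    Tendsto (fun n => a n ^ (D ^ n)) U (𝓝 0) := by
  obtain ⟨θ, h1, h2⟩ := exists_between (max_lt hL zero_lt_one)
  rw [max_lt_iff] at h1
  have hk : Tendsto (fun n : ℕ => D ^ n) U atTop :=
    (tendsto_pow_atTop_atTop_of_one_lt (by omega)).mono_left hU
  have h3 : Tendsto (fun n => θ ^ (D ^ n)) U (𝓝 0) :=
    (tendsto_pow_atTop_nhds_zero_of_lt_one h1.2.le h2).comp hk
  refine squeeze_zero' (Eventually.of_forall fun n => pow_nonneg (ha n) _) ?_ h3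
  filter_upwards [h.eventually (gt_mem_nhds h1.1)] with n hn
  exact pow_le_pow_left₀ (ha n) hn.le _

open Filter Topology in
lemma aux_gt_one {D : ℕ} (hD : 2 ≤ D) {U : Filter ℕ} (hU : U ≤ atTop) {a : ℕ → ℝ} {L : ℝ}
    (h : Tendsto a U (𝓝 L)) (hL : 1 < L) :
    Tendsto (fun n => a n ^ (D ^ n)) U atTop := by
  obtain ⟨θ, h1, h2⟩ := exists_between hL
  have hk : Tendsto (fun n : ℕ => D ^ n) U atTop :=
    (tendsto_pow_atTop_atTop_of_one_lt (by omega)).mono_left hU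
  have h3 : Tendsto (fun n => θ ^ (D ^ n)) U atTop :=
    (tendsto_pow_atTop_atTop_of_one_lt h1).comp hk
  refine tendsto_atTop_mono' _ ?_ h3
  filter_upwards [h.eventually (lt_mem_nhds h2)] with n hn
  exact pow_le_pow_left₀ (by linarith) hn.le _

lemma aux_upper_iter (f : Polynomial ℂ) (hD : 2 ≤ f.natDegree) : ∃ M : ℝ, 1 ≤ M ∧
    ∀ (w : ℂ) (n : ℕ), M * max 1 ‖(fun w => f.eval w)^[n] w‖ ≤ (M * max 1 ‖w‖) ^ (f.natDegree ^ n) := by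
  obtain ⟨M, hM, h⟩ := aux_upper f
  refine ⟨M, hM, fun w n => ?_⟩
  induction n with
  | zero => simp
  | succ n ih =>
    rw [Function.iterate_succ_apply', pow_succ, pow_mul]
    set x := (fun w => f.eval w)^[n] w
    calc M * max 1 ‖f.eval x‖ ≤ M * (M * max 1 ‖x‖ ^ f.natDegree) := by gcongr; exact h x
      _ = M ^ 2 * max 1 ‖x‖ ^ f.natDegree := by ring
      _ ≤ M ^ f.natDegree * max 1 ‖x‖ ^ f.natDegree := by
          gcongr
      _ = (M * max 1 ‖x‖) ^ f.natDegree := by rw [mul_pow]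
      _ ≤ _ := by gcongr

lemma aux_lower_iter (f : Polynomial ℂ) (hD : 2 ≤ f.natDegree) (s : ℂ) : ∃ R : ℝ, 
    ∀ w : ℂ, R ≤ ‖w‖ → ∀ n : ℕ, 2 ^ (f.natDegree ^ n) ≤ ‖(fun w => f.eval w)^[n] w - s‖ := by
  obtain ⟨m, R₀, hm, hm1, h⟩ := aux_lower f (by rintro rfl; simp at hD)
  refine ⟨max R₀ (max (4 / m) (2 * ‖s‖)), fun w hw n => ?_⟩
  have key : max R₀ (max (4 / m) (2 * ‖s‖)) ≤ ‖(fun w => f.eval w)^[n] w‖ ∧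
      4 ^ (f.natDegree ^ n) ≤ m * ‖(fun w => f.eval w)^[n] w‖ := by
    induction n with
    | zero =>
      refine ⟨hw, ?_⟩
      have : 4 / m ≤ ‖w‖ := (le_max_left _ _).trans ((le_max_right _ _).trans hw)
      rw [div_le_iff₀ hm] at this
      simpa [mul_comm] using this
    | succ n ih =>
      rw [Function.iterate_succ_apply']
      set x := (fun w => f.eval w)^[n] w
      obtain ⟨i1, i2⟩ := ih
      have hx := h x ((le_max_left _ _).trans i1)
      have h5 : (m * ‖x‖) ^ f.natDegree ≤ m * ‖f.eval x‖ := by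
        calc (m * ‖x‖) ^ f.natDegree = m ^ f.natDegree * ‖x‖ ^ f.natDegree := mul_pow _ _ _
          _ ≤ m ^ 2 * ‖x‖ ^ f.natDegree := by
            gcongr ?_ * _
            exact pow_le_pow_of_le_one hm.le hm1 hD
          _ = m * (m * ‖x‖ ^ f.natDegree) := by ring
          _ ≤ _ := by gcongr
      have hx4 : 4 ≤ m * ‖x‖ := by
        have : 4 / m ≤ ‖x‖ := (le_max_left _ _).trans ((le_max_right _ _).trans i1)
        rw [div_le_iff₀ hm] at this
        linarith
      constructor
      · refine i1.trans ?_
        have : m * ‖x‖ ≤ m * ‖f.eval x‖ := le_trans (le_self_pow₀ (by linarith) (by omega)) h5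
        exact le_of_mul_le_mul_left this hm
      · refine le_trans ?_ h5
        rw [pow_succ, pow_mul]
        gcongr
  set x := (fun w => f.eval w)^[n] w
  have h6 : 2 * ‖s‖ ≤ ‖x‖ := (le_max_right _ _).trans ((le_max_right _ _).trans key.1)
  have h7 : (2:ℝ) ^ (f.natDegree ^ n) * 2 ≤ 4 ^ (f.natDegree ^ n) := by
    have : (4:ℝ) = 2 * 2 := by norm_num
    rw [this, mul_pow]
    gcongr
    exact le_self_pow₀ (by norm_num) (by positivity)
  have h8 := norm_sub_norm_le x s
  have h9 : m * ‖x‖ ≤ ‖x‖ := mul_le_of_le_one_left (norm_nonneg _) hm1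
  linarith [key.2]

open Filter Topology in
lemma aux_family (f : Polynomial ℂ) (hD : 2 ≤ f.natDegree) (r s : ℂ) (ε : ℝ) (hε : 0 < ε)
    (h : ∀ n, ∀ z ∈ ball r ε, (fun w => f.eval w)^[n] z ≠ s) (U : Ultrafilter ℕ) :
    ∃ (F : ℕ → ℂ → ℂ) (G : ℂ → ℂ), DifferentiableOn ℂ G (ball r ε) ∧
      (∀ n, ∀ z ∈ ball r ε, ‖F n z‖ ^ (f.natDegree ^ n) = ‖(fun w => f.eval w)^[n] z - s‖) ∧
      ∀ z ∈ ball r ε, Tendsto (fun n => ‖F n z‖) U (𝓝 ‖G z‖) := by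
  have hdiff : ∀ n, Differentiable ℂ (fun w => f.eval w)^[n] := fun n =>
    f.differentiable.iterate n
  have hex : ∀ n, ∃ g : ℂ → ℂ, DifferentiableOn ℂ g (ball r ε) ∧
      ∀ z ∈ ball r ε, g z ^ (f.natDegree ^ n) = (fun w => f.eval w)^[n] z - s := fun n =>
    aux_root hε ((hdiff n).sub_const s).differentiableOn
      (fun z hz => sub_ne_zero.2 (h n z hz)) _ (by positivity)
  choose F hFd hF using hex
  have hFn : ∀ n, ∀ z ∈ ball r ε,
      ‖F n z‖ ^ (f.natDegree ^ n) = ‖(fun w => f.eval w)^[n] z - s‖ := by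
    intro n z hz
    rw [← hF n z hz, norm_pow]
  obtain ⟨M, hM, hMb⟩ := aux_upper_iter f hD
  have hb : ∀ n, ∀ z ∈ ball r ε, ‖F n z‖ ≤ (1 + ‖s‖) * (M * (1 + ‖r‖ + ε)) := by
    intro n z hz
    have hk : f.natDegree ^ n ≠ 0 := by positivity
    refine le_of_pow_le_pow_left₀ hk (by positivity) ?_
    rw [hFn n z hz]
    have h1 := hMb z n
    set x := (fun w => f.eval w)^[n] z
    have h2 := norm_sub_le x s
    have h3 : max 1 ‖z‖ ≤ 1 + ‖r‖ + ε := by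
      have : ‖z‖ ≤ ‖r‖ + ‖z - r‖ := by
        have := norm_add_le r (z - r); simpa using this
      rw [mem_ball, dist_eq_norm] at hz
      have := norm_nonneg z
      have := norm_nonneg r
      refine max_le ?_ ?_ <;> linarith
    have h4 : ‖x‖ + ‖s‖ ≤ (1 + ‖s‖) * (M * max 1 ‖x‖) := by
      have a1 : (1:ℝ) ≤ max 1 ‖x‖ := le_max_left _ _
      have a2 : ‖x‖ ≤ max 1 ‖x‖ := le_max_right _ _
      have a3 : max 1 ‖x‖ ≤ M * max 1 ‖x‖ := le_mul_of_one_le_left (by positivity) hM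
      have := norm_nonneg s
      nlinarith
    calc ‖x - s‖ ≤ (1 + ‖s‖) * (M * max 1 ‖x‖) := h2.trans h4
      _ ≤ (1 + ‖s‖) ^ (f.natDegree ^ n) * (M * (1 + ‖r‖ + ε)) ^ (f.natDegree ^ n) := by
        gcongr
        · exact le_self_pow₀ (by have := norm_nonneg s; linarith) hk
        · refine h1.trans ?_
          gcongr
      _ = _ := by rw [mul_pow (1 + ‖s‖)]
  obtain ⟨G, hG, hGt⟩ := aux_limit U hFd hb
  exact ⟨F, G, hG, hFn, fun z hz => (hGt z hz).norm⟩

open Filter Topology in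
/-- If the limit has modulus one, no orbit from the ball escapes: contradiction with repulsion. -/
lemma aux_no_one (f : Polynomial ℂ) (hD : 2 ≤ f.natDegree) (r s : ℂ) (ε : ℝ) (hε : 0 < ε)
    (hr : f.eval r = r) (hrep : 1 < ‖deriv (fun w => f.eval w) r‖) (U : Ultrafilter ℕ)
    (hU : (U : Filter ℕ) ≤ atTop)
    (F : ℕ → ℂ → ℂ) (G : ℂ → ℂ)
    (hF : ∀ n, ∀ z ∈ ball r ε, ‖F n z‖ ^ (f.natDegree ^ n) = ‖(fun w => f.eval w)^[n] z - s‖)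
    (hG : ∀ z ∈ ball r ε, Tendsto (fun n => ‖F n z‖) U (𝓝 ‖G z‖))
    (h1 : ∀ z ∈ ball r ε, ‖G z‖ = 1) : False := by
  obtain ⟨R, hR⟩ := aux_lower_iter f hD s
  have hb : ∀ z ∈ ball r ε, ∀ j, ‖(fun w => f.eval w)^[j] z‖ < R := by
    intro z hz j
    by_contra! hcon
    have h2 := hR _ hcon
    have h3 : ∀ᶠ n in (U : Filter ℕ), (2:ℝ) ≤ ‖F n z‖ ^ (f.natDegree ^ j) := by
      have : ∀ᶠ n in (U : Filter ℕ), j ≤ n := hU (eventually_ge_atTop j)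
      filter_upwards [this] with n hn
      obtain ⟨k, rfl⟩ := Nat.exists_eq_add_of_le hn
      have h4 := h2 k
      rw [← Function.iterate_add_apply, add_comm k j, ← hF _ z hz, pow_add, pow_mul] at h4
      exact le_of_pow_le_pow_left₀ (by positivity) (by positivity) h4
    have h5 := ge_of_tendsto ((hG z hz).pow (f.natDegree ^ j)) h3
    rw [h1 z hz, one_pow] at h5
    norm_num at h5
  have hder : ∀ n : ℕ, ‖deriv (fun w => f.eval w) r‖ ^ n ≤ R / (ε / 2) := by
    intro n
    have hd : HasDerivAt (fun w => f.eval w) (deriv (fun w => f.eval w) r) r :=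
      f.differentiable.differentiableAt.hasDerivAt
    have h6 := (HasDerivAt.iterate r hd hr n).deriv
    rw [← norm_pow, ← h6]
    refine Complex.norm_deriv_le_of_forall_mem_sphere_norm_le (by positivity) 
      (f.differentiable.iterate n).diffContOnCl ?_
    intro z hz
    refine (hb z ?_ n).le
    rw [mem_sphere] at hz
    rw [mem_ball, hz]; linarith
  obtain ⟨n, hn⟩ := pow_unbounded_of_one_lt (R / (ε / 2)) hrep
  exact absurd (hder n) (not_le.2 hn)

lemma aux_second_root (f : Polynomial ℂ) (hD : 2 ≤ f.natDegree) (s : ℂ) (hs : f.eval s = s)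
    (hsd : deriv (fun w => f.eval w) s ≠ 0) : ∃ s', s' ≠ s ∧ f.eval s' = s := by
  have hroot : (f - Polynomial.C s).IsRoot s := by simp [hs]
  obtain ⟨g, hg⟩ := Polynomial.dvd_iff_isRoot.2 hroot
  have hdeg : g.natDegree ≠ 0 := by
    intro h0
    have h1 : (f - Polynomial.C s).natDegree = f.natDegree := Polynomial.natDegree_sub_C
    rw [hg] at h1
    have := Polynomial.natDegree_mul_le (p := Polynomial.X - Polynomial.C s) (q := g)
    rw [Polynomial.natDegree_X_sub_C] at this
    omega
  obtain ⟨s', hs'⟩ := IsAlgClosed.exists_root g (fun h => hdeg (Polynomial.natDegree_eq_of_degree_eq_some h))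
  have hfe : f = (Polynomial.X - Polynomial.C s) * g + Polynomial.C s := by rw [← hg]; ring
  have hs'0 : g.eval s' = 0 := hs'
  refine ⟨s', ?_, ?_⟩
  · rintro rfl
    apply hsd
    rw [Polynomial.deriv, hfe]
    simp [hs'0]
  · rw [hfe]; simp [hs'0]

open Filter Topology in
lemma aux_dense (f : Polynomial ℂ) (hD : 2 ≤ f.natDegree) (r s : ℂ) (hrs : r ≠ s) (ε : ℝ)
    (hε : 0 < ε) (hr : f.eval r = r) (hrep : 1 < ‖deriv (fun w => f.eval w) r‖)
    (hs : f.eval s = s) (hsd : deriv (fun w => f.eval w) s ≠ 0) :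
    ∃ n, ∃ z ∈ ball r ε, (fun w => f.eval w)^[n] z = s := by
  by_contra! hno
  obtain ⟨s', hs's, hs'⟩ := aux_second_root f hD s hs hsd
  have hno' : ∀ n, ∀ z ∈ ball r ε, (fun w => f.eval w)^[n] z ≠ s' := by
    intro n z hz h
    apply hno (n + 1) z hz
    rw [Function.iterate_succ_apply', h]
    exact hs'
  have hrs' : r ≠ s' := by
    rintro rfl
    exact hrs (hr.symm.trans hs')
  have hrb : r ∈ ball r ε := mem_ball_self hε
  let U : Ultrafilter ℕ := Ultrafilter.of atTop
  have hU : (U : Filter ℕ) ≤ atTop := Ultrafilter.of_le atTop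
  obtain ⟨F, G, hGd, hF, hG⟩ := aux_family f hD r s ε hε hno U
  obtain ⟨F', G', hGd', hF', hG'⟩ := aux_family f hD r s' ε hε hno' U
  have hone : ∀ (t : ℂ) (F : ℕ → ℂ → ℂ) (G : ℂ → ℂ), r ≠ t →
      (∀ n, ∀ z ∈ ball r ε, ‖F n z‖ ^ (f.natDegree ^ n) = ‖(fun w => f.eval w)^[n] z - t‖) →
      (∀ z ∈ ball r ε, Tendsto (fun n => ‖F n z‖) U (𝓝 ‖G z‖)) → ‖G r‖ = 1 := by
    intro t F G ht hF hG
    have hc : (fun n => ‖F n r‖ ^ (f.natDegree ^ n)) = fun _ => ‖r - t‖ := by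
      funext n
      rw [hF n r hrb, Function.iterate_fixed hr]
    rcases lt_trichotomy ‖G r‖ 1 with h | h | h
    · have := aux_lt_one hD hU (fun n => norm_nonneg _) (hG r hrb) h
      rw [hc] at this
      have := tendsto_nhds_unique this tendsto_const_nhds
      exact absurd this.symm (norm_ne_zero_iff.2 (sub_ne_zero.2 ht))
    · exact h
    · have := aux_gt_one hD hU (hG r hrb) h
      rw [hc] at this
      exact absurd this (not_tendsto_const_atTop _ _)
  have hGr := hone s F G hrs hF hG
  by_cases hcase : ∀ z ∈ ball r ε, 1 ≤ ‖G z‖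
  · refine aux_no_one f hD r s ε hε hr hrep U hU F G hF hG ?_
    have hne : ∀ z ∈ ball r ε, G z ≠ 0 := fun z hz h0 => by
      have := hcase z hz; rw [h0] at this; norm_num at this
    have hmax := Complex.eqOn_of_isPreconnected_of_isMaxOn_norm (f := fun z => (G z)⁻¹)
      (convex_ball r ε).isPreconnected isOpen_ball (hGd.inv hne) hrb (by
        intro z hz
        simp only [Function.comp, Set.mem_ofPred_eq, norm_inv, hGr]
        rw [inv_one]
        exact inv_le_one_of_one_le₀ (hcase z hz))
    intro z hz
    have := hmax hz
    simp only [Function.const] at this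
    rw [inv_inj.1 this, hGr]
  · push Not at hcase
    obtain ⟨z₀, hz₀, hlt⟩ := hcase
    refine aux_no_one f hD r s' ε hε hr hrep U hU F' G' hF' hG' ?_
    have hloc : ∀ᶠ z in 𝓝 z₀, z ∈ ball r ε ∧ ‖G z‖ < 1 := by
      refine Filter.Eventually.and (isOpen_ball.mem_nhds hz₀) ?_
      exact ((hGd.continuousOn.continuousAt (isOpen_ball.mem_nhds hz₀)).norm).eventually
        (gt_mem_nhds hlt)
    have hloc1 : ∀ z ∈ ball r ε, ‖G z‖ < 1 → ‖G' z‖ = 1 := by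
      intro z hz hlt
      have h1 := aux_lt_one hD hU (fun n => norm_nonneg _) (hG z hz) hlt
      simp only [hF _ z hz] at h1
      rcases lt_trichotomy ‖G' z‖ 1 with h | h | h
      · have h2 := aux_lt_one hD hU (fun n => norm_nonneg _) (hG' z hz) h
        simp only [hF' _ z hz] at h2
        have h3 := h1.add h2
        have h4 := ge_of_tendsto (b := ‖s' - s‖) h3 (Eventually.of_forall fun n => by
          have := norm_sub_le ((fun w => f.eval w)^[n] z - s) ((fun w => f.eval w)^[n] z - s')
          simpa using this)
        rw [add_zero, norm_le_zero_iff, sub_eq_zero] at h4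
        exact absurd h4 hs's
      · exact h
      · have h2 := aux_gt_one hD hU (hG' z hz) h
        simp only [hF' _ z hz] at h2
        have h5 := (h1.eventually (gt_mem_nhds one_pos)).and
          (h2.eventually (eventually_ge_atTop (1 + ‖s - s'‖)))
        obtain ⟨n, hn1, hn2⟩ := h5.exists
        have := norm_add_le ((fun w => f.eval w)^[n] z - s) (s - s')
        rw [sub_add_sub_cancel] at this
        linarith
    have hz₀1 := hloc1 z₀ hz₀ hlt
    have hconst : ∀ᶠ z in 𝓝 z₀, G' z = G' z₀ := by
      refine Complex.eventually_eq_of_isLocalMax_norm ?_ ?_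
      · filter_upwards [hloc] with z hz
        exact hGd'.differentiableAt (isOpen_ball.mem_nhds hz.1)
      · filter_upwards [hloc] with z hz
        simp only [Function.comp]
        rw [hz₀1, hloc1 z hz.1 hz.2]
    have han : AnalyticOnNhd ℂ G' (ball r ε) := hGd'.analyticOnNhd isOpen_ball
    intro z hz
    have := han.eqOn_of_preconnected_of_eventuallyEq (analyticOnNhd_const (v := G' z₀))
      (convex_ball r ε).isPreconnected hz₀ hconst hz
    rw [this, hz₀1]

open Filter Topology in
lemma aux_local_inj {h : ℂ → ℂ} {z a : ℂ} (hh : HasStrictDerivAt h a z) (ha : a ≠ 0) :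
    ∃ O, IsOpen O ∧ z ∈ O ∧ InjOn h O ∧ ∃ k : ℂ → ℂ, ContinuousAt k (h z) ∧ k (h z) = z ∧
      ∀ᶠ y in 𝓝 (h z), h (k y) = y := by
  have h1 := hh.hasStrictFDerivAt_equiv ha
  let e := h1.toOpenPartialHomeomorph h
  have he : (e : ℂ → ℂ) = h := h1.toOpenPartialHomeomorph_coe
  have hz : z ∈ e.source := h1.mem_toOpenPartialHomeomorph_source
  refine ⟨e.source, e.open_source, hz, ?_, e.symm, ?_, ?_, ?_⟩
  · rw [← he]; exact e.injOn
  · rw [← he]; exact e.symm.continuousAt (e.map_source hz)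
  · rw [← he]; exact e.left_inv hz
  · rw [← he]
    filter_upwards [e.open_target.mem_nhds (e.map_source hz)] with y hy
    exact e.right_inv hy

open Filter Topology in
lemma aux_repel {f : ℂ → ℂ} (hf : Differentiable ℂ f) {r : ℂ} (hr : f r = r)
    (hrep : 1 < ‖deriv f r‖) : ∃ (ε lam K : ℝ) (g : ℂ → ℂ), 0 < ε ∧ 1 < lam ∧ 0 ≤ K ∧
      (∀ w ∈ ball r ε, ∀ w' ∈ ball r ε, lam * dist w w' ≤ dist (f w) (f w')) ∧
      (∀ w ∈ ball r ε, g w ∈ ball r ε ∧ f (g w) = w) ∧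
      (∀ w ∈ ball r ε, ‖deriv f r‖ * Real.exp (- (K * dist w r)) ≤ ‖deriv f w‖) := by
  set χ := deriv f r with hχ
  have han : AnalyticAt ℂ f r := hf.analyticAt r
  have hst : HasStrictDerivAt f χ r := han.hasStrictDerivAt
  have hχ0 : χ ≠ 0 := by rintro h; rw [h] at hrep; norm_num at hrep
  obtain ⟨O, hO, hrO, hinj, g, hgc, hgr, hfg⟩ := aux_local_inj hst hχ0
  rw [hr] at hgc hgr hfg
  set η := (‖χ‖ - 1) / 2 with hη
  have hη0 : 0 < η := by rw [hη]; linarith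
  have h1 : ∀ᶠ q : ℂ × ℂ in 𝓝 (r, r), (‖χ‖ - η) * dist q.1 q.2 ≤ dist (f q.1) (f q.2) := by
    have := hst.isLittleO.def hη0
    filter_upwards [this] with q hq
    rw [dist_eq_norm, dist_eq_norm]
    have h2 := norm_sub_norm_le (χ * (q.1 - q.2)) (f q.1 - f q.2)
    rw [norm_mul, norm_sub_rev (χ * (q.1 - q.2))] at h2
    have hq' : ‖f q.1 - f q.2 - χ * (q.1 - q.2)‖ ≤ η * ‖q.1 - q.2‖ := by
      simpa [mul_comm] using hq
    linarith
  rw [nhds_prod_eq] at h1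
  obtain ⟨S, hS, hSb⟩ := (eventually_prod_self_iff (r := fun a b => (‖χ‖ - η) * dist a b ≤ dist (f a) (f b))).1 h1
  have hdd : DifferentiableAt ℂ (deriv f) r := han.deriv.differentiableAt
  obtain ⟨c, hc, hcb⟩ := hdd.isBigO_sub.exists_pos
  have hcb' := hcb.bound
  have hsm : ∀ᶠ w in 𝓝 r, 2 * c * dist w r ≤ ‖χ‖ := by
    have : Tendsto (fun w => 2 * c * dist w r) (𝓝 r) (𝓝 0) := by
      have : Continuous (fun w => 2 * c * dist w r) := by fun_prop
      simpa using this.tendsto r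
    filter_upwards [this.eventually (gt_mem_nhds (by linarith : (0:ℝ) < ‖χ‖))] with w hw using hw.le
  have hgS : ∀ᶠ w in 𝓝 r, g w ∈ S := hgc (by rw [hgr]; exact hS)
  have hall := (((show ∀ᶠ w in 𝓝 r, w ∈ S from hS).and hgS).and hfg).and (hcb'.and hsm)
  obtain ⟨ε, hε, hεb⟩ := Metric.eventually_nhds_iff_ball.1 hall
  have hlam : 1 < ‖χ‖ - η := by rw [hη]; linarith
  have hrB : r ∈ ball r ε := mem_ball_self hε
  refine ⟨ε, ‖χ‖ - η, 2 * c / ‖χ‖, g, hε, hlam, by positivity, ?_, ?_, ?_⟩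
  · intro w hw w' hw'
    exact hSb w (hεb w hw).1.1.1 w' (hεb w' hw').1.1.1
  · intro w hw
    have hfw := (hεb w hw).1.2
    refine ⟨?_, hfw⟩
    have h3 := hSb (g w) (hεb w hw).1.1.2 r (hεb r hrB).1.1.1
    simp only [hfw, hr] at h3
    rw [mem_ball] at hw ⊢
    nlinarith [dist_nonneg (x := g w) (y := r)]
  · intro w hw
    obtain ⟨b1, b2⟩ := (hεb w hw).2
    rw [← dist_eq_norm w r] at b1
    set t := dist w r with ht
    have ht0 : 0 ≤ t := dist_nonneg
    have hpos : 0 < ‖χ‖ := by linarith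
    have h4 : ‖χ‖ - c * t ≤ ‖deriv f w‖ := by
      have := norm_sub_norm_le χ (deriv f w)
      rw [norm_sub_rev] at this
      linarith
    refine le_trans ?_ h4
    rw [Real.exp_neg, ← div_eq_mul_inv, div_le_iff₀ (Real.exp_pos _)]
    have h5 := Real.add_one_le_exp (2 * c / ‖χ‖ * t)
    have h6 : 0 ≤ ‖χ‖ - c * t := by nlinarith
    refine le_trans ?_ (mul_le_mul_of_nonneg_left h5 h6)
    have h7 : (‖χ‖ - c * t) * (2 * c / ‖χ‖ * t + 1) = ‖χ‖ + (c * t / ‖χ‖) * (‖χ‖ - 2 * c * t) := by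
      field_simp
      ring
    rw [h7]
    have : 0 ≤ (c * t / ‖χ‖) * (‖χ‖ - 2 * c * t) := mul_nonneg (by positivity) (by linarith)
    linarith

lemma aux_deriv_prod {f : ℂ → ℂ} (hf : Differentiable ℂ f) {r : ℂ} (hr : f r = r)
    {ε lam K : ℝ} (hε : 0 < ε) (hlam : 1 < lam) (hK : 0 ≤ K) {X : ℝ} (hX : 0 ≤ X)
    (hexp : ∀ w ∈ ball r ε, ∀ w' ∈ ball r ε, lam * dist w w' ≤ dist (f w) (f w'))
    (hder : ∀ w ∈ ball r ε, X * Real.exp (- (K * dist w r)) ≤ ‖deriv f w‖) (k : ℕ) :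
    ∀ w, (∀ j < k, f^[j] w ∈ ball r ε) →
      X ^ k * Real.exp (K / (lam - 1) * dist w r) ≤
        ‖deriv f^[k] w‖ * Real.exp (K / (lam - 1) * dist (f^[k] w) r) := by
  induction k with
  | zero => intro w _; simp
  | succ k ih =>
    intro w hw
    have hwB : w ∈ ball r ε := hw 0 (by omega)
    have h1 := ih (f w) (fun j hj => by
      rw [← Function.iterate_succ_apply]; exact hw (j + 1) (by omega))
    have hd : deriv f^[k + 1] w = deriv f^[k] (f w) * deriv f w := by
      rw [Function.iterate_succ]
      exact deriv_comp w ((hf.iterate k) _) (hf w)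
    rw [hd, norm_mul, Function.iterate_succ_apply]
    have h2 := hder w hwB
    have h3 := hexp w hwB r (mem_ball_self hε)
    rw [hr] at h3
    set C := K / (lam - 1) with hC
    have hl : 0 < lam - 1 := by linarith
    have hCK : C * (lam - 1) = K := by rw [hC]; field_simp
    have hC0 : 0 ≤ C := by positivity
    have h4 : Real.exp (C * dist w r) ≤ Real.exp (- (K * dist w r)) * Real.exp (C * dist (f w) r) := by
      rw [← Real.exp_add, Real.exp_le_exp, ← hCK]
      nlinarith [mul_le_mul_of_nonneg_left h3 hC0]
    calc X ^ (k + 1) * Real.exp (C * dist w r)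
        ≤ X ^ (k + 1) * (Real.exp (- (K * dist w r)) * Real.exp (C * dist (f w) r)) := by gcongr
      _ = (X * Real.exp (- (K * dist w r))) * (X ^ k * Real.exp (C * dist (f w) r)) := by ring
      _ ≤ ‖deriv f w‖ * (‖deriv f^[k] (f w)‖ * Real.exp (C * dist (f^[k] (f w)) r)) := by
          gcongr
      _ = _ := by ring

open Filter Topology in
lemma aux_bij {h : ℂ → ℂ} (hc : Continuous h) {U : Set ℂ} (hU : IsOpen U) (hK : IsCompact (closure U))
    {z a : ℂ} (hz : z ∈ U) (hh : HasStrictDerivAt h a z) (ha : a ≠ 0)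
    (huniq : ∀ w ∈ closure U, h w = h z → w = z) :
    ∃ δ > 0, ∀ D ⊆ ball (h z) δ, BijOn h (U ∩ h ⁻¹' D) D := by
  obtain ⟨O, hO, hzO, hinj, k, hk, hkz, hhk⟩ := aux_local_inj hh ha
  have hO' : ∀ᶠ y in 𝓝 (h z), k y ∈ O ∩ U :=
    hk (by rw [hkz]; exact (hO.inter hU).mem_nhds ⟨hzO, hz⟩)
  have hcl : IsClosed (h '' (closure U \ O)) := ((hK.diff hO).image hc).isClosed
  have hnot : ∀ᶠ y in 𝓝 (h z), y ∉ h '' (closure U \ O) := by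
    refine hcl.isOpen_compl.mem_nhds ?_
    rintro ⟨w, hw, hwz⟩
    rw [huniq w hw.1 hwz] at hw
    exact hw.2 hzO
  obtain ⟨δ, hδ, hb⟩ := Metric.eventually_nhds_iff_ball.1 ((hO'.and hhk).and hnot)
  refine ⟨δ, hδ, fun D hD => ⟨fun w hw => hw.2, ?_, ?_⟩⟩
  · have hin : ∀ w ∈ U ∩ h ⁻¹' D, w ∈ O := by
      intro w hw
      by_contra hwO
      exact (hb _ (hD hw.2)).2 ⟨w, ⟨subset_closure hw.1, hwO⟩, rfl⟩
    intro w hw w' hw' he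
    exact hinj (hin w hw) (hin w' hw') he
  · intro y hy
    obtain ⟨⟨h1, h2⟩, -⟩ := hb y (hD hy)
    exact ⟨k y, ⟨h1.2, by simpa [h2] using hy⟩, h2⟩

lemma aux_region {c : ℂ} {ε : ℝ} (hε : 0 < ε) {F : Set ℂ} (hF : F.Finite) (z : Fin 3 → ℂ)
    (hz : ∀ j, z j ∈ ball c ε \ F) :
    ∃ U : Set ℂ, IsOpen U ∧ IsConnected U ∧ IsCompact (closure U) ∧ closure U ⊆ ball c ε \ F ∧
      ∀ j, z j ∈ U := by
  have hpc : IsPathConnected (ball c ε \ F) := by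
    let e := OpenPartialHomeomorph.univBall (E := ℂ) c ε
    have hs : e.source = univ := OpenPartialHomeomorph.univBall_source c ε
    have ht : e.target = ball c ε := OpenPartialHomeomorph.univBall_target c hε
    have hinj : Function.Injective e := by
      have := e.injOn
      rw [hs] at this
      exact injOn_univ.1 this
    have hcont : Continuous e := by
      have := e.continuousOn
      rw [hs] at this
      exact continuousOn_univ.1 this
    have h1 : IsPathConnected (e ⁻¹' F)ᶜ :=
      ((hF.preimage hinj.injOn).countable).isPathConnected_compl_of_one_lt_rank (by simp)
    have h2 := h1.image hcont
    have h3 : e '' (e ⁻¹' F)ᶜ = ball c ε \ F := by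
      rw [← preimage_compl, image_preimage_eq_inter_range, ← ht, ← e.image_source_eq_target, hs,
        image_univ, inter_comm]
      rfl
    rwa [h3] at h2
  obtain ⟨γ, hγ, hγz⟩ := hpc.exists_path_through_family (n := 2) z hz
  have hKc : IsCompact (range γ) := isCompact_range γ.continuous
  have hop : IsOpen (ball c ε \ F) := isOpen_ball.sdiff hF.isClosed
  obtain ⟨δ, hδ, hsub⟩ := hKc.exists_cthickening_subset_open hop hγ
  refine ⟨thickening δ (range γ), isOpen_thickening, ⟨?_, ?_⟩, ?_, ?_, ?_⟩
  · exact ⟨z 0, self_subset_thickening hδ _ (hγz 0)⟩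
  · have hpre : IsPreconnected (range γ) := isPreconnected_range γ.continuous
    refine isPreconnected_of_forall (z 0) ?_
    intro y hy
    obtain ⟨x, hx, hxy⟩ := mem_thickening_iff.1 hy
    refine ⟨range γ ∪ ball x δ, ?_, Or.inl (hγz 0), Or.inr hxy, ?_⟩
    · refine union_subset (self_subset_thickening hδ _) ?_
      intro w hw
      exact mem_thickening_iff.2 ⟨x, hx, hw⟩
    · exact hpre.union x hx (mem_ball_self hδ) (convex_ball x δ).isPreconnected
  · exact (hKc.cthickening (r := δ)).of_isClosed_subset isClosed_closure
      (closure_thickening_subset_cthickening _ _)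
  · exact (closure_thickening_subset_cthickening _ _).trans hsub
  · exact fun j => self_subset_thickening hδ _ (hγz j)

lemma aux_single (p : Polynomial ℂ) (f : ℂ → ℂ) (hfp : f = fun w => p.eval w)
    (s : Fin 3 → ℂ) (hs : Function.Injective s) (i : Fin 3)
    (hfix : ∀ j, f (s j) = s j) (hrep : 1 < ‖deriv f (s i)‖)
    (hdense : ∀ j, ∀ ε > 0, ∃ n, ∃ z ∈ ball (s i) ε, f^[n] z = s j)
    (hnc : ∀ n z j, f^[n] z = s j → deriv f^[n] z ≠ 0) :
    ∃ (A a₁ a₂ δ : ℝ) (N : ℕ) (V : ℕ → Set ℂ), 0 < A ∧ 0 < a₁ ∧ 0 < a₂ ∧ a₂ < 1 ∧ 0 < δ ∧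
      (∀ l, IsOpen (V l) ∧ IsConnected (V l) ∧ s i ∈ V l) ∧
      (∀ l, f '' V (l + 1) = V l) ∧
      (∀ l, ∀ x ∈ V l, ∀ y ∈ V l, dist x y ≤ a₁ * a₂ ^ l) ∧
      (∀ j, ball (s j) δ ⊆ V 0) ∧
      (∀ l, N ≤ l → ∀ w ∈ V l, A * ‖deriv f (s i)‖ ^ l ≤ ‖deriv f^[l] w‖) ∧
      (∀ l, N ≤ l → ∀ j, ∀ D ⊆ ball (s j) δ, BijOn f^[l] (V l ∩ f^[l] ⁻¹' D) D) := by
  have hf : Differentiable ℂ f := by rw [hfp]; exact p.differentiable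
  set r := s i with hrdef
  have hr : f r = r := hfix i
  obtain ⟨ε, lam, K, g, hε, hlam, hK, hexp, hg, hder⟩ := aux_repel hf hr hrep
  have hrB : r ∈ ball r ε := mem_ball_self hε
  -- preimages
  have hpre : ∀ j, ∃ n, ∃ z ∈ ball r ε, f^[n] z = s j ∧ (j = i → z = r) := by
    intro j
    by_cases hj : j = i
    · exact ⟨0, r, hrB, by simp [hj, hrdef], fun _ => rfl⟩
    · obtain ⟨n, z, hz, h⟩ := hdense j ε hε
      exact ⟨n, z, hz, h, fun h => absurd h hj⟩
  choose n z hzB hzn hzi using hpre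
  set N := ∑ j, n j with hN
  have hzN : ∀ j, f^[N] (z j) = s j := by
    intro j
    have hle : n j ≤ N := Finset.single_le_sum (f := n) (fun _ _ => Nat.zero_le _) (Finset.mem_univ j)
    obtain ⟨k, hk⟩ := Nat.exists_eq_add_of_le hle
    rw [hk, add_comm, Function.iterate_add_apply, hzn, Function.iterate_fixed (hfix j)]
  have hzr : z i = r := hzi i rfl
  -- exceptional set
  set P : Polynomial ℂ := p.comp^[N] Polynomial.X with hP
  have hPe : (fun w => P.eval w) = f^[N] := by
    funext w
    rw [hP, Polynomial.iterate_comp_eval, Polynomial.eval_X, hfp]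
  have hPd : ∀ w, P.derivative.eval w = deriv f^[N] w := by
    intro w; rw [← hPe, Polynomial.deriv]
  have hPd0 : P.derivative ≠ 0 := by
    intro h0
    apply hnc N (z i) i (hzN i)
    rw [← hPd, h0, Polynomial.eval_zero]
  set F : Set ℂ := ({w | P.derivative.eval w = 0} ∪ ⋃ j, {w | (P - Polynomial.C (s j)).eval w = 0}) \ range z with hF
  have hFfin : F.Finite := by
    refine Set.Finite.sdiff (Set.Finite.union ?_ (Set.finite_iUnion fun j => ?_))
    · exact Polynomial.finite_setOfPred_isRoot hPd0
    · refine Polynomial.finite_setOfPred_isRoot (p := P - Polynomial.C (s j)) ?_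
      intro h0
      apply hPd0
      have := congrArg Polynomial.derivative h0
      simpa using this
  have hzF : ∀ j, z j ∈ ball r ε \ F := fun j => ⟨hzB j, fun h => h.2 ⟨j, rfl⟩⟩
  obtain ⟨U, hUo, hUc, hUk, hUs, hzU⟩ := aux_region hε hFfin z hzF
  have hUB : U ⊆ ball r ε := fun w hw => (hUs (subset_closure hw)).1
  have hrU : r ∈ U := hzr ▸ hzU i
  have huniq : ∀ j, ∀ w ∈ closure U, f^[N] w = s j → w = z j := by
    intro j w hw hwj
    have h1 := (hUs hw).2
    by_contra hne
    apply h1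
    refine ⟨Or.inr (mem_iUnion.2 ⟨j, ?_⟩), ?_⟩
    · have : P.eval w = s j := by rw [← hwj, ← hPe]
      simp [this]
    · rintro ⟨j', rfl⟩
      rw [hzN j'] at hwj
      exact hne (by rw [hs hwj])
  have hdne : ∀ w ∈ closure U, deriv f^[N] w ≠ 0 := by
    intro w hw h0
    have h1 := (hUs hw).2
    apply h1
    refine ⟨Or.inl (by rw [← hPd] at h0; exact h0), ?_⟩
    rintro ⟨j', rfl⟩
    exact hnc N _ j' (hzN j') h0
  have hfit : ∀ k, Differentiable ℂ f^[k] := fun k => hf.iterate k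
  -- lower bound of derivative on U
  obtain ⟨c, hc, hcb⟩ : ∃ c > 0, ∀ w ∈ U, c ≤ ‖deriv f^[N] w‖ := by
    have hcont : Continuous fun w => ‖deriv f^[N] w‖ := by
      have : (fun w => ‖deriv f^[N] w‖) = fun w => ‖P.derivative.eval w‖ := by
        funext w; rw [hPd]
      rw [this]
      exact P.derivative.continuous.norm
    obtain ⟨w₀, hw₀, hmin⟩ := hUk.exists_isMinOn ⟨r, subset_closure hrU⟩ hcont.continuousOn
    exact ⟨‖deriv f^[N] w₀‖, norm_pos_iff.2 (hdne w₀ hw₀), fun w hw => hmin (subset_closure hw)⟩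
  -- bijectivity radius
  have hbij : ∀ j, ∃ δ > 0, ∀ D ⊆ ball (s j) δ, BijOn f^[N] (U ∩ f^[N] ⁻¹' D) D := by
    intro j
    have := aux_bij (hfit N).continuous hUo hUk (hzU j)
      ((hfit N).analyticAt (z j)).hasStrictDerivAt (hdne _ (subset_closure (hzU j)))
      (fun w hw h => huniq j w hw (by rw [h, hzN]))
    rwa [hzN] at this
  choose δ hδ hbij using hbij
  obtain ⟨δ₀, hδ₀, hδle⟩ : ∃ δ₀ > 0, ∀ j, δ₀ ≤ δ j := by
    refine ⟨min (δ 0) (min (δ 1) (δ 2)), lt_min (hδ 0) (lt_min (hδ 1) (hδ 2)), ?_⟩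
    intro j
    fin_cases j <;> simp
  -- g facts
  have hgB : ∀ k, ∀ w ∈ ball r ε, g^[k] w ∈ ball r ε := by
    intro k
    induction k with
    | zero => intro w hw; exact hw
    | succ k ih => intro w hw; rw [Function.iterate_succ_apply']; exact (hg _ (ih w hw)).1
  have hfg : ∀ j k, ∀ w ∈ ball r ε, f^[j] (g^[j + k] w) = g^[k] w := by
    intro j
    induction j with
    | zero => intro k w _; simp
    | succ j ih =>
      intro k w hw
      rw [Function.iterate_succ_apply, show j + 1 + k = (j + k) + 1 by ring,
        Function.iterate_succ_apply', (hg _ (hgB _ w hw)).2, ih k w hw]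
  have hfg0 : ∀ j, ∀ w ∈ ball r ε, f^[j] (g^[j] w) = w := fun j w hw => by
    simpa using hfg j 0 w hw
  have hgr : g r = r := by
    have h1 := hexp (g r) (hg r hrB).1 r hrB
    rw [(hg r hrB).2, hr, dist_self] at h1
    have h2 : dist (g r) r ≤ 0 := by
      by_contra! h
      nlinarith
    exact dist_le_zero.1 h2
  have hgcon : ∀ k, ∀ w ∈ ball r ε, ∀ w' ∈ ball r ε, dist (g^[k] w) (g^[k] w') ≤ lam⁻¹ ^ k * dist w w' := by
    intro k w hw w' hw'
    induction k with
    | zero => simp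
    | succ k ih =>
      rw [Function.iterate_succ_apply', Function.iterate_succ_apply']
      have h1 := hexp _ (hg _ (hgB k w hw)).1 _ (hg _ (hgB k w' hw')).1
      rw [(hg _ (hgB k w hw)).2, (hg _ (hgB k w' hw')).2] at h1
      have h2 : dist (g (g^[k] w)) (g (g^[k] w')) ≤ lam⁻¹ * dist (g^[k] w) (g^[k] w') := by
        rw [inv_mul_eq_div, le_div_iff₀ (by linarith), mul_comm]; exact h1
      refine h2.trans ?_
      rw [pow_succ', mul_assoc]
      have : 0 < lam := by linarith
      gcongr
  have hgo : ∀ k, IsOpen (g^[k] '' U) := by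
    intro k
    induction k with
    | zero => simpa using hUo
    | succ k ih =>
      have : g^[k + 1] '' U = ball r ε ∩ f ⁻¹' (g^[k] '' U) := by
        ext w
        constructor
        · rintro ⟨u, hu, rfl⟩
          refine ⟨hgB _ u (hUB hu), ⟨u, hu, ?_⟩⟩
          rw [Function.iterate_succ_apply', (hg _ (hgB _ u (hUB hu))).2]
        · rintro ⟨hw, u, hu, he⟩
          refine ⟨u, hu, ?_⟩
          rw [Function.iterate_succ_apply']
          have hx := hgB k u (hUB hu)
          have h1 := hexp _ (hg _ hx).1 w hw
          rw [(hg _ hx).2, he, dist_self] at h1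
          have h2 : dist (g (f w)) w ≤ 0 := by
            by_contra! h
            nlinarith
          rw [he]
          exact dist_le_zero.1 h2
      rw [this]
      exact isOpen_ball.inter (ih.preimage hf.continuous)
  have hgcont : ∀ k, ContinuousOn g^[k] U := by
    intro k
    have : LipschitzOnWith (Real.toNNReal (lam⁻¹ ^ k)) g^[k] U := by
      refine LipschitzOnWith.of_dist_le_mul fun x hx y hy => ?_
      have hl : 0 < lam := by linarith
      rw [Real.coe_toNNReal _ (by positivity)]
      exact hgcon k x (hUB hx) y (hUB hy)
    exact this.continuousOn
  have hfopen : IsOpenMap f := by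
    have han : AnalyticOnNhd ℂ f univ := fun w _ => hf.analyticAt w
    rcases han.is_constant_or_isOpenMap with ⟨w, hw⟩ | h
    · exfalso
      have : f = fun _ => w := funext hw
      rw [this] at hrep
      norm_num at hrep
    · exact h
  have hfkopen : ∀ k, IsOpenMap f^[k] := fun k => by
    induction k with
    | zero => exact IsOpenMap.id
    | succ k ih => rw [Function.iterate_succ]; exact ih.comp hfopen
  let V : ℕ → Set ℂ := fun l => f^[N - l] '' (g^[l - N] '' U)
  have hVN : ∀ k, V (N + k) = g^[k] '' U := by
    intro k
    simp [V]
  have hVge : ∀ l, N ≤ l → V l = g^[l - N] '' U := by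
    intro l hl
    obtain ⟨k, rfl⟩ := Nat.exists_eq_add_of_le hl
    rw [hVN]; simp
  have hVle : ∀ l, l ≤ N → V l = f^[N - l] '' U := by
    intro l hl
    simp [V, Nat.sub_eq_zero_of_le hl]
  have hbdd : ∀ l, ∃ d, ∀ x ∈ V l, ∀ y ∈ V l, dist x y ≤ d := by
    intro l
    have hb : Bornology.IsBounded (f^[N - l] '' closedBall r ε) :=
      ((isCompact_closedBall r ε).image (hfit _).continuous).isBounded
    obtain ⟨d, hd⟩ := Metric.isBounded_iff.1 hb
    refine ⟨d, fun x hx y hy => hd ?_ ?_⟩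
    · refine image_mono ?_ hx
      rintro _ ⟨u, hu, rfl⟩
      exact ball_subset_closedBall (hgB _ u (hUB hu))
    · refine image_mono ?_ hy
      rintro _ ⟨u, hu, rfl⟩
      exact ball_subset_closedBall (hgB _ u (hUB hu))
  choose d hd using hbdd
  have hl0 : 0 < lam := by linarith
  set C := K / (lam - 1) with hC
  have hC0 : 0 ≤ C := div_nonneg hK (by linarith)
  have hχ : 0 < ‖deriv f r‖ := by linarith
  refine ⟨c * Real.exp (-(C * ε)) / ‖deriv f r‖ ^ N,
    2 * ε * lam ^ N + ∑ l ∈ Finset.range N, |d l| * lam ^ l, lam⁻¹, δ₀, N, V,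
    by positivity, by positivity, by positivity, inv_lt_one_of_one_lt₀ hlam, hδ₀, ?_, ?_, ?_, ?_, ?_, ?_⟩
  · intro l
    refine ⟨hfkopen _ _ (hgo _), (hUc.image _ (hgcont _)).image _ (hfit _).continuous.continuousOn, ?_⟩
    refine ⟨r, ⟨r, hrU, Function.iterate_fixed hgr _⟩, Function.iterate_fixed hr _⟩
  · intro l
    rcases le_or_gt N l with hl | hl
    · obtain ⟨k, rfl⟩ := Nat.exists_eq_add_of_le hl
      rw [add_assoc, hVN, hVN, image_image]
      refine image_congr fun u hu => ?_
      rw [Function.iterate_succ_apply', (hg _ (hgB _ u (hUB hu))).2]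
    · rw [hVle l hl.le, hVle (l + 1) hl, image_image]
      refine image_congr fun u hu => ?_
      rw [← Function.iterate_succ_apply' f]
      congr 2
      omega
  · intro l x hx y hy
    have hS : 0 ≤ ∑ l ∈ Finset.range N, |d l| * lam ^ l := by positivity
    rcases le_or_gt N l with hl | hl
    · obtain ⟨k, rfl⟩ := Nat.exists_eq_add_of_le hl
      rw [hVN] at hx hy
      obtain ⟨u, hu, rfl⟩ := hx
      obtain ⟨v, hv, rfl⟩ := hy
      have h1 := hgcon k u (hUB hu) v (hUB hv)
      have h2 : dist u v ≤ 2 * ε := by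
        have a := mem_ball.1 (hUB hu)
        have b := mem_ball.1 (hUB hv)
        have := dist_triangle_right u v r
        linarith
      calc dist (g^[k] u) (g^[k] v) ≤ lam⁻¹ ^ k * (2 * ε) := h1.trans (by gcongr)
        _ = 2 * ε * lam ^ N * lam⁻¹ ^ (N + k) := by
          rw [pow_add, inv_pow lam N]; field_simp
        _ ≤ _ := by gcongr; linarith
    · have h1 := hd l x hx y hy
      have h2 : |d l| * lam ^ l ≤ ∑ l ∈ Finset.range N, |d l| * lam ^ l :=
        Finset.single_le_sum (f := fun l => |d l| * lam ^ l) (fun _ _ => by positivity)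
          (Finset.mem_range.2 hl)
      calc dist x y ≤ |d l| := h1.trans (le_abs_self _)
        _ = |d l| * lam ^ l * lam⁻¹ ^ l := by rw [inv_pow]; field_simp
        _ ≤ _ := by
          gcongr
          have : 0 ≤ 2 * ε * lam ^ N := by positivity
          linarith
  · intro j y hy
    rw [hVle 0 (Nat.zero_le _)]
    obtain ⟨u, hu, rfl⟩ := (hbij j _ (ball_subset_ball (hδle j))).surjOn hy
    exact ⟨u, hu.1, rfl⟩
  · intro l hl w hw
    obtain ⟨k, rfl⟩ := Nat.exists_eq_add_of_le hl
    rw [hVN] at hw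
    obtain ⟨u, hu, rfl⟩ := hw
    have h1 := aux_deriv_prod hf hr hε hlam hK (norm_nonneg (deriv f r)) hexp hder k (g^[k] u) (by
      intro j hj
      obtain ⟨t, rfl⟩ := Nat.exists_eq_add_of_le hj.le
      rw [hfg j t u (hUB hu)]
      exact hgB t u (hUB hu))
    rw [hfg0 k u (hUB hu), ← hC] at h1
    have hdd : deriv f^[N + k] (g^[k] u) = deriv f^[N] u * deriv f^[k] (g^[k] u) := by
      rw [Function.iterate_add, deriv_comp _ (hfit N _) (hfit k _), hfg0 k u (hUB hu)]
    rw [hdd, norm_mul]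
    have h2 : ‖deriv f r‖ ^ k * Real.exp (-(C * ε)) ≤ ‖deriv f^[k] (g^[k] u)‖ := by
      rw [Real.exp_neg, ← div_eq_mul_inv, div_le_iff₀ (Real.exp_pos _)]
      calc ‖deriv f r‖ ^ k ≤ ‖deriv f r‖ ^ k * Real.exp (C * dist (g^[k] u) r) :=
            le_mul_of_one_le_right (by positivity) (Real.one_le_exp (by positivity))
        _ ≤ _ := h1
        _ ≤ _ := by
          gcongr
          exact (mem_ball.1 (hUB hu)).le
    calc c * Real.exp (-(C * ε)) / ‖deriv f r‖ ^ N * ‖deriv f r‖ ^ (N + k)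
        = c * (‖deriv f r‖ ^ k * Real.exp (-(C * ε))) := by
          rw [pow_add]; field_simp
      _ ≤ _ := by
          gcongr
          exact hcb u hu
  · intro l hl j D hD
    obtain ⟨k, rfl⟩ := Nat.exists_eq_add_of_le hl
    have hb := hbij j D (hD.trans (ball_subset_ball (hδle j)))
    rw [hVN]
    have hcomp : ∀ u ∈ U, f^[N + k] (g^[k] u) = f^[N] u := by
      intro u hu
      rw [Function.iterate_add_apply, hfg0 k u (hUB hu)]
    refine ⟨fun w hw => hw.2, ?_, ?_⟩
    · rintro _ ⟨⟨u, hu, rfl⟩, hu2⟩ _ ⟨⟨v, hv, rfl⟩, hv2⟩ he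
      rw [mem_preimage, hcomp u hu] at hu2
      rw [mem_preimage, hcomp v hv] at hv2
      rw [hcomp u hu, hcomp v hv] at he
      rw [hb.injOn ⟨hu, hu2⟩ ⟨hv, hv2⟩ he]
    · intro y hy
      obtain ⟨u, ⟨hu, hu2⟩, rfl⟩ := hb.surjOn hy
      exact ⟨g^[k] u, ⟨⟨u, hu, rfl⟩, by rw [mem_preimage, hcomp u hu]; exact hy⟩, hcomp u hu⟩

lemma aux_crit (q : Polynomial ℂ) (n : ℕ) (w : ℂ)
    (h : deriv (fun w => q.eval w)^[n] w = 0) :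
    (fun w => q.eval w)^[n] w ∈
      ⋃ n : ℕ, (fun w => q.eval w)^[n + 1] '' {w : ℂ | q.derivative.eval w = 0} := by
  have hf : Differentiable ℂ (fun w => q.eval w) := q.differentiable
  induction n generalizing w with
  | zero => simp at h
  | succ n ih =>
    have hd : deriv (fun w => q.eval w)^[n + 1] w =
        deriv (fun w => q.eval w)^[n] (q.eval w) * deriv (fun w => q.eval w) w := by
      rw [Function.iterate_succ]
      exact deriv_comp w ((hf.iterate n) _) (hf w)
    rw [hd, mul_eq_zero] at h
    rcases h with h | h
    · rw [Function.iterate_succ_apply]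
      exact ih _ h
    · rw [Polynomial.deriv] at h
      exact mem_iUnion.2 ⟨n, w, h, rfl⟩

/-- Lemma 3.1: existence of an admissible system of shrinking neighborhoods `Vᵢ^l` around three
repelling periodic points `r₁, r₂, r₃` of period `m₁` of a degree `d` polynomial `q`, with
`q^{m₁}(Vᵢ^{l+1}) = Vᵢ^l`, exponentially decreasing diameters, uniform expansion, covering, and
branch bijectivity for `l ≥ l₀`. -/
theorem stmt_2 (d : ℕ) (hd : 2 ≤ d) (q : Polynomial ℂ) (hq : q.natDegree = d)
    (m₁ : ℕ) (hm₁ : 1 ≤ m₁) (r : Fin 3 → ℂ) (hr : Function.Injective r)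
    (hper : ∀ i, (fun w => q.eval w)^[m₁] (r i) = r i)
    (hrep : ∀ i, 1 < ‖deriv ((fun w => q.eval w)^[m₁]) (r i)‖)
    (hpc : ∀ i, r i ∉ ⋃ n : ℕ, (fun w => q.eval w)^[n + 1] '' {w : ℂ | q.derivative.eval w = 0}) :
    ∃ (A : ℝ) (l₀ : ℕ) (a₁ a₂ : ℝ) (V : Fin 3 → ℕ → Set ℂ),
      0 < A ∧ 1 ≤ l₀ ∧ 0 < a₁ ∧ 0 < a₂ ∧ a₂ < 1 ∧
      (∀ i l, IsOpen (V i l) ∧ IsConnected (V i l) ∧ r i ∈ V i l) ∧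
      (∀ i l, (fun w => q.eval w)^[m₁] '' V i (l + 1) = V i l) ∧
      (∀ i l, EMetric.diam (V i l) ≤ ENNReal.ofReal (a₁ * a₂ ^ l)) ∧
      ∀ l, l₀ ≤ l →
        (∀ i, ∀ w ∈ V i l,
          A * ‖deriv ((fun w => q.eval w)^[m₁]) (r i)‖ ^ l ≤
            ‖deriv ((fun w => q.eval w)^[l * m₁]) w‖) ∧
        (∀ i, 1 < A * ‖deriv ((fun w => q.eval w)^[m₁]) (r i)‖ ^ l) ∧
        (∀ i, closure (V 0 l ∪ V 1 l ∪ V 2 l) ⊆ (fun w => q.eval w)^[l * m₁] '' V i l) ∧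
        (∀ i j, Set.BijOn ((fun w => q.eval w)^[l * m₁])
          (V i l ∩ (fun w => q.eval w)^[l * m₁] ⁻¹' V j l) (V j l)) := by
  classical
  set Q : ℂ → ℂ := fun w => q.eval w with hQ
  set f : ℂ → ℂ := Q^[m₁] with hfdef
  set p : Polynomial ℂ := q.comp^[m₁] Polynomial.X with hp
  have hfp : f = fun w => p.eval w := by
    funext w
    rw [hp, Polynomial.iterate_comp_eval, Polynomial.eval_X]
  have hpD : 2 ≤ p.natDegree := by
    rw [hp, Polynomial.natDegree_iterate_comp, Polynomial.natDegree_X, mul_one, hq]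
    exact hd.trans (Nat.le_self_pow (by omega) d)
  have hit : ∀ l, f^[l] = Q^[l * m₁] := by
    intro l
    rw [hfdef, ← Function.iterate_mul, mul_comm]
  have hdense : ∀ i j, ∀ ε > 0, ∃ n, ∃ z ∈ ball (r i) ε, f^[n] z = r j := by
    intro i j ε hε
    by_cases hij : i = j
    · subst hij
      exact ⟨0, r i, mem_ball_self hε, rfl⟩
    · have h1 := hper i
      have h2 := hper j
      have h3 := hrep i
      have h4 := hrep j
      rw [hfp] at h1 h2 h3 h4 ⊢
      exact aux_dense p hpD (r i) (r j) (fun h => hij (hr h)) ε hε h1 h3 h2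
        (fun h => by rw [h] at h4; norm_num at h4)
  have hnc : ∀ n z j, f^[n] z = r j → deriv f^[n] z ≠ 0 := by
    intro n z j h h0
    apply hpc j
    rw [← h, hit]
    rw [hit] at h0
    exact aux_crit q _ z h0
  have key := fun i => aux_single p f hfp r hr i hper (hrep i) (hdense i) hnc
  choose A a₁ a₂ δ N V hA ha₁ ha₂ ha₂' hδ hV hVs hVd hV0 hVder hVb using key
  have fin3 : ∀ (a : Fin 3 → ℝ), (∀ j, 0 < a j) → ∃ b > 0, ∀ j, b ≤ a j := by
    intro a ha
    refine ⟨min (a 0) (min (a 1) (a 2)), lt_min (ha 0) (lt_min (ha 1) (ha 2)), ?_⟩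
    intro j
    fin_cases j <;> simp
  obtain ⟨A', hA', hAle⟩ := fin3 A hA
  obtain ⟨δ', hδ', hδle⟩ := fin3 δ hδ
  obtain ⟨b₁, hb₁, hb₁le⟩ : ∃ b₁ > 0, ∀ j, a₁ j ≤ b₁ := by
    refine ⟨∑ j, a₁ j, Finset.sum_pos (fun j _ => ha₁ j) ⟨0, Finset.mem_univ _⟩, fun j => ?_⟩
    exact Finset.single_le_sum (fun j _ => (ha₁ j).le) (Finset.mem_univ j)
  obtain ⟨b₂, hb₂, hb₂le⟩ := fin3 (fun j => 1 - a₂ j) (fun j => by have := ha₂' j; linarith)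
  have hb₂lt : b₂ < 1 := by have := hb₂le 0; have := ha₂ 0; linarith
  have hdist : ∀ i l, ∀ x ∈ V i l, ∀ y ∈ V i l, dist x y ≤ b₁ * (1 - b₂) ^ l := by
    intro i l x hx y hy
    refine (hVd i l x hx y hy).trans ?_
    have h1 := ha₂ i
    have h2 : a₂ i ≤ 1 - b₂ := by have := hb₂le i; linarith
    have h3 := ha₁ i
    gcongr
    exact hb₁le i
  -- eventual conditions
  have e1 : ∀ᶠ l : ℕ in Filter.atTop, b₁ * (1 - b₂) ^ l < δ' := by
    have h1 : Filter.Tendsto (fun l : ℕ => b₁ * (1 - b₂) ^ l) Filter.atTop (nhds (b₁ * 0)) :=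
      (tendsto_pow_atTop_nhds_zero_of_lt_one (by linarith) (by linarith)).const_mul b₁
    rw [mul_zero] at h1
    exact h1.eventually (gt_mem_nhds hδ')
  have e2 : ∀ᶠ l : ℕ in Filter.atTop, ∀ i, 1 < A' * ‖deriv f (r i)‖ ^ l := by
    rw [Filter.eventually_all]
    intro i
    exact ((tendsto_pow_atTop_atTop_of_one_lt (hrep i)).const_mul_atTop hA').eventually
      (Filter.eventually_gt_atTop 1)
  have e3 : ∀ᶠ l : ℕ in Filter.atTop, ∀ i, N i ≤ l := by
    rw [Filter.eventually_all]
    exact fun i => Filter.eventually_ge_atTop _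
  obtain ⟨l₀, hl₀⟩ := Filter.eventually_atTop.1 ((e1.and e2).and e3)
  refine ⟨A', max l₀ 1, b₁, 1 - b₂, V, hA', le_max_right _ _, hb₁, by linarith, by linarith,
    hV, hVs, ?_, ?_⟩
  · intro i l
    refine EMetric.diam_le fun x hx y hy => ?_
    rw [edist_dist]
    exact ENNReal.ofReal_le_ofReal (hdist i l x hx y hy)
  · intro l hl
    obtain ⟨⟨c1, c2⟩, c3⟩ := hl₀ l ((le_max_left _ _).trans hl)
    simp only [← hit]
    have hsub : ∀ j, V j l ⊆ closedBall (r j) (b₁ * (1 - b₂) ^ l) := fun j x hx =>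
      hdist j l x hx _ (hV j l).2.2
    have himg : ∀ i l, f^[l] '' V i l = V i 0 := by
      intro i l
      induction l with
      | zero => simp
      | succ l ih => rw [Function.iterate_succ, image_comp, hVs, ih]
    refine ⟨?_, c2, ?_, ?_⟩
    · intro i w hw
      refine le_trans ?_ (hVder i l (c3 i) w hw)
      gcongr
      exact hAle i
    · intro i
      rw [himg]
      have hcl : ∀ j, closure (V j l) ⊆ V i 0 := fun j =>
        (closure_minimal (hsub j) isClosed_closedBall).trans
          ((closedBall_subset_ball (c1.trans_le (hδle i))).trans (hV0 i j))
      rw [closure_union, closure_union]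
      exact union_subset (union_subset (hcl 0) (hcl 1)) (hcl 2)
    · intro i j
      exact hVb i l (c3 i) j _
        ((hsub j).trans (closedBall_subset_ball (c1.trans_le (hδle i))))
end

section
/- With the admissible system of neighborhoods Vᵢ^l as in the context, let H₁, H₂, H₃ ⊆ ℂ be open sets, H := H₁ ∪ H₂ ∪ H₃, and let K ⊆ H be compact. For l ≥ 1 set Z^l := ∪_{i=1}^3 Hᵢ × Vᵢ^l. Then there exist δ₀ > 0 and L₀ ≥ l₀ such that for every l ≥ L₀ and every holomorphic map g : Z^l → K × ℂ of the form g(z,w) = (h(z,w), q^{l·m₁}(w)) which contracts the cone field C_{δ₀} on Z^l, there is α > 0 with the following property: for every holomorphic map f : Z^l → ℂ² with ‖f − g‖_{C¹,Z^l} ≤ α, every i ∈ {1,2,3} and every holomorphic σ : Vᵢ^l → Hᵢ with sup_{Vᵢ^l} |σ'| < δ₀, there exists a point x on the vertical graph Γ_σ := {(σ(w), w) : w ∈ Vᵢ^l} whose entire forward f-orbit remains in Z^l; in particular the set Λ_f := ∩_{n≥0} f^{-n}(closure(Z^l)) intersects Γ_σ. -/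
open Metric Set

/-- An admissible system of shrinking neighborhoods around three repelling periodic points of a
polynomial `q`, as provided by Lemma 3.1 of the paper. -/
structure AdmissibleSystem where
  /-- the degree -/
  d : ℕ
  hd : 2 ≤ d
  /-- the polynomial -/
  q : Polynomial ℂ
  hq : q.natDegree = d
  /-- the period -/
  m₁ : ℕ
  hm₁ : 1 ≤ m₁
  /-- the three repelling periodic points -/
  r : Fin 3 → ℂ
  hr : Function.Injective r
  hper : ∀ i, (fun w => q.eval w)^[m₁] (r i) = r i
  hrep : ∀ i, 1 < ‖deriv ((fun w => q.eval w)^[m₁]) (r i)‖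
  hpc : ∀ i, r i ∉ ⋃ n : ℕ, (fun w => q.eval w)^[n + 1] '' {w : ℂ | q.derivative.eval w = 0}
  /-- the expansion constant -/
  A : ℝ
  hA : 0 < A
  /-- the threshold index -/
  l₀ : ℕ
  hl₀ : 1 ≤ l₀
  /-- constants controlling the diameters -/
  a₁ : ℝ
  ha₁ : 0 < a₁
  a₂ : ℝ
  ha₂ : 0 < a₂
  ha₂' : a₂ < 1
  /-- the neighborhoods -/
  V : Fin 3 → ℕ → Set ℂ
  hVopen : ∀ i l, IsOpen (V i l)
  hVconn : ∀ i l, IsConnected (V i l)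
  hVmem : ∀ i l, r i ∈ V i l
  hVmap : ∀ i l, (fun w => q.eval w)^[m₁] '' V i (l + 1) = V i l
  hVdiam : ∀ i l, EMetric.diam (V i l) ≤ ENNReal.ofReal (a₁ * a₂ ^ l)
  hVexp : ∀ l, l₀ ≤ l → ∀ i, ∀ w ∈ V i l,
    A * ‖deriv ((fun w => q.eval w)^[m₁]) (r i)‖ ^ l ≤
      ‖deriv ((fun w => q.eval w)^[l * m₁]) w‖
  hVexp1 : ∀ l, l₀ ≤ l → ∀ i, 1 < A * ‖deriv ((fun w => q.eval w)^[m₁]) (r i)‖ ^ l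
  hVcover : ∀ l, l₀ ≤ l → ∀ i,
    closure (V 0 l ∪ V 1 l ∪ V 2 l) ⊆ (fun w => q.eval w)^[l * m₁] '' V i l
  hVbij : ∀ l, l₀ ≤ l → ∀ i j, Set.BijOn ((fun w => q.eval w)^[l * m₁])
    (V i l ∩ (fun w => q.eval w)^[l * m₁] ⁻¹' V j l) (V j l)

/-- The cone `C_δ = {(a,b) ∈ ℂ² | |a| < δ |b|}`, viewed as a constant cone field on `ℂ²`. -/
def cone (δ : ℝ) : Set (ℂ × ℂ) := {v : ℂ × ℂ | ‖v.1‖ < δ * ‖v.2‖}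

/-- A map `g : ℂ² → ℂ²` contracts the cone field `C_δ` on `U` if there is `0 < δ' < δ` such
that the derivative of `g` at every point of `U` maps `C_δ` into `C_{δ'}`. -/
def ContractsCone (g : ℂ × ℂ → ℂ × ℂ) (δ : ℝ) (U : Set (ℂ × ℂ)) : Prop :=
  ∃ δ' : ℝ, 0 < δ' ∧ δ' < δ ∧ ∀ x ∈ U, ∀ v ∈ cone δ, fderiv ℂ g x v ∈ cone δ'


/-! ### General one-variable lemmas -/

lemma aux_locinv (P : ℂ → ℂ) (hP : Differentiable ℂ P) (a : ℂ) (h : deriv P a ≠ 0) :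
    ∃ θ : ℂ → ℂ, (∀ᶠ z in nhds (P a), DifferentiableAt ℂ θ z) ∧ θ (P a) = a ∧
      (∀ᶠ x in nhds a, θ (P x) = x) ∧ (∀ᶠ z in nhds (P a), P (θ z) = z) := by
  have hc : ContDiffAt ℂ 1 P a := hP.contDiff.contDiffAt
  have hs : HasStrictDerivAt P (deriv P a) a := hc.hasStrictDerivAt (by norm_num)
  have hf := hs.hasStrictFDerivAt_equiv h
  have hn : (1 : WithTop ℕ∞) ≠ 0 := by norm_num
  refine ⟨hc.localInverse hf.hasFDerivAt hn, ?_, ?_, ?_, ?_⟩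
  · have := hc.to_localInverse hf.hasFDerivAt hn
    filter_upwards [this.eventually (by simp)] with z hz
    exact hz.differentiableAt (by norm_num)
  · exact hc.localInverse_apply_image hf.hasFDerivAt hn
  · exact hf.eventually_left_inverse
  · exact hf.eventually_right_inverse

lemma aux_mvt {ψ : ℂ → ℂ} {c : ℂ} {R C : ℝ} (hd : ∀ z ∈ Metric.ball c R, DifferentiableAt ℂ ψ z)
    (hb : ∀ z ∈ Metric.ball c R, ‖deriv ψ z‖ ≤ C) {x y : ℂ} (hx : x ∈ Metric.ball c R)
    (hy : y ∈ Metric.ball c R) : ‖ψ y - ψ x‖ ≤ C * ‖y - x‖ :=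
  (convex_ball c R).norm_image_sub_le_of_norm_deriv_le hd hb hx hy

/-- variation along a connected open set, uniformly in the function -/
lemma aux_conn {U : Set ℂ} (hU : IsOpen U) (hc : IsPreconnected U) (Q : ℂ → ℂ)
    (hQ : Differentiable ℂ Q) (p p' : ℂ) (hp : p ∈ U) (hp' : p' ∈ U) :
    ∃ M : ℝ, 0 ≤ M ∧ ∀ (φ : ℂ → ℂ) (δ : ℝ), 0 ≤ δ → (∀ w ∈ U, DifferentiableAt ℂ φ w) →
      (∀ w ∈ U, ‖deriv φ w‖ ≤ δ * ‖deriv Q w‖) → ‖φ p - φ p'‖ ≤ δ * M := by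
  refine hc.induction₂ (fun p p' => ∃ M : ℝ, 0 ≤ M ∧ ∀ (φ : ℂ → ℂ) (δ : ℝ), 0 ≤ δ →
      (∀ w ∈ U, DifferentiableAt ℂ φ w) →
      (∀ w ∈ U, ‖deriv φ w‖ ≤ δ * ‖deriv Q w‖) → ‖φ p - φ p'‖ ≤ δ * M) ?_ ?_ ?_ hp hp'
  · intro x hx
    have hcont : ContinuousAt (deriv Q) x :=
      ((hQ.contDiff (n := 1)).continuous_deriv (by norm_num)).continuousAt
    have h1 : ∀ᶠ y in nhds x, ‖deriv Q y‖ < ‖deriv Q x‖ + 1 :=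
      hcont.norm.eventually_lt_const (by linarith)
    obtain ⟨R, hR, hRs⟩ := Metric.eventually_nhds_iff_ball.1 (h1.and (hU.mem_nhds hx))
    refine Filter.Eventually.filter_mono nhdsWithin_le_nhds ?_
    filter_upwards [Metric.ball_mem_nhds x hR] with y hy
    refine ⟨(‖deriv Q x‖ + 1) * ‖x - y‖, by positivity, ?_⟩
    intro φ δ hδ hd hb
    rw [← mul_assoc]
    refine aux_mvt (c := x) (R := R) (fun z hz => hd z (hRs z hz).2) ?_ hy
      (Metric.mem_ball_self hR)
    intro z hz
    refine (hb z (hRs z hz).2).trans ?_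
    exact mul_le_mul_of_nonneg_left (hRs z hz).1.le hδ
  · rintro x y z hx hy hz ⟨M, hM, h1⟩ ⟨M', hM', h2⟩
    refine ⟨M + M', by positivity, fun φ δ hδ hd hb => ?_⟩
    have := norm_sub_le_norm_sub_add_norm_sub (φ x) (φ y) (φ z)
    nlinarith [h1 φ δ hδ hd hb, h2 φ δ hδ hd hb]
  · rintro x y hx hy ⟨M, hM, h1⟩
    refine ⟨M, hM, fun φ δ hδ hd hb => ?_⟩
    rw [norm_sub_rev]
    exact h1 φ δ hδ hd hb

/-- derivative domination is stable under precomposition -/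
lemma aux_dom {φ Q τ : ℂ → ℂ} {δ : ℝ} {z : ℂ} (hφ : DifferentiableAt ℂ φ (τ z))
    (hQ : DifferentiableAt ℂ Q (τ z)) (hτ : DifferentiableAt ℂ τ z)
    (h : ‖deriv φ (τ z)‖ ≤ δ * ‖deriv Q (τ z)‖) :
    ‖deriv (φ ∘ τ) z‖ ≤ δ * ‖deriv (Q ∘ τ) z‖ := by
  rw [deriv_comp z hφ hτ, deriv_comp z hQ hτ, norm_mul, norm_mul, ← mul_assoc]
  exact mul_le_mul_of_nonneg_right h (norm_nonneg _)

/-- inverse of a map close to the identity on a disc -/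
lemma aux_inv {G : ℂ → ℂ} {c : ℂ} {ρ α : ℝ} (hρ : 0 < ρ) (hα : 0 ≤ α) (hα1 : α ≤ 1 / 32)
    (hα2 : α ≤ ρ / 32)
    (hd : ∀ z ∈ Metric.ball c ρ, DifferentiableAt ℂ G z)
    (h1 : ∀ z ∈ Metric.ball c ρ, ‖deriv G z - 1‖ ≤ α) (h0 : ‖G c - c‖ ≤ α) :
    ∃ y : ℂ → ℂ, ∀ z ∈ Metric.ball c (3 * ρ / 4), y z ∈ Metric.ball c ρ ∧ G (y z) = z ∧
      DifferentiableAt ℂ y z := by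
  lift α to NNReal using hα
  have happ : ApproximatesLinearOn G
      ((ContinuousLinearEquiv.refl ℂ ℂ : ℂ ≃L[ℂ] ℂ) : ℂ →L[ℂ] ℂ) (Metric.ball c ρ)
      α := by
    intro x hx y hy
    have := aux_mvt (ψ := fun z => G z - z) (c := c) (R := ρ) (C := α)
      (fun z hz => (hd z hz).sub differentiableAt_id) (fun z hz => by
        have : deriv (fun z => G z - z) z = deriv G z - 1 :=
          ((hd z hz).hasDerivAt.sub (hasDerivAt_id z)).deriv
        rw [this]; exact h1 z hz) hy hx
    have e : G x - G y - (((ContinuousLinearEquiv.refl ℂ ℂ : ℂ ≃L[ℂ] ℂ) : ℂ →L[ℂ] ℂ) (x - y))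
      = (G x - x) - (G y - y) := by simp; ring
    rw [e]; exact this
  have hN : ‖((ContinuousLinearEquiv.refl ℂ ℂ : ℂ ≃L[ℂ] ℂ).symm : ℂ →L[ℂ] ℂ)‖₊ = 1 := by
    apply NNReal.eq
    simp
  have hc : Subsingleton ℂ ∨ α <
      ‖((ContinuousLinearEquiv.refl ℂ ℂ : ℂ ≃L[ℂ] ℂ).symm : ℂ →L[ℂ] ℂ)‖₊⁻¹ := by
    right
    rw [hN, inv_one, ← NNReal.coe_lt_coe]
    rw [NNReal.coe_one]
    linarith
  set e := happ.toOpenPartialHomeomorph G _ hc Metric.isOpen_ball with he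
  have htar := happ.closedBall_subset_target hc Metric.isOpen_ball (b := c) (ε := 15 * ρ / 16)
    (by positivity) (Metric.closedBall_subset_ball (by linarith))
  refine ⟨e.symm, fun z hz => ?_⟩
  have hzt : z ∈ e.target := by
    apply htar
    rw [hN, Metric.mem_closedBall]
    rw [Metric.mem_ball] at hz
    have : dist z (G c) ≤ dist z c + α := by
      refine (dist_triangle z c (G c)).trans ?_
      rw [dist_comm c, dist_eq_norm (G c)]; linarith
    refine this.trans ?_
    simp only [inv_one, NNReal.coe_one]
    nlinarith
  have hsrc : e.symm z ∈ Metric.ball c ρ := e.map_target hzt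
  refine ⟨hsrc, e.right_inv hzt, ?_⟩
  refine (e.hasDerivAt_symm hzt (f' := deriv G (e.symm z)) ?_ (hd _ hsrc).hasDerivAt).differentiableAt
  intro h
  have := h1 _ hsrc
  rw [h] at this
  simp at this
  linarith
/-! ### Geometry of the admissible system -/

/-- the first return map -/
noncomputable def AdmissibleSystem.P (S : AdmissibleSystem) : ℂ → ℂ :=
  (fun w => S.q.eval w)^[S.m₁]

lemma AdmissibleSystem.P_diff (S : AdmissibleSystem) : Differentiable ℂ S.P :=
  Differentiable.iterate S.q.differentiable _

lemma AdmissibleSystem.iter_eq (S : AdmissibleSystem) (l : ℕ) :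
    (fun w => S.q.eval w)^[l * S.m₁] = S.P^[l] := by
  rw [mul_comm, Function.iterate_mul]; rfl

lemma AdmissibleSystem.P_iter_diff (S : AdmissibleSystem) (l : ℕ) :
    Differentiable ℂ (S.P^[l]) := S.P_diff.iterate l

lemma AdmissibleSystem.one_lt (S : AdmissibleSystem) {l : ℕ} (hl : S.l₀ ≤ l) (i : Fin 3) {w : ℂ}
    (hw : w ∈ S.V i l) : 1 < ‖deriv (S.P^[l]) w‖ := by
  rw [← S.iter_eq]
  exact (S.hVexp1 l hl i).trans_le (S.hVexp l hl i w hw)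

lemma AdmissibleSystem.V_small (S : AdmissibleSystem) (i : Fin 3) {ε : ℝ} (hε : 0 < ε) :
    ∀ᶠ l in Filter.atTop, S.V i l ⊆ ball (S.r i) ε := by
  have h1 : Filter.Tendsto (fun l => S.a₁ * S.a₂ ^ l) Filter.atTop (nhds (S.a₁ * 0)) :=
    (tendsto_pow_atTop_nhds_zero_of_lt_one S.ha₂.le S.ha₂').const_mul _
  rw [mul_zero] at h1
  filter_upwards [h1.eventually_lt_const hε] with l hl w hw
  have h2 : edist w (S.r i) ≤ ENNReal.ofReal (S.a₁ * S.a₂ ^ l) :=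
    (EMetric.edist_le_diam_of_mem hw (S.hVmem i l)).trans (S.hVdiam i l)
  rw [edist_dist, ENNReal.ofReal_le_ofReal_iff
    (mul_nonneg S.ha₁.le (pow_nonneg S.ha₂.le _))] at h2
  exact mem_ball.2 (h2.trans_lt hl)

/-- inverse branches fixing `r i` -/
lemma AdmissibleSystem.tau (S : AdmissibleSystem) (i : Fin 3) :
    ∀ᶠ L in Filter.atTop, ∀ k : ℕ, ∃ τ : ℂ → ℂ, τ (S.r i) = S.r i ∧
      ∀ z ∈ S.V i L, τ z ∈ S.V i (L + k) ∧ S.P^[k] (τ z) = z ∧ DifferentiableAt ℂ τ z := by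
  have hfix : S.P (S.r i) = S.r i := S.hper i
  have hne : deriv S.P (S.r i) ≠ 0 := by
    intro h
    have := S.hrep i
    change 1 < ‖deriv S.P (S.r i)‖ at this
    rw [h, norm_zero] at this
    linarith
  obtain ⟨θ, h1, h2, h3, -⟩ := aux_locinv S.P S.P_diff (S.r i) hne
  rw [hfix] at h1 h2
  obtain ⟨ε, hε, hb⟩ := Metric.eventually_nhds_iff_ball.1 (h1.and h3)
  obtain ⟨L, hL⟩ := Filter.eventually_atTop.1 (S.V_small i hε)
  filter_upwards [Filter.eventually_ge_atTop L] with L' hL' k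
  induction k with
  | zero => exact ⟨id, rfl, fun z hz => ⟨hz, rfl, differentiableAt_id⟩⟩
  | succ k ih =>
    obtain ⟨τ, ht, hτ⟩ := ih
    refine ⟨θ ∘ τ, by simp [ht, h2], fun z hz => ?_⟩
    obtain ⟨ha, hb', hc⟩ := hτ z hz
    have hmem := ha
    rw [← S.hVmap] at hmem
    obtain ⟨ω, hω, hω'⟩ := hmem
    change S.P ω = τ z at hω'
    have hθ : θ (τ z) = ω := by
      rw [← hω']
      exact (hb ω (hL (L' + k + 1) (by omega) hω)).2
    refine ⟨?_, ?_, ?_⟩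
    · change θ (τ z) ∈ S.V i (L' + k + 1)
      rw [hθ]; exact hω
    · rw [Function.iterate_succ_apply, Function.comp_apply, hθ, hω', hb']
    · exact (hb _ (hL (L' + k) (by omega) ha)).1.comp z hc

/-- The geometric input. -/
lemma AdmissibleSystem.geom (S : AdmissibleSystem) :
    ∃ (ρ M : ℝ) (L₀ : ℕ), 0 < ρ ∧ 0 ≤ M ∧ S.l₀ ≤ L₀ ∧ ∀ l, L₀ ≤ l → ∀ j,
      S.V j l ⊆ ball (S.r j) (ρ / 2) ∧ ∀ i, ∃ t : ℂ → ℂ,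
        (∀ z ∈ ball (S.r j) ρ, t z ∈ S.V i l ∧ S.P^[l] (t z) = z ∧ DifferentiableAt ℂ t z) ∧
        ∀ (φ : ℂ → ℂ) (δ : ℝ), 0 ≤ δ → (∀ w ∈ S.V i l, DifferentiableAt ℂ φ w) →
          (∀ w ∈ S.V i l, ‖deriv φ w‖ ≤ δ * ‖deriv (S.P^[l]) w‖) →
          ∀ z ∈ ball (S.r j) ρ, ‖φ (t z) - φ (S.r i)‖ ≤ δ * M := by
  obtain ⟨L, hLl, hL⟩ := ((Filter.eventually_ge_atTop S.l₀).and
    (Filter.eventually_all.2 (fun i => S.tau i))).exists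
  -- local data at level `L`
  have key : ∀ x : Fin 3 × Fin 3, ∃ (ρ : ℝ) (M : ℝ) (t : ℂ → ℂ), 0 < ρ ∧ 0 ≤ M ∧
      (∀ z ∈ ball (S.r x.2) ρ, t z ∈ S.V x.1 L ∧ S.P^[L] (t z) = z ∧ DifferentiableAt ℂ t z) ∧
      ∀ (φ : ℂ → ℂ) (δ : ℝ), 0 ≤ δ → (∀ w ∈ S.V x.1 L, DifferentiableAt ℂ φ w) →
          (∀ w ∈ S.V x.1 L, ‖deriv φ w‖ ≤ δ * ‖deriv (S.P^[L]) w‖) →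
          ‖φ (t (S.r x.2)) - φ (S.r x.1)‖ ≤ δ * M := by
    rintro ⟨i, j⟩
    obtain ⟨p, ⟨hp, -⟩, hpj⟩ := (S.hVbij L hLl i j).surjOn (S.hVmem j L)
    rw [S.iter_eq] at hpj
    have hne : deriv (S.P^[L]) p ≠ 0 := by
      intro h
      have := S.one_lt hLl i hp
      rw [h, norm_zero] at this
      linarith
    obtain ⟨t, h1, h2, -, h4⟩ := aux_locinv _ (S.P_iter_diff L) p hne
    rw [hpj] at h1 h2 h4
    have h5 : ∀ᶠ z in nhds (S.r j), t z ∈ S.V i L :=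
      h1.self_of_nhds.continuousAt.eventually_mem ((S.hVopen i L).mem_nhds (by rw [h2]; exact hp))
    obtain ⟨ρ, hρ, hb⟩ := Metric.eventually_nhds_iff_ball.1 (h5.and (h4.and h1))
    obtain ⟨M, hM, hM'⟩ := aux_conn (S.hVopen i L) (S.hVconn i L).isPreconnected _
      (S.P_iter_diff L) p (S.r i) hp (S.hVmem i L)
    refine ⟨ρ, M, t, hρ, hM, hb, ?_⟩
    change ∀ (φ : ℂ → ℂ) (δ : ℝ), 0 ≤ δ → (∀ w ∈ S.V i L, DifferentiableAt ℂ φ w) →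
          (∀ w ∈ S.V i L, ‖deriv φ w‖ ≤ δ * ‖deriv (S.P^[L]) w‖) →
          ‖φ (t (S.r j)) - φ (S.r i)‖ ≤ δ * M
    rw [h2]
    exact hM'
  choose ρ M t hρ hM ht hφ using key
  obtain ⟨R, hR⟩ : ∃ R : ℝ, 0 < R ∧ ∀ x, R ≤ ρ x := by
    obtain ⟨x, hx⟩ := Finite.exists_min ρ
    exact ⟨ρ x, hρ x, hx⟩
  obtain ⟨N, hN⟩ : ∃ N : ℝ, ∀ x, M x ≤ N := by
    obtain ⟨x, hx⟩ := Finite.exists_max M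
    exact ⟨M x, hx⟩
  have hN0 : 0 ≤ N := (hM (0, 0)).trans (hN _)
  obtain ⟨L', hL'⟩ := Filter.eventually_atTop.1
    (Filter.eventually_all.2 (fun j => S.V_small j (half_pos hR.1)))
  refine ⟨R, N + R, max L L', hR.1, add_nonneg hN0 hR.1.le, hLl.trans (le_max_left _ _), ?_⟩
  intro l hl j
  refine ⟨hL' l ((le_max_right _ _).trans hl) j, fun i => ?_⟩
  obtain ⟨k, rfl⟩ := Nat.exists_eq_add_of_le ((le_max_left _ _).trans hl)
  obtain ⟨τ, hτr, hτ⟩ := hL i k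
  have hsub : ball (S.r j) R ⊆ ball (S.r j) (ρ (i, j)) := ball_subset_ball (hR.2 _)
  refine ⟨τ ∘ t (i, j), fun z hz => ?_, fun φ δ hδ hd hb z hz => ?_⟩
  · obtain ⟨h1, h2, h3⟩ := ht (i, j) z (hsub hz)
    obtain ⟨g1, g2, g3⟩ := hτ _ h1
    refine ⟨g1, ?_, g3.comp z h3⟩
    rw [Function.iterate_add_apply, Function.comp_apply, g2, h2]
  · have hψd : ∀ w ∈ S.V i L, DifferentiableAt ℂ (φ ∘ τ) w := fun w hw =>
      (hd _ (hτ w hw).1).comp w (hτ w hw).2.2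
    have hψb : ∀ w ∈ S.V i L, ‖deriv (φ ∘ τ) w‖ ≤ δ * ‖deriv (S.P^[L]) w‖ := by
      intro w hw
      have h1 := aux_dom (hd _ (hτ w hw).1) (S.P_iter_diff (L + k) _) (hτ w hw).2.2
        (hb _ (hτ w hw).1)
      have h2 : deriv (S.P^[L + k] ∘ τ) w = deriv (S.P^[L]) w := by
        apply Filter.EventuallyEq.deriv_eq
        filter_upwards [(S.hVopen i L).mem_nhds hw] with v hv
        rw [Function.comp_apply, Function.iterate_add_apply, (hτ v hv).2.1]
      rwa [h2] at h1
    have hA := hφ (i, j) (φ ∘ τ) δ hδ hψd hψb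
    have hB : ‖(φ ∘ τ ∘ t (i, j)) z - (φ ∘ τ ∘ t (i, j)) (S.r j)‖ ≤ δ * ‖z - S.r j‖ := by
      refine aux_mvt (c := S.r j) (R := R) ?_ ?_ (mem_ball_self hR.1) hz
      · intro v hv
        obtain ⟨h1, h2, h3⟩ := ht (i, j) v (hsub hv)
        exact (hψd _ h1).comp v h3
      · intro v hv
        obtain ⟨h1, h2, h3⟩ := ht (i, j) v (hsub hv)
        have h4 := aux_dom (hψd _ h1) (S.P_iter_diff L _) h3 (hψb _ h1)
        have h5 : deriv (S.P^[L] ∘ t (i, j)) v = 1 := by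
          rw [← deriv_id v]
          apply Filter.EventuallyEq.deriv_eq
          filter_upwards [isOpen_ball.mem_nhds hv] with u hu
          exact (ht (i, j) u (hsub hu)).2.1
        rw [h5, norm_one, mul_one] at h4
        exact h4
    have hC : ‖z - S.r j‖ ≤ R := by
      rw [← dist_eq_norm]; exact (mem_ball.1 hz).le
    have hD := norm_sub_le_norm_sub_add_norm_sub ((φ ∘ τ ∘ t (i, j)) z)
      ((φ ∘ τ ∘ t (i, j)) (S.r j)) (φ (S.r i))
    simp only [Function.comp_apply, hτr] at hA hB hD ⊢
    have hE := mul_le_mul_of_nonneg_left hC hδ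
    have hF := mul_le_mul_of_nonneg_left (hN (i, j)) hδ
    linarith

/-! ### One step of the graph transform -/

/-- vertical graphs over `V i` -/
def AuxGood (H V : Fin 3 → Set ℂ) (δ₀ : ℝ) (x : Fin 3 × (ℂ → ℂ)) : Prop :=
  DifferentiableOn ℂ x.2 (V x.1) ∧ (∀ w ∈ V x.1, x.2 w ∈ H x.1) ∧
    ∀ w ∈ V x.1, ‖deriv x.2 w‖ < δ₀

lemma aux_graph_deriv {f : ℂ × ℂ → ℂ × ℂ} {σ : ℂ → ℂ} {w : ℂ}
    (hf : DifferentiableAt ℂ f (σ w, w)) (hσ : DifferentiableAt ℂ σ w) :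
    HasDerivAt (fun w => f (σ w, w)) (fderiv ℂ f (σ w, w) (deriv σ w, 1)) w :=
  HasFDerivAt.comp_hasDerivAt (f := fun w => (σ w, w)) w hf.hasFDerivAt
    (hσ.hasDerivAt.prodMk (hasDerivAt_id w))

lemma aux_step {H V : Fin 3 → Set ℂ} (hH : ∀ i, IsOpen (H i)) (hV : ∀ i, IsOpen (V i))
    {r : Fin 3 → ℂ} (hr : ∀ i, r i ∈ V i) {Q : ℂ → ℂ}
    {K : Set ℂ} {ρ M ε δ₀ δ' α : ℝ} (hρ : 0 < ρ)
    (hVsub : ∀ j, V j ⊆ ball (r j) (ρ / 2))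
    (hexp : ∀ i, ∀ w ∈ V i, 1 < ‖deriv Q w‖)
    (ht : ∀ j i, ∃ t : ℂ → ℂ,
        (∀ z ∈ ball (r j) ρ, t z ∈ V i ∧ Q (t z) = z ∧ DifferentiableAt ℂ t z) ∧
        ∀ (φ : ℂ → ℂ) (δ : ℝ), 0 ≤ δ → (∀ w ∈ V i, DifferentiableAt ℂ φ w) →
          (∀ w ∈ V i, ‖deriv φ w‖ ≤ δ * ‖deriv Q w‖) →
          ∀ z ∈ ball (r j) ρ, ‖φ (t z) - φ (r i)‖ ≤ δ * M)
    (hε : ∀ x ∈ K, ∃ j, ball x ε ⊆ H j)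
    (hδ0 : 0 < δ₀) (hδ1 : δ₀ ≤ 1) (hδ' : 0 < δ')
    (hα : 0 < α) (hα1 : α ≤ 1 / 32) (hα2 : α ≤ ρ / 32) (hα3 : δ' + 4 * α ≤ δ₀)
    (hα4 : α + δ₀ * M < ε)
    {h : ℂ × ℂ → ℂ} {f g : ℂ × ℂ → ℂ × ℂ} (hg : g = fun x => (h x, Q x.2))
    (hgd : DifferentiableOn ℂ g (⋃ j : Fin 3, H j ×ˢ V j))
    (hhK : ∀ x ∈ ⋃ j : Fin 3, H j ×ˢ V j, h x ∈ K)
    (hcone : ∀ x ∈ ⋃ j : Fin 3, H j ×ˢ V j, ∀ v ∈ cone δ₀, fderiv ℂ g x v ∈ cone δ')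
    (hfd : DifferentiableOn ℂ f (⋃ j : Fin 3, H j ×ˢ V j))
    (hfg : ∀ x ∈ ⋃ j : Fin 3, H j ×ˢ V j, ‖f x - g x‖ + ‖fderiv ℂ f x - fderiv ℂ g x‖ ≤ α)
    (x : Fin 3 × (ℂ → ℂ)) (hx : AuxGood H V δ₀ x) :
    ∃ (y : Fin 3 × (ℂ → ℂ)) (s : ℂ → ℂ), AuxGood H V δ₀ y ∧
      ContinuousOn s (closedBall (r y.1) (ρ / 2)) ∧
      MapsTo s (closedBall (r y.1) (ρ / 2)) (V x.1) ∧
      ∀ z ∈ V y.1, f (x.2 (s z), s z) = (y.2 z, z) := by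
  obtain ⟨i, σ⟩ := x
  obtain ⟨hσd, hσH, hσ'⟩ := hx
  simp only at hσd hσH hσ'
  have hZo : IsOpen (⋃ j : Fin 3, H j ×ˢ V j) := isOpen_iUnion fun j => (hH j).prod (hV j)
  have hZ : ∀ w ∈ V i, (σ w, w) ∈ ⋃ j : Fin 3, H j ×ˢ V j := fun w hw =>
    mem_iUnion.2 ⟨i, hσH w hw, hw⟩
  have hσa : ∀ w ∈ V i, DifferentiableAt ℂ σ w := fun w hw =>
    hσd.differentiableAt ((hV i).mem_nhds hw)
  have hF : ∀ w ∈ V i, HasDerivAt (fun w => f (σ w, w))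
      (fderiv ℂ f (σ w, w) (deriv σ w, 1)) w := fun w hw =>
    aux_graph_deriv (hfd.differentiableAt (hZo.mem_nhds (hZ w hw))) (hσa w hw)
  have hG : ∀ w ∈ V i, HasDerivAt (fun w => g (σ w, w))
      (fderiv ℂ g (σ w, w) (deriv σ w, 1)) w := fun w hw =>
    aux_graph_deriv (hgd.differentiableAt (hZo.mem_nhds (hZ w hw))) (hσa w hw)
  -- projections
  have fst_d : ∀ {u : ℂ → ℂ × ℂ} {u' : ℂ × ℂ} {w : ℂ}, HasDerivAt u u' w →
      HasDerivAt (fun w => (u w).1) u'.1 w := fun {u u' w} hu =>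
    HasFDerivAt.comp_hasDerivAt w (ContinuousLinearMap.fst ℂ ℂ ℂ).hasFDerivAt hu
  have snd_d : ∀ {u : ℂ → ℂ × ℂ} {u' : ℂ × ℂ} {w : ℂ}, HasDerivAt u u' w →
      HasDerivAt (fun w => (u w).2) u'.2 w := fun {u u' w} hu =>
    HasFDerivAt.comp_hasDerivAt w (ContinuousLinearMap.snd ℂ ℂ ℂ).hasFDerivAt hu
  have hQd : ∀ w ∈ V i, HasDerivAt Q (fderiv ℂ g (σ w, w) (deriv σ w, 1)).2 w := by
    intro w hw
    have := snd_d (hG w hw)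
    simpa only [hg] using this
  have hhd : ∀ w ∈ V i, HasDerivAt (fun w => h (σ w, w))
      (fderiv ℂ g (σ w, w) (deriv σ w, 1)).1 w := by
    intro w hw
    have := fst_d (hG w hw)
    simpa only [hg] using this
  have hcone' : ∀ w ∈ V i, ‖(fderiv ℂ g (σ w, w) (deriv σ w, 1)).1‖ <
      δ' * ‖(fderiv ℂ g (σ w, w) (deriv σ w, 1)).2‖ := by
    intro w hw
    refine hcone _ (hZ w hw) (deriv σ w, 1) ?_
    change ‖deriv σ w‖ < δ₀ * ‖(1 : ℂ)‖
    rw [norm_one, mul_one]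
    exact hσ' w hw
  have hdiff : ∀ w ∈ V i, ‖fderiv ℂ f (σ w, w) (deriv σ w, 1) -
      fderiv ℂ g (σ w, w) (deriv σ w, 1)‖ ≤ α := by
    intro w hw
    have h1 : ‖fderiv ℂ f (σ w, w) - fderiv ℂ g (σ w, w)‖ ≤ α := by
      linarith [hfg _ (hZ w hw), norm_nonneg (f (σ w, w) - g (σ w, w))]
    have h2 := (fderiv ℂ f (σ w, w) - fderiv ℂ g (σ w, w)).le_opNorm (deriv σ w, 1)
    have h3 : ‖((deriv σ w, 1) : ℂ × ℂ)‖ ≤ 1 := by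
      rw [Prod.norm_def]
      exact max_le ((hσ' w hw).le.trans hδ1) (by simp)
    calc _ ≤ _ := h2
      _ ≤ α * 1 := mul_le_mul h1 h3 (norm_nonneg _) hα.le
      _ = α := mul_one _
  have hdiff1 : ∀ w ∈ V i, ‖(fderiv ℂ f (σ w, w) (deriv σ w, 1)).1 -
      (fderiv ℂ g (σ w, w) (deriv σ w, 1)).1‖ ≤ α := fun w hw =>
    (norm_fst_le (_ - _ : ℂ × ℂ)).trans (hdiff w hw)
  have hdiff2 : ∀ w ∈ V i, ‖(fderiv ℂ f (σ w, w) (deriv σ w, 1)).2 -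
      (fderiv ℂ g (σ w, w) (deriv σ w, 1)).2‖ ≤ α := fun w hw =>
    (norm_snd_le (_ - _ : ℂ × ℂ)).trans (hdiff w hw)
  have hb0 : ∀ w ∈ V i, 1 < ‖(fderiv ℂ g (σ w, w) (deriv σ w, 1)).2‖ := by
    intro w hw
    rw [← (hQd w hw).deriv]
    exact hexp i w hw
  have hslope : ∀ w ∈ V i, ‖(fderiv ℂ f (σ w, w) (deriv σ w, 1)).1‖ <
      δ₀ * ‖(fderiv ℂ f (σ w, w) (deriv σ w, 1)).2‖ := by
    intro w hw
    have h1 := hdiff1 w hw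
    have h2 := hdiff2 w hw
    have h3 := hcone' w hw
    have h4 := hb0 w hw
    set a := (fderiv ℂ f (σ w, w) (deriv σ w, 1)).1
    set b := (fderiv ℂ f (σ w, w) (deriv σ w, 1)).2
    set a0 := (fderiv ℂ g (σ w, w) (deriv σ w, 1)).1
    set b0 := (fderiv ℂ g (σ w, w) (deriv σ w, 1)).2
    have e1 : ‖a‖ ≤ ‖a0‖ + α := by linarith [norm_sub_norm_le a a0]
    have e2 : ‖b0‖ ≤ ‖b‖ + α := by
      have := norm_sub_norm_le b0 b
      rw [norm_sub_rev] at this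
      linarith
    have e3 : 1 / 2 ≤ ‖b‖ := by linarith
    have e4 : δ' * ‖b0‖ ≤ δ' * (‖b‖ + α) := mul_le_mul_of_nonneg_left e2 hδ'.le
    have e5 : δ' * α ≤ 1 * α := mul_le_mul_of_nonneg_right (by linarith) hα.le
    have e6 : (δ' + 4 * α) * ‖b‖ ≤ δ₀ * ‖b‖ := mul_le_mul_of_nonneg_right hα3 (norm_nonneg _)
    have e7 : 4 * α * (1 / 2) ≤ 4 * α * ‖b‖ := mul_le_mul_of_nonneg_left e3 (by linarith)
    linarith
  have hval : ∀ w ∈ V i, ‖f (σ w, w) - g (σ w, w)‖ ≤ α := fun w hw => by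
    linarith [hfg _ (hZ w hw), norm_nonneg (fderiv ℂ f (σ w, w) - fderiv ℂ g (σ w, w))]
  have hval1 : ∀ w ∈ V i, ‖(f (σ w, w)).1 - h (σ w, w)‖ ≤ α := fun w hw => by
    have := (norm_fst_le (f (σ w, w) - g (σ w, w))).trans (hval w hw)
    simpa only [hg, Prod.fst_sub] using this
  have hval2 : ∀ w ∈ V i, ‖(f (σ w, w)).2 - Q w‖ ≤ α := fun w hw => by
    have := (norm_snd_le (f (σ w, w) - g (σ w, w))).trans (hval w hw)
    simpa only [hg, Prod.snd_sub] using this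
  -- choice of `j`
  obtain ⟨j, hj⟩ := hε _ (hhK _ (hZ _ (hr i)))
  obtain ⟨t, ht1, ht2⟩ := ht j i
  -- inverse of `F ∘ t`
  have hFt : ∀ z ∈ ball (r j) ρ, HasDerivAt (fun z => (f (σ (t z), t z)).2)
      ((fderiv ℂ f (σ (t z), t z) (deriv σ (t z), 1)).2 * deriv t z) z := by
    intro z hz
    obtain ⟨h1, h2, h3⟩ := ht1 z hz
    exact HasDerivAt.comp z (snd_d (hF _ h1)) h3.hasDerivAt
  have hQt : ∀ z ∈ ball (r j) ρ,
      (fderiv ℂ g (σ (t z), t z) (deriv σ (t z), 1)).2 * deriv t z = 1 := by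
    intro z hz
    obtain ⟨h1, h2, h3⟩ := ht1 z hz
    have e1 := HasDerivAt.comp z (hQd _ h1) h3.hasDerivAt
    refine e1.unique ((hasDerivAt_id z).congr_of_eventuallyEq ?_)
    filter_upwards [isOpen_ball.mem_nhds hz] with u hu
    exact (ht1 u hu).2.1
  obtain ⟨y, hy⟩ := aux_inv (G := fun z => (f (σ (t z), t z)).2) (c := r j) hρ hα.le hα1 hα2
    (fun z hz => (hFt z hz).differentiableAt)
    (by
      intro z hz
      obtain ⟨h1, h2, h3⟩ := ht1 z hz
      rw [(hFt z hz).deriv]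
      have e1 := hQt z hz
      have e2 := hdiff2 _ h1
      have e3 := hb0 _ h1
      set b := (fderiv ℂ f (σ (t z), t z) (deriv σ (t z), 1)).2
      set b0 := (fderiv ℂ g (σ (t z), t z) (deriv σ (t z), 1)).2
      have e4 : ‖b0‖ * ‖deriv t z‖ = 1 := by rw [← norm_mul, e1, norm_one]
      have e5 : ‖deriv t z‖ ≤ 1 := by nlinarith [norm_nonneg (deriv t z)]
      rw [← e1, ← sub_mul, norm_mul]
      calc _ ≤ α * 1 := mul_le_mul e2 e5 (norm_nonneg _) hα.le
        _ = α := mul_one _)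
    (by
      have hz : r j ∈ ball (r j) ρ := mem_ball_self hρ
      obtain ⟨h1, h2, h3⟩ := ht1 _ hz
      have := hval2 _ h1
      rwa [h2] at this)
  have hsubE : closedBall (r j) (ρ / 2) ⊆ ball (r j) (3 * ρ / 4) :=
    closedBall_subset_ball (by linarith)
  have hsV : ∀ z ∈ ball (r j) (3 * ρ / 4), t (y z) ∈ V i := fun z hz => (ht1 _ (hy z hz).1).1
  have hsd : ∀ z ∈ ball (r j) (3 * ρ / 4), DifferentiableAt ℂ (fun z => t (y z)) z := fun z hz =>
    (ht1 _ (hy z hz).1).2.2.comp z (hy z hz).2.2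
  have hVE : V j ⊆ ball (r j) (3 * ρ / 4) :=
    (hVsub j).trans (ball_subset_ball (by linarith))
  have hnew : ∀ z ∈ V j, HasDerivAt (fun z => (f (σ (t (y z)), t (y z))).1)
      ((fderiv ℂ f (σ (t (y z)), t (y z)) (deriv σ (t (y z)), 1)).1 *
        deriv (fun z => t (y z)) z) z := fun z hz =>
    HasDerivAt.comp (h := fun z => t (y z)) z (fst_d (hF _ (hsV z (hVE hz))))
      (hsd z (hVE hz)).hasDerivAt
  refine ⟨(j, fun z => (f (σ (t (y z)), t (y z))).1), fun z => t (y z), ⟨?_, ?_, ?_⟩, ?_, ?_, ?_⟩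
  · exact fun z hz => (hnew z hz).differentiableAt.differentiableWithinAt
  · intro z hz
    apply hj
    have e1 := hval1 _ (hsV z (hVE hz))
    have e2 := ht2 (fun w => h (σ w, w)) δ₀ hδ0.le (fun w hw => (hhd w hw).differentiableAt)
      (by
        intro w hw
        rw [(hhd w hw).deriv, (hQd w hw).deriv]
        refine (hcone' w hw).le.trans ?_
        exact mul_le_mul_of_nonneg_right (by linarith) (norm_nonneg _)) (y z) (hy z (hVE hz)).1
    have e3 := norm_sub_le_norm_sub_add_norm_sub (f (σ (t (y z)), t (y z))).1
      (h (σ (t (y z)), t (y z))) (h (σ (r i), r i))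
    rw [mem_ball, dist_eq_norm]
    simp only at e2 ⊢
    linarith
  · intro z hz
    change ‖deriv (fun z => (f (σ (t (y z)), t (y z))).1) z‖ < δ₀
    rw [(hnew z hz).deriv]
    have e1 := HasDerivAt.comp (h := fun z => t (y z)) z (snd_d (hF _ (hsV z (hVE hz))))
      (hsd z (hVE hz)).hasDerivAt
    have e2 : (fderiv ℂ f (σ (t (y z)), t (y z)) (deriv σ (t (y z)), 1)).2 *
        deriv (fun z => t (y z)) z = 1 := by
      refine e1.unique ((hasDerivAt_id z).congr_of_eventuallyEq ?_)
      filter_upwards [isOpen_ball.mem_nhds (hVE hz)] with u hu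
      exact (hy u hu).2.1
    have e3 := hslope _ (hsV z (hVE hz))
    set a := (fderiv ℂ f (σ (t (y z)), t (y z)) (deriv σ (t (y z)), 1)).1
    set b := (fderiv ℂ f (σ (t (y z)), t (y z)) (deriv σ (t (y z)), 1)).2
    set s' := deriv (fun z => t (y z)) z
    have e4 : ‖b‖ * ‖s'‖ = 1 := by rw [← norm_mul, e2, norm_one]
    have e5 : 0 < ‖s'‖ := by
      rcases (norm_nonneg s').eq_or_lt with h0 | h0
      · rw [← h0] at e4; simp at e4
      · exact h0
    rw [norm_mul]
    calc ‖a‖ * ‖s'‖ < δ₀ * ‖b‖ * ‖s'‖ := mul_lt_mul_of_pos_right e3 e5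
      _ = δ₀ := by rw [mul_assoc, e4, mul_one]
  · exact fun z hz => (hsd z (hsubE hz)).continuousAt.continuousWithinAt
  · exact fun z hz => hsV z (hsubE hz)
  · intro z hz
    exact Prod.ext rfl (hy z (hVE hz)).2.1

/-- A sequence of inverse branches. -/
lemma aux_orbit {H V : Fin 3 → Set ℂ} {δ₀ ρ : ℝ} {r : Fin 3 → ℂ} (hρ : 0 < ρ)
    (hVsub : ∀ j, V j ⊆ ball (r j) (ρ / 2)) {f : ℂ × ℂ → ℂ × ℂ}
    (step : ∀ x : Fin 3 × (ℂ → ℂ), AuxGood H V δ₀ x →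
      ∃ (y : Fin 3 × (ℂ → ℂ)) (s : ℂ → ℂ), AuxGood H V δ₀ y ∧
      ContinuousOn s (closedBall (r y.1) (ρ / 2)) ∧
      MapsTo s (closedBall (r y.1) (ρ / 2)) (V x.1) ∧
      ∀ z ∈ V y.1, f (x.2 (s z), s z) = (y.2 z, z))
    (x₀ : Fin 3 × (ℂ → ℂ)) (hx₀ : AuxGood H V δ₀ x₀) :
    ∃ w ∈ V x₀.1, ∀ n : ℕ, f^[n] (x₀.2 w, w) ∈ ⋃ j : Fin 3, H j ×ˢ V j := by
  choose! N s hN hs hm hf using step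
  set X : ℕ → Fin 3 × (ℂ → ℂ) := fun n => N^[n] x₀ with hXdef
  have hX0 : X 0 = x₀ := rfl
  have hXs : ∀ n, X (n + 1) = N (X n) := fun n => Function.iterate_succ_apply' _ _ _
  have hX : ∀ n, AuxGood H V δ₀ (X n) := by
    intro n
    induction n with
    | zero => exact hx₀
    | succ n ih => rw [hXs]; exact hN _ ih
  let E : ℕ → Set ℂ := fun n => closedBall (r (X n).1) (ρ / 2)
  have hVE : ∀ n, V (X n).1 ⊆ E n := fun n => (hVsub _).trans ball_subset_closedBall
  have hsc : ∀ n, ContinuousOn (s (X n)) (E (n + 1)) := by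
    intro n
    change ContinuousOn (s (X n)) (closedBall (r (X (n + 1)).1) (ρ / 2))
    rw [hXs]; exact hs _ (hX n)
  have hsm : ∀ n, MapsTo (s (X n)) (E (n + 1)) (V (X n).1) := by
    intro n
    change MapsTo (s (X n)) (closedBall (r (X (n + 1)).1) (ρ / 2)) _
    rw [hXs]; exact hm _ (hX n)
  have hsf : ∀ n, ∀ z ∈ V (X (n + 1)).1,
      f ((X n).2 (s (X n) z), s (X n) z) = ((X (n + 1)).2 z, z) := by
    intro n
    rw [hXs]; exact hf _ (hX n)
  let T : ℕ → ℂ → ℂ := fun n => Nat.rec id (fun k T => T ∘ s (X k)) n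
  have hT0 : T 0 = id := rfl
  have hTs : ∀ n, T (n + 1) = T n ∘ s (X n) := fun n => rfl
  have hTc : ∀ n, ContinuousOn (T n) (E n) := by
    intro n
    induction n with
    | zero => exact continuousOn_id
    | succ n ih =>
      rw [hTs]
      exact ih.comp (hsc n) (fun z hz => hVE n (hsm n hz))
  have hTf : ∀ n, ∀ v ∈ V (X n).1, f^[n] (x₀.2 (T n v), T n v) = ((X n).2 v, v) := by
    intro n
    induction n with
    | zero => intro v hv; rfl
    | succ n ih =>
      intro v hv
      rw [hTs, Function.iterate_succ_apply', Function.comp_apply,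
        ih _ (hsm n (hVE (n + 1) hv)), hsf n v hv]
  have hcomp : ∀ n, IsCompact (T n '' E n) := fun n =>
    (isCompact_closedBall _ _).image_of_continuousOn (hTc n)
  obtain ⟨w, hw⟩ := IsCompact.nonempty_iInter_of_sequence_nonempty_isCompact_isClosed
    (fun n => T n '' E n)
    (by
      intro n
      change T (n + 1) '' E (n + 1) ⊆ T n '' E n
      rw [hTs, image_comp]
      exact image_mono (fun z ⟨u, hu, e⟩ => e ▸ hVE n (hsm n hu)))
    (fun n => ⟨_, mem_image_of_mem _ (mem_closedBall_self (by positivity))⟩)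
    (hcomp 0) (fun n => (hcomp n).isClosed)
  rw [mem_iInter] at hw
  have hw' : ∀ n, ∃ v ∈ V (X n).1, T n v = w := by
    intro n
    obtain ⟨z, hz, e⟩ := hw (n + 1)
    exact ⟨s (X n) z, hsm n hz, e⟩
  refine ⟨w, ?_, ?_⟩
  · obtain ⟨v, hv, e⟩ := hw' 0
    rw [hT0, id] at e
    rw [← e]; exact hv
  · intro n
    obtain ⟨v, hv, e⟩ := hw' n
    rw [← e, hTf n v hv]
    exact mem_iUnion.2 ⟨(X n).1, (hX n).2.1 v hv, hv⟩

/-- Proposition 3.4: for an admissible system, open sets `H i`, a compact `K ⊆ H 0 ∪ H 1 ∪ H 2`,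
there are `δ₀ > 0` and `L₀ ≥ l₀` such that for every `l ≥ L₀` and every holomorphic skew product
`g = (h, q^{l m₁})` mapping `Z^l = ⋃ Hᵢ × Vᵢ^l` into `K × ℂ` and contracting the cone field
`C_{δ₀}`, there is `α > 0` such that every holomorphic `f` that is `α`-close to `g` in the `C¹`
sense on `Z^l` has the property that any vertical graph over `Vᵢ^l` in `Hᵢ`, tangent to `C_{δ₀}`,
contains a point whose whole forward `f`-orbit stays in `Z^l`; in particular
`Λ_f = ⋂ₙ f^{-n}(closure Z^l)` meets the graph. -/
theorem stmt_3 (S : AdmissibleSystem) (H : Fin 3 → Set ℂ) (hH : ∀ i, IsOpen (H i))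
    (K : Set ℂ) (hK : IsCompact K) (hKH : K ⊆ H 0 ∪ H 1 ∪ H 2) :
    ∃ (δ₀ : ℝ) (L₀ : ℕ), 0 < δ₀ ∧ S.l₀ ≤ L₀ ∧
      ∀ l, L₀ ≤ l →
        ∀ h : ℂ × ℂ → ℂ,
          DifferentiableOn ℂ (fun x : ℂ × ℂ => (h x, (fun w => S.q.eval w)^[l * S.m₁] x.2))
            (⋃ j : Fin 3, H j ×ˢ S.V j l) →
          (∀ x ∈ ⋃ j : Fin 3, H j ×ˢ S.V j l, h x ∈ K) →
          ContractsCone (fun x : ℂ × ℂ => (h x, (fun w => S.q.eval w)^[l * S.m₁] x.2)) δ₀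
            (⋃ j : Fin 3, H j ×ˢ S.V j l) →
          ∃ α : ℝ, 0 < α ∧
            ∀ f : ℂ × ℂ → ℂ × ℂ,
              DifferentiableOn ℂ f (⋃ j : Fin 3, H j ×ˢ S.V j l) →
              (∀ x ∈ ⋃ j : Fin 3, H j ×ˢ S.V j l,
                ‖f x - (h x, (fun w => S.q.eval w)^[l * S.m₁] x.2)‖ +
                  ‖fderiv ℂ f x -
                    fderiv ℂ (fun x : ℂ × ℂ => (h x, (fun w => S.q.eval w)^[l * S.m₁] x.2)) x‖
                  ≤ α) →
              ∀ i : Fin 3, ∀ σ : ℂ → ℂ,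
                DifferentiableOn ℂ σ (S.V i l) →
                (∀ w ∈ S.V i l, σ w ∈ H i) →
                (∀ w ∈ S.V i l, ‖deriv σ w‖ < δ₀) →
                ∃ w ∈ S.V i l,
                  (∀ n : ℕ, f^[n] (σ w, w) ∈ ⋃ j : Fin 3, H j ×ˢ S.V j l) ∧
                  (σ w, w) ∈ ⋂ n : ℕ, f^[n] ⁻¹' closure (⋃ j : Fin 3, H j ×ˢ S.V j l) := by
  obtain ⟨ρ, M, L₀, hρ, hM, hL₀, hgeom⟩ := S.geom
  obtain ⟨ε, hε, hleb⟩ := lebesgue_number_lemma_of_metric hK hH (by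
    intro x hx
    rcases hKH hx with (h0 | h1) | h2
    · exact mem_iUnion.2 ⟨0, h0⟩
    · exact mem_iUnion.2 ⟨1, h1⟩
    · exact mem_iUnion.2 ⟨2, h2⟩)
  have hM1 : 0 < 2 * (M + 1) := by linarith
  refine ⟨min 1 (ε / (2 * (M + 1))), L₀, lt_min one_pos (div_pos hε hM1), hL₀, ?_⟩
  set δ₀ := min 1 (ε / (2 * (M + 1))) with hδ₀
  have hδpos : 0 < δ₀ := lt_min one_pos (div_pos hε hM1)
  have hδM : δ₀ * M ≤ ε / 2 := by
    have h1 : δ₀ * (2 * (M + 1)) ≤ ε := (le_div_iff₀ hM1).1 (min_le_right _ _)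
    nlinarith
  intro l hl h hgd hhK hcon
  obtain ⟨δ', hδ', hδ'', hcone⟩ := hcon
  rw [S.iter_eq] at hgd hcone ⊢
  refine ⟨min (min (1 / 32) (ρ / 32)) (min ((δ₀ - δ') / 4) (ε / 4)), ?_, ?_⟩
  · exact lt_min (lt_min (by norm_num) (by linarith)) (lt_min (by linarith) (by linarith))
  set α := min (min (1 / 32) (ρ / 32)) (min ((δ₀ - δ') / 4) (ε / 4)) with hα
  have hα0 : 0 < α :=
    lt_min (lt_min (by norm_num) (by linarith)) (lt_min (by linarith) (by linarith))
  have hα1 : α ≤ 1 / 32 := (min_le_left _ _).trans (min_le_left _ _)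
  have hα2 : α ≤ ρ / 32 := (min_le_left _ _).trans (min_le_right _ _)
  have hα3 : α ≤ (δ₀ - δ') / 4 := (min_le_right _ _).trans (min_le_left _ _)
  have hα4 : α ≤ ε / 4 := (min_le_right _ _).trans (min_le_right _ _)
  intro f hfd hfg i σ hσd hσH hσ'
  obtain ⟨w, hw, horb⟩ := aux_orbit (H := H) (V := fun j => S.V j l) (δ₀ := δ₀) (r := S.r) hρ
    (fun j => (hgeom l hl j).1) (f := f)
    (fun x hx => aux_step hH (fun j => S.hVopen j l) (fun j => S.hVmem j l) hρ
      (fun j => (hgeom l hl j).1) (fun j w hw => S.one_lt (hL₀.trans hl) j hw)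
      (fun j => (hgeom l hl j).2) hleb hδpos (min_le_left _ _) hδ' hα0 hα1 hα2
      (by linarith) (by linarith) rfl hgd hhK hcone hfd hfg x hx)
    (i, σ) ⟨hσd, hσH, hσ'⟩
  exact ⟨w, hw, horb, mem_iInter.2 fun n => subset_closure (horb n)⟩
end

section
/- Let Z ⊆ ℂ² be open, 0 < δ' < δ, and let g(z,w) = (h(z,w), Q(w)) be a holomorphic map on Z whose derivative D_x g maps the cone C_δ into C_{δ'} at every point x ∈ Z. Let V ⊆ ℂ be open, ψ : V → ℂ holomorphic with Q(ψ(w)) = w for all w ∈ V, and let σ be a holomorphic function on a neighborhood of ψ(V) with |σ'| < δ there, such that (σ(ψ(w)), ψ(w)) ∈ Z for all w ∈ V. Then the function σ₁(w) := h(σ(ψ(w)), ψ(w)) satisfies |σ₁'(w)| < δ' for all w ∈ V. (In particular, the image under g of a vertical graph tangent to C_δ contains a vertical graph over V tangent to C_{δ'}.) -/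
open Metric Set

/-- The graph-transform step from the proof of Proposition 3.4: if `g = (h, Q ∘ pr₂)` is
holomorphic on an open set `Z` and its derivative maps the cone `C_δ` into `C_{δ'}` on `Z`,
`ψ` is a holomorphic local inverse branch of `Q` on an open set `V`, and `σ` is holomorphic with
`|σ'| < δ` on an open neighborhood `W` of `ψ(V)` with `(σ(ψ w), ψ w) ∈ Z` for `w ∈ V`, then the
transformed graph map `σ₁ w = h (σ (ψ w), ψ w)` satisfies `|σ₁'| < δ'` on `V`. -/
theorem stmt_4 (Z : Set (ℂ × ℂ)) (hZ : IsOpen Z) (δ δ' : ℝ) (hδ' : 0 < δ') (hδ : δ' < δ)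
    (h : ℂ × ℂ → ℂ) (Q : ℂ → ℂ)
    (hg : DifferentiableOn ℂ (fun x : ℂ × ℂ => (h x, Q x.2)) Z)
    (hcone : ∀ x ∈ Z, ∀ v ∈ cone δ, fderiv ℂ (fun x : ℂ × ℂ => (h x, Q x.2)) x v ∈ cone δ')
    (V : Set ℂ) (hV : IsOpen V) (ψ : ℂ → ℂ) (hψ : DifferentiableOn ℂ ψ V)
    (hQψ : ∀ w ∈ V, Q (ψ w) = w)
    (W : Set ℂ) (hW : IsOpen W) (hψW : ψ '' V ⊆ W)
    (σ : ℂ → ℂ) (hσ : DifferentiableOn ℂ σ W) (hσ' : ∀ z ∈ W, ‖deriv σ z‖ < δ)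
    (hin : ∀ w ∈ V, (σ (ψ w), ψ w) ∈ Z) :
    ∀ w ∈ V, ‖deriv (fun w => h (σ (ψ w), ψ w)) w‖ < δ' := by
  intro w hw
  have hψd : HasDerivAt ψ (deriv ψ w) w :=
    (hψ.differentiableAt (hV.mem_nhds hw)).hasDerivAt
  have hmem : ψ w ∈ W := hψW ⟨w, hw, rfl⟩
  have hσd : HasDerivAt σ (deriv σ (ψ w)) (ψ w) :=
    (hσ.differentiableAt (hW.mem_nhds hmem)).hasDerivAt
  have hγ : HasDerivAt (fun w => (σ (ψ w), ψ w)) (deriv σ (ψ w) * deriv ψ w, deriv ψ w) w :=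
    (hσd.comp w hψd).prodMk hψd
  have hgd := (hg.differentiableAt (hZ.mem_nhds (hin w hw))).hasFDerivAt
  have hc := hgd.comp_hasDerivAt w hγ
  have hcone' := hcone _ (hin w hw) (deriv σ (ψ w) * deriv ψ w, deriv ψ w)
  generalize fderiv ℂ (fun x : ℂ × ℂ => (h x, Q x.2)) (σ (ψ w), ψ w) = L at hc hcone'
  have h1 : HasDerivAt (fun w => h (σ (ψ w), ψ w))
      (L (deriv σ (ψ w) * deriv ψ w, deriv ψ w)).1 w :=
    (ContinuousLinearMap.fst ℂ ℂ ℂ).hasFDerivAt.comp_hasDerivAt w hc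
  have h2 : HasDerivAt (fun w => Q (ψ w))
      (L (deriv σ (ψ w) * deriv ψ w, deriv ψ w)).2 w :=
    (ContinuousLinearMap.snd ℂ ℂ ℂ).hasFDerivAt.comp_hasDerivAt w hc
  have h3 : HasDerivAt (fun w => Q (ψ w)) 1 w :=
    (hasDerivAt_id w).congr_of_eventuallyEq
      (Filter.eventuallyEq_of_mem (hV.mem_nhds hw) fun x hx => hQψ x hx)
  have h4 := h2.unique h3
  have hne : deriv ψ w ≠ 0 := by
    intro h0
    rw [h0, mul_zero, Prod.mk_zero_zero, map_zero] at h4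
    simp at h4
  have hv := hcone' (by
    simp only [cone, Set.mem_ofPred_eq, norm_mul]
    exact mul_lt_mul_of_pos_right (hσ' _ hmem) (norm_pos_iff.mpr hne))
  simp only [cone, Set.mem_ofPred_eq] at hv
  rw [h4, norm_one, mul_one] at hv
  rw [h1.deriv]
  exact hv
end

section
/- With the admissible system of neighborhoods Vᵢ^l and the triangle data (c₁,c₂,c₃,ε₀,α₀) as in the context, there exist L₀ ≥ l₀ and δ₀ > 0 such that for every l ≥ L₀, every ρ ∈ ℂ with |ρ| = 1+α₀, and every polynomial skew product g(z,w) = (h(z,w), q^{m₁·l}(w)) satisfying (i) |h(z,w) − (ρz + ε₀cⱼ)| ≤ δ₀ for all (z,w) ∈ 2𝔻 × Vⱼ^l and j ∈ {1,2,3}, and (ii) g contracts the cone field C_{δ₀} on closure(∪_{j=1}^3 𝔻 × Vⱼ^l), the following hold: there exist open sets H₁, H₂, H₃ ⊆ 𝔻 with (1/2)𝔻 ⊆ H₁ ∩ H₂ ∩ H₃ such that (a) closure(∪_{j=1}^3 𝔻 × Vⱼ^l) ⊆ g(∪_{j=1}^3 𝔻 × Vⱼ^l); (b) |∂h/∂z(z,w)|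 > 1 for all (z,w) ∈ closure(𝔻 × Vⱼ^l) and each j; (c) for every i ∈ {1,2,3} and every holomorphic σ : Vᵢ^l → Hᵢ with sup |σ'| < δ₀, the set Λ_g := ∩_{n≥0} g^{-n}(closure(∪_{j=1}^3 Hⱼ × Vⱼ^l)) intersects the graph {(σ(w), w) : w ∈ Vᵢ^l}; and (d) for every i and every holomorphic σ : Vᵢ^l → (1/3)·Hᵢ with sup |σ'| < δ₀, the set Λ'_g := ∩_{n≥0} g^{-n}(closure(∪_{j=1}^3 (1/3)·Hⱼ × Vⱼ^l)) intersects the graph of σ. -/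
open Metric Set
open scoped Pointwise

/-! ### Oscillation of functions with small derivative on connected open sets -/

/-- Uniform oscillation bound between two points. -/
lemma osc_pair {U : Set ℂ} (hU : IsOpen U) (hc : IsPreconnected U) {x y : ℂ} (hx : x ∈ U)
    (hy : y ∈ U) : ∃ M : ℝ, 0 ≤ M ∧ ∀ (τ : ℂ → ℂ) (δ : ℝ), 0 ≤ δ → DifferentiableOn ℂ τ U →
      (∀ w ∈ U, ‖deriv τ w‖ ≤ δ) → ‖τ y - τ x‖ ≤ M * δ := by
  refine hc.induction₂ (fun x y => ∃ M : ℝ, 0 ≤ M ∧ ∀ (τ : ℂ → ℂ) (δ : ℝ), 0 ≤ δ →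
    DifferentiableOn ℂ τ U → (∀ w ∈ U, ‖deriv τ w‖ ≤ δ) → ‖τ y - τ x‖ ≤ M * δ) ?_ ?_ ?_ hx hy
  · intro x hx
    obtain ⟨R, hR, hsub⟩ := Metric.isOpen_iff.1 hU x hx
    filter_upwards [nhdsWithin_le_nhds (ball_mem_nhds x hR)] with y hy
    refine ⟨‖y - x‖, norm_nonneg _, fun τ δ _ hτ hd => ?_⟩
    rw [mul_comm]
    exact Convex.norm_image_sub_le_of_norm_deriv_le
      (fun z hz => (hτ z (hsub hz)).differentiableAt (hU.mem_nhds (hsub hz)))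
      (fun z hz => hd z (hsub hz)) (convex_ball x R) (mem_ball_self hR) hy
  · rintro x y z - - - ⟨M, hM, h⟩ ⟨M', hM', h'⟩
    refine ⟨M + M', by positivity, fun τ δ h0 hτ hd => ?_⟩
    have e : τ z - τ x = (τ z - τ y) + (τ y - τ x) := by ring
    rw [e]
    have := norm_add_le (τ z - τ y) (τ y - τ x)
    have := h τ δ h0 hτ hd
    have := h' τ δ h0 hτ hd
    linarith
  · rintro x y - - ⟨M, hM, h⟩
    refine ⟨M, hM, fun τ δ h0 hτ hd => ?_⟩
    rw [norm_sub_rev]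
    exact h τ δ h0 hτ hd

/-- Uniform oscillation bound on a compact subset. -/
lemma osc_compact {U K : Set ℂ} (hU : IsOpen U) (hc : IsPreconnected U) (hK : IsCompact K)
    (hKU : K ⊆ U) : ∃ M : ℝ, 0 ≤ M ∧ ∀ (τ : ℂ → ℂ) (δ : ℝ), 0 ≤ δ → DifferentiableOn ℂ τ U →
      (∀ w ∈ U, ‖deriv τ w‖ ≤ δ) → ∀ x ∈ K, ∀ y ∈ K, ‖τ y - τ x‖ ≤ M * δ := by
  rcases U.eq_empty_or_nonempty with rfl | ⟨a, ha⟩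
  · exact ⟨0, le_rfl, fun τ δ _ _ _ x hx => (hKU hx).elim⟩
  have key : ∃ M : ℝ, 0 ≤ M ∧ ∀ (τ : ℂ → ℂ) (δ : ℝ), 0 ≤ δ → DifferentiableOn ℂ τ U →
      (∀ w ∈ U, ‖deriv τ w‖ ≤ δ) → ∀ x ∈ K, ‖τ x - τ a‖ ≤ M * δ := by
    refine hK.induction_on (p := fun T => ∃ M : ℝ, 0 ≤ M ∧ ∀ (τ : ℂ → ℂ) (δ : ℝ), 0 ≤ δ →
      DifferentiableOn ℂ τ U →
      (∀ w ∈ U, ‖deriv τ w‖ ≤ δ) → ∀ x ∈ T, ‖τ x - τ a‖ ≤ M * δ) ?_ ?_ ?_ ?_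
    · exact ⟨0, le_rfl, fun τ δ _ _ _ x hx => hx.elim⟩
    · rintro s t hst ⟨M, hM, h⟩
      exact ⟨M, hM, fun τ δ h0 hτ hd x hx => h τ δ h0 hτ hd x (hst hx)⟩
    · rintro s t ⟨M, hM, h⟩ ⟨M', hM', h'⟩
      refine ⟨M + M', by positivity, fun τ δ h0 hτ hd x hx => ?_⟩
      rcases hx with hx | hx
      · have := h τ δ h0 hτ hd x hx
        nlinarith
      · have := h' τ δ h0 hτ hd x hx
        nlinarith
    · intro x hx
      obtain ⟨R, hR, hsub⟩ := Metric.isOpen_iff.1 hU x (hKU hx)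
      obtain ⟨M, hM, h⟩ := osc_pair hU hc ha (hKU hx)
      refine ⟨ball x R, nhdsWithin_le_nhds (ball_mem_nhds x hR), R + M, by positivity,
        fun τ δ h0 hτ hd y hy => ?_⟩
      have h1 : ‖τ y - τ x‖ ≤ δ * ‖y - x‖ := Convex.norm_image_sub_le_of_norm_deriv_le
        (fun z hz => (hτ z (hsub hz)).differentiableAt (hU.mem_nhds (hsub hz)))
        (fun z hz => hd z (hsub hz)) (convex_ball x R) (mem_ball_self hR) hy
      have h2 := h τ δ h0 hτ hd
      have h3 : ‖y - x‖ < R := by simpa [dist_eq_norm] using hy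
      have h4 := norm_add_le (τ y - τ x) (τ x - τ a)
      have e : τ y - τ a = (τ y - τ x) + (τ x - τ a) := by ring
      rw [e]
      nlinarith
  obtain ⟨M, hM, h⟩ := key
  refine ⟨M + M, by positivity, fun τ δ h0 hτ hd x hx y hy => ?_⟩
  have h1 := h τ δ h0 hτ hd x hx
  have h2 := h τ δ h0 hτ hd y hy
  have h4 := norm_sub_le (τ y - τ a) (τ x - τ a)
  have e : τ y - τ x = (τ y - τ a) - (τ x - τ a) := by ring
  rw [e]
  linarith

/-! ### Derivatives of inverse branches -/

/-- The derivative of an inverse of an entire map injective on an open set. -/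
lemma hasDerivAt_inv_branch {f g : ℂ → ℂ} (hf : Differentiable ℂ f) {U : Set ℂ} (hU : IsOpen U)
    (hg : ∀ x ∈ U, g (f x) = x) {x : ℂ} (hx : x ∈ U) (hd : deriv f x ≠ 0) :
    HasDerivAt g (deriv f x)⁻¹ (f x) := by
  have h1 : HasStrictDerivAt f (deriv f x) x :=
    (hf.analyticAt x).hasStrictDerivAt
  exact (h1.to_local_left_inverse hd
    (Filter.eventually_of_mem (hU.mem_nhds hx) hg)).hasDerivAt

/-- Near a repelling fixed point, an entire map is injective and expanding. -/
lemma repelling_nhd {f : ℂ → ℂ} (hf : Differentiable ℂ f) {r : ℂ} (hr : 1 < ‖deriv f r‖) :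
    ∃ R > 0, InjOn f (ball r R) ∧ ∀ x ∈ ball r R, 1 ≤ ‖deriv f x‖ := by
  have h1 : HasStrictDerivAt f (deriv f r) r := (hf.analyticAt r).hasStrictDerivAt
  have h0 : deriv f r ≠ 0 := by
    intro h
    rw [h, norm_zero] at hr
    linarith
  have hcont : Continuous (deriv f) :=
    (hf.contDiff (n := 1)).continuous_deriv le_rfl
  have h2 : ∀ᶠ x in nhds r, 1 < ‖deriv f x‖ :=
    hcont.norm.continuousAt.eventually (lt_mem_nhds hr)
  obtain ⟨R, hR, h⟩ := Metric.eventually_nhds_iff_ball.1 (h2.and (h1.eventually_left_inverse h0))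
  refine ⟨R, hR, ?_, fun x hx => (h x hx).1.le⟩
  intro x hx y hy hxy
  rw [← (h x hx).2, ← (h y hy).2, hxy]

lemma iterate_props {f : ℂ → ℂ} (hf : Differentiable ℂ f) (V : ℕ → Set ℂ) (L : ℕ)
    (hmap : ∀ l, f '' V (l + 1) = V l) (hinj : ∀ l, L ≤ l → InjOn f (V l))
    (hexp : ∀ l, L ≤ l → ∀ x ∈ V l, 1 ≤ ‖deriv f x‖) (n : ℕ) :
    f^[n] '' V (L + n) = V L ∧ InjOn f^[n] (V (L + n)) ∧
      ∀ x ∈ V (L + n), 1 ≤ ‖deriv f^[n] x‖ := by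
  induction n with
  | zero => simp
  | succ n ih =>
    obtain ⟨h1, h2, h3⟩ := ih
    have hm : ∀ x ∈ V (L + (n + 1)), f x ∈ V (L + n) := fun x hx => by
      rw [← hmap (L + n)]
      exact ⟨x, hx, rfl⟩
    rw [Function.iterate_succ]
    refine ⟨?_, ?_, ?_⟩
    · rw [image_comp, ← add_assoc, hmap, h1]
    · exact h2.comp (hinj _ (by omega)) hm
    · intro x hx
      rw [deriv_comp _ (hf.iterate n _) (hf x), norm_mul]
      exact one_le_mul_of_one_le_of_one_le (h3 _ (hm x hx)) (hexp _ (by omega) x hx)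

/-! ### The admissible system -/

lemma AdmissibleSystem.shrink (S : AdmissibleSystem) (i : Fin 3) {N : Set ℂ}
    (hN : N ∈ nhds (S.r i)) : ∀ᶠ l in Filter.atTop, S.V i l ⊆ N := by
  obtain ⟨R, hR, hsub⟩ := Metric.mem_nhds_iff.1 hN
  have h1 : Filter.Tendsto (fun l : ℕ => S.a₁ * S.a₂ ^ l) Filter.atTop (nhds (S.a₁ * 0)) :=
    (tendsto_pow_atTop_nhds_zero_of_lt_one S.ha₂.le S.ha₂').const_mul _
  rw [mul_zero] at h1
  filter_upwards [h1.eventually (gt_mem_nhds hR)] with l hl x hx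
  apply hsub
  have h2 := (Metric.edist_le_ediam_of_mem hx (S.hVmem i l)).trans (S.hVdiam i l)
  rw [edist_dist, ENNReal.ofReal_le_ofReal_iff (mul_nonneg S.ha₁.le (pow_nonneg S.ha₂.le l))] at h2
  exact mem_ball.2 (h2.trans_lt hl)

lemma AdmissibleSystem.diff_iter (S : AdmissibleSystem) (n : ℕ) :
    Differentiable ℂ (fun w => S.q.eval w)^[n] :=
  Differentiable.iterate S.q.differentiable n

lemma AdmissibleSystem.key (S : AdmissibleSystem) :
    ∃ (L₀ : ℕ) (M : ℝ), S.l₀ ≤ L₀ ∧ 0 ≤ M ∧ ∀ l, L₀ ≤ l → ∀ i, ∃ C ⊆ S.V i l, IsCompact C ∧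
      (∀ w ∈ S.V i l, ∀ j, (fun w => S.q.eval w)^[S.m₁ * l] w ∈ S.V j l → w ∈ C) ∧
      ∀ (σ : ℂ → ℂ) (δ : ℝ), 0 ≤ δ → DifferentiableOn ℂ σ (S.V i l) →
        (∀ w ∈ S.V i l, ‖deriv σ w‖ ≤ δ) → ∀ x ∈ C, ∀ y ∈ C, ‖σ y - σ x‖ ≤ M * δ := by
  classical
  set p : ℂ → ℂ := (fun w => S.q.eval w)^[S.m₁] with hp
  have hpd : Differentiable ℂ p := S.diff_iter _
  have hpit : ∀ l, (fun w => S.q.eval w)^[S.m₁ * l] = p^[l] := fun l => Function.iterate_mul _ _ _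
  have hpit' : ∀ l, (fun w => S.q.eval w)^[l * S.m₁] = p^[l] := fun l => by
    rw [mul_comm, hpit]
  choose R hR hinj hexp using fun i => repelling_nhd hpd (S.hrep i)
  obtain ⟨L, hL⟩ := Filter.eventually_atTop.1 (Filter.eventually_all.2
    (fun i => S.shrink i (ball_mem_nhds (S.r i) (hR i))))
  -- enlarge
  obtain ⟨L, hL, hLl₀⟩ : ∃ L : ℕ, (∀ b, L ≤ b → ∀ i, S.V i b ⊆ ball (S.r i) (R i)) ∧ S.l₀ ≤ L :=
    ⟨max L S.l₀, fun b hb => hL b (le_trans (le_max_left _ _) hb), le_max_right _ _⟩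
  have hprops := fun i n => iterate_props hpd (S.V i) L (S.hVmap i)
    (fun l hl => (hinj i).mono (hL l hl i)) (fun l hl x hx => hexp i x (hL l hl i hx)) n
  have hbij := S.hVbij L hLl₀
  simp only [hpit'] at hbij
  have hder : ∀ i, ∀ w ∈ S.V i L, deriv p^[L] w ≠ 0 := by
    intro i w hw h0
    have h1 := S.hVexp L hLl₀ i w hw
    have h2 := S.hVexp1 L hLl₀ i
    rw [hpit', h0, norm_zero] at h1
    linarith
  have ht : ∀ i j, ∃ t ∈ S.V i L, p^[L] t = S.r j := by
    intro i j
    obtain ⟨t, ht, h⟩ := (hbij i j).surjOn (S.hVmem j L)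
    exact ⟨t, ht.1, h⟩
  choose t htV htr using ht
  have hR' : ∀ i j, ∃ R' > 0, closedBall (t i j) R' ⊆ S.V i L := fun i j =>
    Metric.nhds_basis_closedBall.mem_iff.1 ((S.hVopen i L).mem_nhds (htV i j))
  choose R' hR'0 hR'V using hR'
  have hev : ∀ i j, ∀ᶠ l in Filter.atTop,
      S.V j l ⊆ p^[L] '' ball (t i j) (R' i j) ∩ S.V j L := by
    intro i j
    apply S.shrink j
    refine Filter.inter_mem ?_ ((S.hVopen j L).mem_nhds (S.hVmem j L))
    have h1 : HasStrictDerivAt p^[L] (deriv p^[L] (t i j)) (t i j) :=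
      ((hpd.iterate L).analyticAt _).hasStrictDerivAt
    have h2 := h1.map_nhds_eq (hder i _ (htV i j))
    rw [htr] at h2
    rw [← h2]
    exact Filter.image_mem_map (ball_mem_nhds _ (hR'0 i j))
  obtain ⟨L₁, hL₁⟩ := Filter.eventually_atTop.1
    (Filter.eventually_all.2 (fun i => Filter.eventually_all.2 (hev i)))
  set K : Fin 3 → Set ℂ := fun i => ⋃ j, closedBall (t i j) (R' i j) with hK
  have hKc : ∀ i, IsCompact (K i) := fun i => isCompact_iUnion fun j => isCompact_closedBall _ _
  have hKV : ∀ i, K i ⊆ S.V i L := fun i => iUnion_subset (hR'V i)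
  choose M hM0 hM using fun i =>
    osc_compact (S.hVopen i L) (S.hVconn i L).isPreconnected (hKc i) (hKV i)
  refine ⟨max L L₁, M 0 + M 1 + M 2, hLl₀.trans (le_max_left _ _),
    by have := hM0 0; have := hM0 1; have := hM0 2; positivity, ?_⟩
  intro l hl i
  have hMi : M i ≤ M 0 + M 1 + M 2 := by
    have := hM0 0; have := hM0 1; have := hM0 2
    fin_cases i <;> simp <;> linarith
  obtain ⟨n, rfl⟩ := Nat.exists_eq_add_of_le ((le_max_left _ _).trans hl)
  obtain ⟨him, hin, hex⟩ := hprops i n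
  set F : ℂ → ℂ := Function.invFunOn p^[n] (S.V i (L + n)) with hF
  have hFl : ∀ x ∈ S.V i (L + n), F (p^[n] x) = x := fun x hx => hin.leftInvOn_invFunOn hx
  have hFmem : ∀ y ∈ S.V i L, F y ∈ S.V i (L + n) := by
    intro y hy
    rw [← him] at hy
    exact Function.invFunOn_mem hy
  have hFr : ∀ y ∈ S.V i L, p^[n] (F y) = y := by
    intro y hy
    rw [← him] at hy
    exact Function.invFunOn_eq hy
  have hFd : ∀ y ∈ S.V i L, HasDerivAt F (deriv p^[n] (F y))⁻¹ y := by
    intro y hy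
    have hne : deriv p^[n] (F y) ≠ 0 := by
      intro h0
      have := hex _ (hFmem y hy)
      rw [h0, norm_zero] at this
      linarith
    have := hasDerivAt_inv_branch (hpd.iterate n) (S.hVopen i (L + n)) hFl (hFmem y hy) hne
    rwa [hFr y hy] at this
  refine ⟨F '' K i, ?_, ?_, ?_, ?_⟩
  · rintro _ ⟨y, hy, rfl⟩
    exact hFmem y (hKV i hy)
  · exact (hKc i).image_of_continuousOn
      (fun y hy => (hFd y (hKV i hy)).continuousAt.continuousWithinAt)
  · intro w hw j hj
    rw [hpit, Function.iterate_add_apply] at hj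
    obtain ⟨⟨x, hx, hxe⟩, hjL⟩ := hL₁ (L + n) ((le_max_right _ _).trans hl) i j hj
    have hwL : p^[n] w ∈ S.V i L := by
      rw [← him]
      exact ⟨w, hw, rfl⟩
    have hxK : x ∈ closedBall (t i j) (R' i j) := ball_subset_closedBall hx
    have hxV : x ∈ S.V i L := hR'V i j hxK
    have hxw : x = p^[n] w :=
      (hbij i j).injOn ⟨hxV, by rw [mem_preimage, hxe]; exact hjL⟩ ⟨hwL, hjL⟩ hxe
    refine ⟨x, mem_iUnion.2 ⟨j, hxK⟩, ?_⟩
    rw [hxw, hFl w hw]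
  · rintro σ δ hδ hσ hσd _ ⟨x, hx, rfl⟩ _ ⟨y, hy, rfl⟩
    have hcomp : ∀ y ∈ S.V i L,
        HasDerivAt (σ ∘ F) (deriv σ (F y) * (deriv p^[n] (F y))⁻¹) y := fun y hy =>
      HasDerivAt.comp y ((hσ _ (hFmem y hy)).differentiableAt
        ((S.hVopen i (L + n)).mem_nhds (hFmem y hy))).hasDerivAt (hFd y hy)
    have h1 := hM i (σ ∘ F) δ hδ
      (fun y hy => (hcomp y hy).differentiableAt.differentiableWithinAt) ?_ x hx y hy
    · exact h1.trans (by gcongr)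
    · intro y hy
      rw [(hcomp y hy).deriv, norm_mul, norm_inv]
      have h2 := hσd _ (hFmem y hy)
      have h3 := inv_le_one_of_one_le₀ (hex _ (hFmem y hy))
      calc _ ≤ δ * 1 := mul_le_mul h2 h3 (by positivity) hδ
        _ = δ := mul_one δ

/-! ### Triangle data -/

lemma tri_uniform (e : Fin 3 → ℂ) (ρ₀ : ℂ) (H : Fin 3 → Set ℂ) (hHo : ∀ j, IsOpen (H j))
    (hHh : ∀ j, ball (0:ℂ) (1/2) ⊆ H j) (hHb : ∀ j, H j ⊆ ball (0:ℂ) 1)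
    (hHu : ball (0:ℂ) 1 = H 0 ∪ H 1 ∪ H 2)
    (hHc : ∀ j, closure ((fun z => ρ₀ * z + e j) '' H j) ⊆ ball 0 1)
    (hHc' : ∀ j, closure ((fun z => ρ₀ * z + e j) '' ((3:ℂ)⁻¹ • H j)) ⊆ ball (0:ℂ) (1/3)) :
    ∃ η > 0, ∀ ρ : ℂ, ‖ρ‖ = ‖ρ₀‖ → ρ₀ ≠ 0 → ∃ H : Fin 3 → Set ℂ, (∀ j, IsOpen (H j)) ∧
      (∀ j, ball (0:ℂ) (1/2) ⊆ H j) ∧ (∀ j, H j ⊆ ball (0:ℂ) 1) ∧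
      (∀ j, ∀ z ∈ H j, ∃ k, ball (ρ * z + e j) η ⊆ H k) ∧
      (∀ j, ∀ z ∈ (3:ℂ)⁻¹ • H j, ∃ k, ball (ρ * z + e j) η ⊆ (3:ℂ)⁻¹ • H k) := by
  have h3 : (3:ℂ) ≠ 0 := by norm_num
  have hmem : ∀ (A : Set ℂ) (z : ℂ), z ∈ (3:ℂ)⁻¹ • A ↔ 3 * z ∈ A := fun A z => by
    rw [mem_inv_smul_set_iff₀ h3, smul_eq_mul]
  choose t ht htb using fun j => exists_lt_subset_ball isClosed_closure (hHc j)
  choose t' ht' htb' using fun j => exists_lt_subset_ball isClosed_closure (hHc' j)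
  obtain ⟨T, hT, hT1⟩ : ∃ T < 1, ∀ j, t j ≤ T ∧ 3 * t' j ≤ T := by
    have hev : ∀ᶠ T in nhdsWithin (1:ℝ) (Iio 1), ∀ j, t j ≤ T ∧ 3 * t' j ≤ T := by
      rw [Filter.eventually_all]
      intro j
      have h2 : 3 * t' j < 1 := by linarith [ht' j]
      exact nhdsWithin_le_nhds (((lt_mem_nhds (ht j)).and (lt_mem_nhds h2)).mono
        fun x hx => ⟨hx.1.le, hx.2.le⟩)
    obtain ⟨T, h1, h2⟩ := (hev.and self_mem_nhdsWithin).exists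
    exact ⟨T, h2, h1⟩
  have hcov : closedBall (0:ℂ) T ⊆ ⋃ k, H k := by
    intro x hx
    have : x ∈ ball (0:ℂ) 1 := closedBall_subset_ball hT hx
    rw [hHu] at this
    rcases this with (h | h) | h
    exacts [mem_iUnion.2 ⟨_, h⟩, mem_iUnion.2 ⟨_, h⟩, mem_iUnion.2 ⟨_, h⟩]
  obtain ⟨η, hη, hleb⟩ := lebesgue_number_lemma_of_metric (isCompact_closedBall (0:ℂ) T) hHo hcov
  refine ⟨η / 3, by positivity, fun ρ hρ hρ0 => ?_⟩
  set u : ℂ := ρ / ρ₀ with hu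
  have hun : ‖u‖ = 1 := by rw [hu, norm_div, hρ, div_self (norm_ne_zero_iff.2 hρ0)]
  have hρu : ∀ z, ρ * z = ρ₀ * (u * z) := fun z => by rw [hu]; field_simp
  have hpt : ∀ j z, u * z ∈ H j → ‖ρ * z + e j‖ ≤ T := by
    intro j z hz
    have := htb j (subset_closure ⟨_, hz, rfl⟩)
    rw [mem_ball_zero_iff] at this
    rw [hρu]
    exact this.le.trans (hT1 j).1
  have hpt' : ∀ j z, 3 * (u * z) ∈ H j → ‖3 * (ρ * z + e j)‖ ≤ T := by
    intro j z hz
    have := htb' j (subset_closure ⟨_, (hmem _ _).2 hz, rfl⟩)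
    rw [mem_ball_zero_iff] at this
    rw [hρu, norm_mul]
    have h := (hT1 j).2
    have e3 : ‖(3:ℂ)‖ = 3 := by simp
    rw [e3]
    linarith
  refine ⟨fun j => (fun z => u * z) ⁻¹' H j, fun j => (hHo j).preimage (by fun_prop), ?_, ?_, ?_, ?_⟩
  · intro j z hz
    apply hHh j
    rw [mem_ball_zero_iff] at hz ⊢
    rwa [norm_mul, hun, one_mul]
  · intro j z hz
    have := hHb j hz
    rw [mem_ball_zero_iff, norm_mul, hun, one_mul] at this
    rwa [mem_ball_zero_iff]
  · intro j z hz
    obtain ⟨k, hk⟩ := hleb (u * (ρ * z + e j))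
      (by rw [mem_closedBall_zero_iff, norm_mul, hun, one_mul]; exact hpt j z hz)
    refine ⟨k, fun y hy => hk ?_⟩
    rw [mem_ball, dist_eq_norm] at hy ⊢
    rw [← mul_sub, norm_mul, hun, one_mul]
    linarith
  · intro j z hz
    rw [hmem, mem_preimage] at hz
    obtain ⟨k, hk⟩ := hleb (u * (3 * (ρ * z + e j)))
      (by
        rw [mem_closedBall_zero_iff, norm_mul, hun, one_mul]
        exact hpt' j z (by convert hz using 1; ring))
    refine ⟨k, fun y hy => ?_⟩
    rw [hmem, mem_preimage]
    apply hk
    rw [mem_ball, dist_eq_norm] at hy ⊢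
    rw [← mul_sub, ← mul_sub, norm_mul, norm_mul, hun, one_mul]
    have e3 : ‖(3:ℂ)‖ = 3 := by simp
    rw [e3]
    linarith

lemma cover_uniform (e : Fin 3 → ℂ) (ρ₀ : ℂ) (hρ₀ : ρ₀ ≠ 0)
    (h : closure (ball (0:ℂ) 1) ⊆ ⋃ j : Fin 3, (fun z => ρ₀ * z + e j) '' ball 0 1) :
    ∃ η > 0, ∀ ρ : ℂ, ‖ρ‖ = ‖ρ₀‖ → ∀ z ∈ closedBall (0:ℂ) 1,
      ∃ j, ∃ y, ‖y‖ < 1 - η ∧ ρ * y + e j = z := by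
  have hpos : 0 < ‖ρ₀‖ := norm_pos_iff.2 hρ₀
  rw [closure_ball _ one_ne_zero] at h
  have hcov : closedBall (0:ℂ) 1 ⊆ ⋃ n : ℕ, {z | ∃ j, ‖z - e j‖ < ‖ρ₀‖ * (1 - 1 / ((n:ℝ) + 1))} := by
    intro z hz
    obtain ⟨j, y, hy, rfl⟩ := mem_iUnion.1 (h hz)
    rw [mem_ball_zero_iff] at hy
    obtain ⟨n, hn⟩ := exists_nat_one_div_lt (sub_pos.2 hy)
    refine mem_iUnion.2 ⟨n, j, ?_⟩
    simp only [add_sub_cancel_right, norm_mul]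
    gcongr
    linarith
  obtain ⟨n, hn⟩ := (isCompact_closedBall (0:ℂ) 1).elim_directed_cover _
    (fun n => by
      simp only [ofPred_exists]
      exact isOpen_iUnion fun j => isOpen_lt (by fun_prop) continuous_const) hcov
    (directed_of_isDirected_le (fun a b hab z => by
      rintro ⟨j, hj⟩
      refine ⟨j, hj.trans_le ?_⟩
      gcongr))
  refine ⟨1 / ((n:ℝ) + 1), by positivity, fun ρ hρ z hz => ?_⟩
  obtain ⟨j, hj⟩ := hn hz
  have hρ0 : ρ ≠ 0 := norm_pos_iff.1 (hρ ▸ hpos)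
  refine ⟨j, (z - e j) / ρ, ?_, by field_simp; ring⟩
  rw [norm_div, hρ, div_lt_iff₀ hpos, mul_comm]
  exact hj

/-! ### The blender property -/

lemma blender (V : Fin 3 → Set ℂ) (Q : ℂ → ℂ) (hQ : Differentiable ℂ Q)
    (hVo : ∀ i, IsOpen (V i)) (hVn : ∀ i, (V i).Nonempty)
    (hdQ : ∀ i, ∀ w ∈ V i, deriv Q w ≠ 0)
    (hbij : ∀ i j, BijOn Q (V i ∩ Q ⁻¹' V j) (V j))
    (h : ℂ × ℂ → ℂ) (hh : Differentiable ℂ h) (ρ : ℂ) (e : Fin 3 → ℂ) (δ M η : ℝ) (hδ : 0 < δ)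
    (hclose : ∀ j : Fin 3, ∀ x ∈ ball (0:ℂ) 2 ×ˢ V j, ‖h x - (ρ * x.1 + e j)‖ ≤ δ)
    (hcone : ContractsCone (fun x : ℂ × ℂ => (h x, Q x.2)) δ
      (closure (⋃ j : Fin 3, ball (0:ℂ) 1 ×ˢ V j)))
    (hosc : ∀ i, ∃ C ⊆ V i, IsCompact C ∧ (∀ w ∈ V i, ∀ j, Q w ∈ V j → w ∈ C) ∧
      ∀ (σ : ℂ → ℂ) (δ : ℝ), 0 ≤ δ → DifferentiableOn ℂ σ (V i) →
        (∀ w ∈ V i, ‖deriv σ w‖ ≤ δ) → ∀ x ∈ C, ∀ y ∈ C, ‖σ y - σ x‖ ≤ M * δ)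
    (hη : δ + ‖ρ‖ * (M * δ) < η) (G : Fin 3 → Set ℂ) (hGb : ∀ j, G j ⊆ ball (0:ℂ) 1)
    (hG : ∀ j, ∀ z ∈ G j, ∃ k, ball (ρ * z + e j) η ⊆ G k)
    (i : Fin 3) (σ : ℂ → ℂ) (hσ : DifferentiableOn ℂ σ (V i)) (hσG : ∀ w ∈ V i, σ w ∈ G i)
    (hσd : ∀ w ∈ V i, ‖deriv σ w‖ < δ) :
    ∃ w ∈ V i, ∀ n : ℕ, (fun x : ℂ × ℂ => (h x, Q x.2))^[n] (σ w, w) ∈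
      closure (⋃ j : Fin 3, G j ×ˢ V j) := by
  set g : ℂ × ℂ → ℂ × ℂ := fun x => (h x, Q x.2) with hg
  have hgd : Differentiable ℂ g := hh.prodMk (hQ.comp differentiable_snd)
  -- one step of the graph transform
  have step : ∀ i (σ : ℂ → ℂ), DifferentiableOn ℂ σ (V i) → (∀ w ∈ V i, σ w ∈ G i) →
      (∀ w ∈ V i, ‖deriv σ w‖ < δ) → ∃ k, ∃ τ : ℂ → ℂ, DifferentiableOn ℂ τ (V k) ∧
        (∀ w ∈ V k, τ w ∈ G k) ∧ (∀ w ∈ V k, ‖deriv τ w‖ < δ) ∧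
        ∀ w ∈ V k, ∃ v ∈ V i, g (σ v, v) = (τ w, w) := by
    intro i σ hσ hσG hσd
    obtain ⟨C, hCV, -, hC, hosc⟩ := hosc i
    replace hosc := hosc σ δ hδ.le hσ (fun w hw => (hσd w hw).le)
    obtain ⟨a, ha⟩ := hVn 0
    obtain ⟨w₀, ⟨hw₀, hw₀'⟩, -⟩ := (hbij i 0).surjOn ha
    have hw₀C : w₀ ∈ C := hC w₀ hw₀ 0 hw₀'
    obtain ⟨k, hk⟩ := hG i (σ w₀) (hσG w₀ hw₀)
    set U : Set ℂ := V i ∩ Q ⁻¹' V k with hU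
    have hUo : IsOpen U := (hVo i).inter ((hVo k).preimage hQ.continuous)
    set u : ℂ → ℂ := Function.invFunOn Q U with hudef
    have hul : ∀ x ∈ U, u (Q x) = x := fun x hx => (hbij i k).injOn.leftInvOn_invFunOn hx
    have huU : ∀ w ∈ V k, u w ∈ U := fun w hw =>
      Function.invFunOn_mem ((hbij i k).surjOn hw)
    have hur : ∀ w ∈ V k, Q (u w) = w := fun w hw =>
      Function.invFunOn_eq ((hbij i k).surjOn hw)
    have hud : ∀ w ∈ V k, HasDerivAt u (deriv Q (u w))⁻¹ w := by
      intro w hw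
      have := hasDerivAt_inv_branch hQ hUo hul (huU w hw) (hdQ i _ (huU w hw).1)
      rwa [hur w hw] at this
    have hσu : ∀ w ∈ V k, HasDerivAt (fun w => σ (u w))
        (deriv σ (u w) * (deriv Q (u w))⁻¹) w := fun w hw =>
      HasDerivAt.comp w ((hσ _ (huU w hw).1).differentiableAt
        ((hVo i).mem_nhds (huU w hw).1)).hasDerivAt (hud w hw)
    have hgu : ∀ w ∈ V k, HasDerivAt (fun w => g (σ (u w), u w))
        (fderiv ℂ g (σ (u w), u w) (deriv σ (u w) * (deriv Q (u w))⁻¹, (deriv Q (u w))⁻¹)) w :=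
      fun w hw => (hgd _).hasFDerivAt.comp_hasDerivAt w ((hσu w hw).prodMk (hud w hw))
    have hτd : ∀ w ∈ V k, HasDerivAt (fun w => h (σ (u w), u w))
        (fderiv ℂ g (σ (u w), u w)
          (deriv σ (u w) * (deriv Q (u w))⁻¹, (deriv Q (u w))⁻¹)).1 w :=
      fun w hw => (ContinuousLinearMap.fst ℂ ℂ ℂ).hasFDerivAt.comp_hasDerivAt w (hgu w hw)
    have hτs : ∀ w ∈ V k, (fderiv ℂ g (σ (u w), u w)
          (deriv σ (u w) * (deriv Q (u w))⁻¹, (deriv Q (u w))⁻¹)).2 = 1 := by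
      intro w hw
      have h1 : HasDerivAt (fun w => (g (σ (u w), u w)).2) _ w :=
        (ContinuousLinearMap.snd ℂ ℂ ℂ).hasFDerivAt.comp_hasDerivAt w (hgu w hw)
      have h2 : HasDerivAt (fun w => (g (σ (u w), u w)).2) 1 w :=
        (hasDerivAt_id w).congr_of_eventuallyEq
          (Filter.eventually_of_mem ((hVo k).mem_nhds hw) (fun x hx => hur x hx))
      exact h1.unique h2
    refine ⟨k, fun w => h (σ (u w), u w), fun w hw =>
      (hτd w hw).differentiableAt.differentiableWithinAt, ?_, ?_, ?_⟩
    · intro w hw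
      apply hk
      have hv := (huU w hw).1
      have hball := hGb i (hσG _ hv)
      have h1 := hclose i (σ (u w), u w) ⟨ball_subset_ball (by norm_num) hball, hv⟩
      have h2 := hosc w₀ hw₀C (u w) (hC _ hv k (by rw [hur w hw]; exact hw))
      rw [mem_ball, dist_eq_norm]
      have e1 : h (σ (u w), u w) - (ρ * σ w₀ + e i) =
        (h (σ (u w), u w) - (ρ * σ (u w) + e i)) + ρ * (σ (u w) - σ w₀) := by ring
      rw [e1]
      refine (norm_add_le _ _).trans_lt ?_
      rw [norm_mul]
      have h3 := mul_le_mul_of_nonneg_left h2 (norm_nonneg ρ)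
      simp only at h1
      linarith
    · intro w hw
      rw [(hτd w hw).deriv]
      obtain ⟨δ', hδ'0, hδ', hc⟩ := hcone
      have hv := (huU w hw).1
      have hq := hdQ i _ hv
      have h1 := hc (σ (u w), u w)
        (subset_closure (mem_iUnion.2 ⟨i, hGb i (hσG _ hv), hv⟩))
        (deriv σ (u w) * (deriv Q (u w))⁻¹, (deriv Q (u w))⁻¹) (by
          change ‖deriv σ (u w) * (deriv Q (u w))⁻¹‖ < δ * ‖(deriv Q (u w))⁻¹‖
          rw [norm_mul]
          have : 0 < ‖(deriv Q (u w))⁻¹‖ := norm_pos_iff.2 (inv_ne_zero hq)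
          exact mul_lt_mul_of_pos_right (hσd _ hv) this)
      change ‖_‖ < δ' * ‖_‖ at h1
      rw [hτs w hw, norm_one, mul_one] at h1
      exact h1.trans hδ'
    · intro w hw
      refine ⟨u w, (huU w hw).1, ?_⟩
      change (h (σ (u w), u w), Q (u w)) = _
      rw [hur w hw]
  -- finite orbits
  have fin : ∀ n : ℕ, ∀ i (σ : ℂ → ℂ), DifferentiableOn ℂ σ (V i) → (∀ w ∈ V i, σ w ∈ G i) →
      (∀ w ∈ V i, ‖deriv σ w‖ < δ) → ∃ w ∈ V i, ∀ m ≤ n,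
        g^[m] (σ w, w) ∈ ⋃ j : Fin 3, G j ×ˢ V j := by
    intro n
    induction n with
    | zero =>
      intro i σ _ hσG _
      obtain ⟨w, hw⟩ := hVn i
      refine ⟨w, hw, fun m hm => ?_⟩
      obtain rfl : m = 0 := by omega
      exact mem_iUnion.2 ⟨i, hσG w hw, hw⟩
    | succ n ih =>
      intro i σ hσ hσG hσd
      obtain ⟨k, τ, h1, h2, h3, h4⟩ := step i σ hσ hσG hσd
      obtain ⟨w, hw, hwn⟩ := ih k τ h1 h2 h3
      obtain ⟨v, hv, hgv⟩ := h4 w hw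
      refine ⟨v, hv, fun m hm => ?_⟩
      cases m with
      | zero => exact mem_iUnion.2 ⟨i, hσG v hv, hv⟩
      | succ m =>
        rw [Function.iterate_succ_apply, hgv]
        exact hwn m (by omega)
  obtain ⟨C, hCV, hCc, hC, -⟩ := hosc i
  set X : ℕ → Set ℂ := fun n => {w ∈ C | ∀ m ≤ n,
    g^[m] (σ w, w) ∈ closure (⋃ j : Fin 3, G j ×ˢ V j)} with hX
  have hXcl : ∀ n, IsClosed (X n) := by
    intro n
    have : X n = C ∩ ⋂ m, ⋂ (_ : m ≤ n), (C ∩ (fun w => g^[m] (σ w, w)) ⁻¹'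
        closure (⋃ j : Fin 3, G j ×ˢ V j)) := by
      ext w
      simp only [hX, mem_ofPred_eq, mem_inter_iff, mem_iInter, mem_preimage]
      exact ⟨fun h => ⟨h.1, fun m hm => ⟨h.1, h.2 m hm⟩⟩, fun h => ⟨h.1, fun m hm => (h.2 m hm).2⟩⟩
    rw [this]
    refine hCc.isClosed.inter (isClosed_iInter fun m => isClosed_iInter fun _ => ?_)
    refine ContinuousOn.preimage_isClosed_of_isClosed ?_ hCc.isClosed isClosed_closure
    exact (hgd.continuous.iterate m).comp_continuousOn
      ((hσ.continuousOn.mono hCV).prodMk continuousOn_id)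
  obtain ⟨w, hw⟩ := IsCompact.nonempty_iInter_of_sequence_nonempty_isCompact_isClosed X
    (fun n w hw => ⟨hw.1, fun m hm => hw.2 m (by omega)⟩)
    (fun n => by
      obtain ⟨w, hw, hwn⟩ := fin (n + 1) i σ hσ hσG hσd
      obtain ⟨j, -, hj⟩ := mem_iUnion.1 (hwn 1 (by omega))
      exact ⟨w, hC w hw j hj, fun m hm => subset_closure (hwn m (by omega))⟩)
    (hCc.of_isClosed_subset (hXcl 0) (fun w hw => hw.1)) hXcl
  rw [mem_iInter] at hw
  exact ⟨w, hCV (hw 0).1, fun n => (hw n).2 n le_rfl⟩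

/-! ### Estimates in the fibers -/

lemma deriv_est {f : ℂ → ℂ} (hf : Differentiable ℂ f) {ρ e : ℂ} {δ α : ℝ}
    (hcl : ∀ z ∈ ball (0:ℂ) 2, ‖f z - (ρ * z + e)‖ ≤ δ) (hρ : ‖ρ‖ = 1 + α) (hδ : 2 * δ < α)
    {z : ℂ} (hz : z ∈ closedBall (0:ℂ) 1) : 1 < ‖deriv f z‖ := by
  have hd : Differentiable ℂ (fun z => f z - (ρ * z + e)) := by fun_prop
  have h1 := Complex.norm_deriv_le_of_forall_mem_sphere_norm_le (c := z) (R := 1/2) (C := δ)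
    (by norm_num) hd.diffContOnCl (fun y hy => hcl y (by
      rw [mem_ball_zero_iff]
      rw [mem_closedBall_zero_iff] at hz
      rw [mem_sphere, dist_eq_norm] at hy
      have := norm_add_le (y - z) z
      rw [sub_add_cancel] at this
      linarith))
  have h2 : deriv (fun z => f z - (ρ * z + e)) z = deriv f z - ρ := by
    have h3 : HasDerivAt (fun z => f z - (ρ * z + e)) (deriv f z - (ρ * 1)) z :=
      (hf z).hasDerivAt.sub (((hasDerivAt_id z).const_mul ρ).add_const e)
    rw [h3.deriv, mul_one]
  rw [h2] at h1
  have h3 := norm_sub_norm_le ρ (deriv f z)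
  rw [norm_sub_rev] at h3
  have : δ / (1/2) = 2 * δ := by ring
  linarith

lemma surj_est {f : ℂ → ℂ} (hf : Differentiable ℂ f) {ρ e : ℂ} {δ α η : ℝ}
    (hcl : ∀ z ∈ ball (0:ℂ) 2, ‖f z - (ρ * z + e)‖ ≤ δ) (hρ : ‖ρ‖ = 1 + α) (hδ : 2 * δ < α)
    (hα : 0 < α) (hη : 0 < η) (hδη : 4 * δ < η) {y : ℂ} (hy : ‖y‖ < 1 - η) :
    ∃ y' ∈ ball (0:ℂ) 1, f y' = ρ * y + e := by
  have hyb : y ∈ ball (0:ℂ) 2 := by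
    rw [mem_ball_zero_iff]; linarith
  have hd := deriv_est hf hcl hρ hδ (z := y) (by rw [mem_closedBall_zero_iff]; linarith)
  have hy0 := hcl y hyb
  have hnear : ∀ z, ‖z - y‖ ≤ η → ‖z‖ < 1 := fun z hz => by
    have := norm_add_le (z - y) y
    rw [sub_add_cancel] at this
    linarith
  have h1 : ball (f y) ((η - 2 * δ) / 2) ⊆ f '' closedBall y η := by
    refine DiffContOnCl.ball_subset_image_closedBall hf.diffContOnCl hη (fun z hz => ?_) ?_
    · rw [mem_sphere, dist_eq_norm] at hz
      have hz0 := hcl z (by rw [mem_ball_zero_iff]; linarith [hnear z hz.le])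
      have e1 : ρ * (z - y) = (f z - f y) - (f z - (ρ * z + e)) + (f y - (ρ * y + e)) := by ring
      have h2 := norm_add_le ((f z - f y) - (f z - (ρ * z + e))) (f y - (ρ * y + e))
      have h3 := norm_sub_le (f z - f y) (f z - (ρ * z + e))
      rw [← e1, norm_mul, hz, hρ] at h2
      nlinarith
    · have hne : deriv f y ≠ 0 := by
        intro h0
        rw [h0, norm_zero] at hd
        linarith
      have := (hf y).hasDerivAt.eventually_ne (c := f y) hne
      exact this.frequently.filter_mono nhdsWithin_le_nhds
  obtain ⟨y', hy', h2⟩ := h1 (show ρ * y + e ∈ _ by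
    rw [mem_ball, dist_eq_norm, norm_sub_rev]
    linarith)
  rw [mem_closedBall, dist_eq_norm] at hy'
  exact ⟨y', by rw [mem_ball_zero_iff]; exact hnear y' hy', h2⟩

lemma mvpoly_diff (P : MvPolynomial (Fin 2) ℂ) :
    Differentiable ℂ (fun x : ℂ × ℂ => MvPolynomial.eval ![x.1, x.2] P) := by
  induction P using MvPolynomial.induction_on with
  | C a => simp
  | add p q hp hq => simp only [map_add]; exact hp.add hq
  | mul_X p i hp =>
    simp only [map_mul, MvPolynomial.eval_X]
    refine hp.mul ?_
    fin_cases i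
    · exact differentiable_fst
    · exact differentiable_snd

lemma mvpoly_diff_fst (P : MvPolynomial (Fin 2) ℂ) (w : ℂ) :
    Differentiable ℂ (fun z : ℂ => MvPolynomial.eval ![z, w] P) := by
  have h1 : Differentiable ℂ (fun z : ℂ => (z, w)) :=
    differentiable_id.prodMk (differentiable_const w)
  have h2 := Differentiable.comp (mvpoly_diff P) h1
  exact h2

lemma mvpoly_cont_snd (P : MvPolynomial (Fin 2) ℂ) (z : ℂ) :
    Continuous (fun w : ℂ => MvPolynomial.eval ![z, w] P) := by
  have h1 : Continuous (fun w : ℂ => (z, w)) := by fun_prop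
  have h2 := Continuous.comp (mvpoly_diff P).continuous h1
  exact h2

/-- Proposition 3.6: given an admissible system and triangle data `(c, ε₀, α₀)` as in Lemma 3.2,
there are `L₀ ≥ l₀` and `δ₀ > 0` such that for `l ≥ L₀`, `|ρ| = 1 + α₀`, any polynomial skew
product `g = (h, q^{m₁ l})` with `h` δ₀-close to `ρ z + ε₀ cⱼ` on `2𝔻 × Vⱼ^l` and contracting
the cone field `C_{δ₀}` possesses two nested blenders of repelling type: there are open sets
`Hⱼ` with `(1/2)𝔻 ⊆ Hⱼ ⊆ 𝔻` such that the covering and expansion properties (a), (b) hold and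
the sets `Λ_g`, `Λ'_g` intersect every vertical graph tangent to `C_{δ₀}` as in (c), (d). -/
theorem stmt_5 (S : AdmissibleSystem) (c : Fin 3 → ℂ)
    (hc : ¬ Collinear ℝ ({c 0, c 1, c 2} : Set ℂ)) (hcsum : c 0 + c 1 + c 2 = 0)
    (ε₀ α₀ : ℝ) (hε₀ : 0 < ε₀) (hα₀ : 0 < α₀)
    (htri : ∀ ρ : ℂ, 1 - α₀ ≤ ‖ρ‖ → ‖ρ‖ ≤ 1 + α₀ →
      (closure (ball (0:ℂ) 1) ⊆ ⋃ j : Fin 3, (fun z => ρ * z + (ε₀ : ℂ) * c j) '' ball 0 1) ∧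
      ∃ H : Fin 3 → Set ℂ, (∀ j, IsOpen (H j)) ∧ (∀ j, ball (0:ℂ) (1/2) ⊆ H j) ∧
        (∀ j, H j ⊆ ball (0:ℂ) 1) ∧ ball (0:ℂ) 1 = H 0 ∪ H 1 ∪ H 2 ∧
        (∀ j, closure ((fun z => ρ * z + (ε₀ : ℂ) * c j) '' H j) ⊆ ball 0 1) ∧
        (∀ j, closure ((fun z => ρ * z + (ε₀ : ℂ) * c j) '' ((3:ℂ)⁻¹ • H j)) ⊆
          ball (0:ℂ) (1/3))) :
    ∃ (L₀ : ℕ) (δ₀ : ℝ), S.l₀ ≤ L₀ ∧ 0 < δ₀ ∧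
      ∀ l, L₀ ≤ l → ∀ ρ : ℂ, ‖ρ‖ = 1 + α₀ →
        ∀ P : MvPolynomial (Fin 2) ℂ,
          (∀ j : Fin 3, ∀ x ∈ ball (0:ℂ) 2 ×ˢ S.V j l,
            ‖MvPolynomial.eval ![x.1, x.2] P - (ρ * x.1 + (ε₀ : ℂ) * c j)‖ ≤ δ₀) →
          ContractsCone
            (fun x : ℂ × ℂ =>
              (MvPolynomial.eval ![x.1, x.2] P, (fun w => S.q.eval w)^[S.m₁ * l] x.2))
            δ₀ (closure (⋃ j : Fin 3, ball (0:ℂ) 1 ×ˢ S.V j l)) →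
          ∃ H : Fin 3 → Set ℂ, (∀ j, IsOpen (H j)) ∧ (∀ j, ball (0:ℂ) (1/2) ⊆ H j) ∧
            (∀ j, H j ⊆ ball (0:ℂ) 1) ∧
            (closure (⋃ j : Fin 3, ball (0:ℂ) 1 ×ˢ S.V j l) ⊆
              (fun x : ℂ × ℂ =>
                  (MvPolynomial.eval ![x.1, x.2] P, (fun w => S.q.eval w)^[S.m₁ * l] x.2)) ''
                (⋃ j : Fin 3, ball (0:ℂ) 1 ×ˢ S.V j l)) ∧
            (∀ j : Fin 3, ∀ x ∈ closure (ball (0:ℂ) 1 ×ˢ S.V j l),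
              1 < ‖deriv (fun z => MvPolynomial.eval ![z, x.2] P) x.1‖) ∧
            (∀ i : Fin 3, ∀ σ : ℂ → ℂ, DifferentiableOn ℂ σ (S.V i l) →
              (∀ w ∈ S.V i l, σ w ∈ H i) → (∀ w ∈ S.V i l, ‖deriv σ w‖ < δ₀) →
              ∃ w ∈ S.V i l, ∀ n : ℕ,
                (fun x : ℂ × ℂ =>
                    (MvPolynomial.eval ![x.1, x.2] P,
                      (fun w => S.q.eval w)^[S.m₁ * l] x.2))^[n] (σ w, w) ∈
                  closure (⋃ j : Fin 3, H j ×ˢ S.V j l)) ∧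
            (∀ i : Fin 3, ∀ σ : ℂ → ℂ, DifferentiableOn ℂ σ (S.V i l) →
              (∀ w ∈ S.V i l, σ w ∈ (3:ℂ)⁻¹ • H i) → (∀ w ∈ S.V i l, ‖deriv σ w‖ < δ₀) →
              ∃ w ∈ S.V i l, ∀ n : ℕ,
                (fun x : ℂ × ℂ =>
                    (MvPolynomial.eval ![x.1, x.2] P,
                      (fun w => S.q.eval w)^[S.m₁ * l] x.2))^[n] (σ w, w) ∈
                  closure (⋃ j : Fin 3, ((3:ℂ)⁻¹ • H j) ×ˢ S.V j l)) := by
  classical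
  set e : Fin 3 → ℂ := fun j => (ε₀ : ℂ) * c j with he
  set ρ₀ : ℂ := ((1 + α₀ : ℝ) : ℂ) with hρ₀
  have hρ₀n : ‖ρ₀‖ = 1 + α₀ := by
    rw [hρ₀, Complex.norm_real, Real.norm_of_nonneg (by linarith)]
  have hρ₀0 : ρ₀ ≠ 0 := by
    rw [← norm_pos_iff, hρ₀n]; linarith
  obtain ⟨hcov, H₀, g1, g2, g3, g4, g5, g6⟩ := htri ρ₀ (by rw [hρ₀n]; linarith) hρ₀n.le
  obtain ⟨η₁, hη₁, hcov'⟩ := cover_uniform e ρ₀ hρ₀0 hcov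
  obtain ⟨η₂, hη₂, hH⟩ := tri_uniform e ρ₀ H₀ g1 g2 g3 g4 g5 g6
  obtain ⟨L₀, M, hL₀, hM, hkey⟩ := S.key
  obtain ⟨δ₀, hδ₀, hδ1, hδ2, hδ3⟩ : ∃ δ₀ : ℝ, 0 < δ₀ ∧ 2 * δ₀ < α₀ ∧ 4 * δ₀ < η₁ ∧
      δ₀ + (1 + α₀) * (M * δ₀) < η₂ := by
    have k1 : Filter.Tendsto (fun d : ℝ => 2 * d) (nhdsWithin 0 (Ioi 0)) (nhds (2 * 0)) :=
      Filter.Tendsto.mono_left (Continuous.tendsto (by fun_prop) 0) nhdsWithin_le_nhds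
    have k2 : Filter.Tendsto (fun d : ℝ => 4 * d) (nhdsWithin 0 (Ioi 0)) (nhds (4 * 0)) :=
      Filter.Tendsto.mono_left (Continuous.tendsto (by fun_prop) 0) nhdsWithin_le_nhds
    have k3 : Filter.Tendsto (fun d : ℝ => d + (1 + α₀) * (M * d)) (nhdsWithin 0 (Ioi 0))
        (nhds (0 + (1 + α₀) * (M * 0))) :=
      Filter.Tendsto.mono_left
        (Continuous.tendsto (f := fun d : ℝ => d + (1 + α₀) * (M * d)) (by fun_prop) 0)
        nhdsWithin_le_nhds
    obtain ⟨d, ⟨⟨h1, h2⟩, h3⟩, h4⟩ := (((k1.eventually_lt_const (u := α₀) (by simpa)).and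
      (k2.eventually_lt_const (u := η₁) (by simpa))).and
      (k3.eventually_lt_const (u := η₂) (by simpa))).and self_mem_nhdsWithin |>.exists
    exact ⟨d, h4, h1, h2, h3⟩
  refine ⟨L₀, δ₀, hL₀, hδ₀, ?_⟩
  intro l hl ρ hρ P hclose hcone
  obtain ⟨H, f1, f2, f3, f4, f5⟩ := hH ρ (by rw [hρ, hρ₀n]) hρ₀0
  have hll : S.l₀ ≤ l := hL₀.trans hl
  have hPd := mvpoly_diff P
  have hfd : ∀ w, Differentiable ℂ (fun z : ℂ => MvPolynomial.eval ![z, w] P) :=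
    mvpoly_diff_fst P
  have hcl' : ∀ j, ∀ w ∈ closure (S.V j l), ∀ z ∈ ball (0:ℂ) 2,
      ‖MvPolynomial.eval ![z, w] P - (ρ * z + e j)‖ ≤ δ₀ := by
    intro j w hw z hz
    have hcont : Continuous (fun w : ℂ => ‖MvPolynomial.eval ![z, w] P - (ρ * z + e j)‖) :=
      ((mvpoly_cont_snd P z).sub continuous_const).norm
    exact closure_minimal (fun v hv => hclose j (z, v) ⟨hz, hv⟩)
      (isClosed_le hcont continuous_const) hw
  set Q : ℂ → ℂ := (fun w => S.q.eval w)^[S.m₁ * l] with hQ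
  have hQ' : (fun w => S.q.eval w)^[l * S.m₁] = Q := by rw [mul_comm]
  have hdQ : ∀ i, ∀ w ∈ S.V i l, deriv Q w ≠ 0 := by
    intro i w hw h0
    have h1 := S.hVexp l hll i w hw
    have h2 := S.hVexp1 l hll i
    rw [hQ', h0, norm_zero] at h1
    linarith
  have hbij := S.hVbij l hll
  have hcover := S.hVcover l hll
  rw [hQ'] at hbij hcover
  have hη : δ₀ + ‖ρ‖ * (M * δ₀) < η₂ := by rw [hρ]; exact hδ3
  have hb := blender (fun i => S.V i l) Q (S.diff_iter _) (fun i => S.hVopen i l)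
    (fun i => (S.hVconn i l).nonempty) hdQ hbij _ hPd ρ e δ₀ M η₂ hδ₀ hclose hcone (hkey l hl) hη
  refine ⟨H, f1, f2, f3, ?_, ?_, ?_, ?_⟩
  · intro x hx
    have hx' : x ∈ closedBall (0:ℂ) 1 ×ˢ closure (S.V 0 l ∪ S.V 1 l ∪ S.V 2 l) := by
      refine closure_minimal ?_ (isClosed_closedBall.prod isClosed_closure) hx
      refine iUnion_subset fun j => prod_mono ball_subset_closedBall ?_
      refine Subset.trans ?_ subset_closure
      intro w hw
      fin_cases j
      exacts [Or.inl (Or.inl hw), Or.inl (Or.inr hw), Or.inr hw]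
    obtain ⟨j, y, hy, hyx⟩ := hcov' ρ (by rw [hρ, hρ₀n]) x.1 hx'.1
    obtain ⟨v, hv, hvx⟩ := hcover j hx'.2
    obtain ⟨y', hy', hfy⟩ := surj_est (hfd v) (hcl' j v (subset_closure hv)) hρ hδ1 hα₀ hη₁ hδ2 hy
    refine ⟨(y', v), mem_iUnion.2 ⟨j, hy', hv⟩, ?_⟩
    exact Prod.ext (hfy.trans hyx) hvx
  · intro j x hx
    rw [closure_prod_eq, closure_ball _ one_ne_zero] at hx
    exact deriv_est (hfd x.2) (hcl' j x.2 hx.2) hρ hδ1 hx.1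
  · exact hb H f3 f4
  · refine hb (fun j => (3:ℂ)⁻¹ • H j) (fun j z hz => ?_) f5
    rw [mem_inv_smul_set_iff₀ (by norm_num)] at hz
    have := f3 j hz
    rw [mem_ball_zero_iff, smul_eq_mul, norm_mul] at this
    rw [mem_ball_zero_iff]
    have e3 : ‖(3:ℂ)‖ = 3 := by simp
    rw [e3] at this
    linarith [norm_nonneg z]
end

section
/- Let p, q be polynomials with complex coefficients, m₀ ≥ 1 with p^{m₀}(0) = 0, and set ρ := (p^{m₀})'(0). Let t₀ ≥ 1, m₁ := m₀·t₀, and for 0 ≤ i ≤ m₁−1 set bᵢ := (p^{m₁−i−1})'(p^{i+1}(0)). Fix ε ∈ ℂ, and for s ∈ ℂ∖{0} define f_s(z,w) := (p(z) + sεw, q(w)), φ_s(z,w) := (sz, w) and g_s := φ_s⁻¹ ∘ f_s ∘ φ_s. Then for every l ≥ 1 there exists a polynomial E_l in three variables with complex coefficients (depending on p, q, ε, m₁, l but not on s) such that for all s ∈ ℂ∖{0} and all (z,w) ∈ ℂ²: g_s^{m₁·l}(z,w) = ( ρ^{t₀·l}·z + ε·Σ_{i=0}^{m₁−1} bᵢ·Σ_{k=0}^{l−1}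 ρ^{t₀·k}·q^{i+(l−1−k)m₁}(w) + s·E_l(s,z,w), q^{m₁·l}(w) ). -/
theorem aux_deriv (p : Polynomial ℂ) (n : ℕ) :
    Differentiable ℂ ((fun z => p.eval z)^[n]) :=
  Differentiable.iterate p.differentiable n

theorem aux_add (p : Polynomial ℂ) (a b : ℕ) (x : ℂ) :
    deriv ((fun z => p.eval z)^[a + b]) x =
      deriv ((fun z => p.eval z)^[a]) ((fun z => p.eval z)^[b] x) *
        deriv ((fun z => p.eval z)^[b]) x := by
  rw [Function.iterate_add]
  exact deriv_comp x (aux_deriv p a _) (aux_deriv p b _)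

theorem aux_one (p : Polynomial ℂ) (x : ℂ) :
    deriv ((fun z => p.eval z)^[1]) x = p.derivative.eval x := by
  rw [Function.iterate_one]
  exact p.deriv

theorem aux_per (p : Polynomial ℂ) (m : ℕ) (h : (fun z => p.eval z)^[m] 0 = 0) (k : ℕ) :
    (fun z => p.eval z)^[m * k] 0 = 0 := by
  rw [Function.iterate_mul]
  exact Function.iterate_fixed h k

theorem aux_pow (p : Polynomial ℂ) (m : ℕ) (h : (fun z => p.eval z)^[m] 0 = 0) (k : ℕ) :
    deriv ((fun z => p.eval z)^[m * k]) 0 = deriv ((fun z => p.eval z)^[m]) 0 ^ k := by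
  induction k with
  | zero => simp
  | succ k ih => rw [Nat.mul_succ, aux_add, h, ih, pow_succ]

theorem aux_sum (F : ℕ → ℂ) (m l : ℕ) :
    ∑ j ∈ Finset.range (m * l), F j =
      ∑ i ∈ Finset.range m, ∑ k ∈ Finset.range l, F (i + k * m) := by
  induction l with
  | zero => simp
  | succ l ih =>
    rw [Nat.mul_succ, Finset.sum_range_add, ih, ← Finset.sum_add_distrib]
    refine Finset.sum_congr rfl fun i _ => ?_
    rw [Finset.sum_range_succ]
    congr 2
    ring

theorem aux_Q (q : Polynomial ℂ) (n : ℕ) :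
    ∃ Q : MvPolynomial (Fin 3) ℂ, ∀ s z w : ℂ,
      MvPolynomial.eval ![s, z, w] Q = (fun w => q.eval w)^[n] w := by
  induction n with
  | zero => exact ⟨MvPolynomial.X 2, fun s z w => by simp⟩
  | succ n ih =>
    obtain ⟨Q, hQ⟩ := ih
    refine ⟨(q.map MvPolynomial.C).eval Q, fun s z w => ?_⟩
    rw [Function.iterate_succ_apply', ← hQ s z w, ← Polynomial.eval₂_at_apply,
      Polynomial.eval₂_map]
    have : (MvPolynomial.eval ![s, z, w]).comp MvPolynomial.C = RingHom.id ℂ := by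
      ext x; simp
    rw [this]; rfl

theorem aux_taylor (p : Polynomial ℂ) (c : ℂ) (U : MvPolynomial (Fin 3) ℂ) :
    ∃ R : MvPolynomial (Fin 3) ℂ, ∀ s z w : ℂ,
      p.eval (c + s * MvPolynomial.eval ![s, z, w] U) =
        p.eval c + p.derivative.eval c * (s * MvPolynomial.eval ![s, z, w] U) +
          s * s * MvPolynomial.eval ![s, z, w] R := by
  obtain ⟨k, hk⟩ := Polynomial.binomExpansion (p.map MvPolynomial.C)
    (MvPolynomial.C c) (MvPolynomial.X 0 * U)
  refine ⟨k * U ^ 2, fun s z w => ?_⟩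
  have hc : (MvPolynomial.eval ![s, z, w]).comp MvPolynomial.C = RingHom.id ℂ := by
    ext x; simp
  have key : ∀ (r : Polynomial ℂ) (V : MvPolynomial (Fin 3) ℂ),
      MvPolynomial.eval ![s, z, w] ((r.map MvPolynomial.C).eval V) =
        r.eval (MvPolynomial.eval ![s, z, w] V) := by
    intro r V
    rw [← Polynomial.eval₂_at_apply, Polynomial.eval₂_map, hc]; rfl
  have h := congrArg (MvPolynomial.eval ![s, z, w]) hk
  rw [Polynomial.derivative_map] at h
  simp only [map_add, map_mul, map_pow, key, MvPolynomial.eval_C, MvPolynomial.eval_X] at h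
  simp only [Matrix.cons_val_zero] at h
  rw [h]
  simp only [map_mul, map_pow]
  ring

/-- The first-order coefficient of the iterate. -/
noncomputable def auxA (p q : Polynomial ℂ) (ε : ℂ) (n : ℕ) (z w : ℂ) : ℂ :=
  deriv ((fun z => p.eval z)^[n]) 0 * z + ε * ∑ i ∈ Finset.range n,
    deriv ((fun z => p.eval z)^[n - i - 1]) ((fun z => p.eval z)^[i + 1] 0) *
      (fun w => q.eval w)^[i] w

theorem auxA_succ (p q : Polynomial ℂ) (ε : ℂ) (n : ℕ) (z w : ℂ) :
    auxA p q ε (n + 1) z w =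
      p.derivative.eval ((fun z => p.eval z)^[n] 0) * auxA p q ε n z w +
        ε * (fun w => q.eval w)^[n] w := by
  unfold auxA
  have h1 : ∀ i ∈ Finset.range n,
      deriv ((fun z => p.eval z)^[n + 1 - i - 1]) ((fun z => p.eval z)^[i + 1] 0) *
        (fun w => q.eval w)^[i] w =
      p.derivative.eval ((fun z => p.eval z)^[n] 0) *
       (deriv ((fun z => p.eval z)^[n - i - 1]) ((fun z => p.eval z)^[i + 1] 0) *
        (fun w => q.eval w)^[i] w) := by
    intro i hi
    have hi := Finset.mem_range.1 hi
    have e : n + 1 - i - 1 = 1 + (n - i - 1) := by omega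
    rw [e, aux_add, aux_one, ← Function.iterate_add_apply]
    have e2 : n - i - 1 + (i + 1) = n := by omega
    rw [e2, mul_assoc]
  rw [Finset.sum_range_succ, Finset.sum_congr rfl h1, ← Finset.mul_sum, Nat.add_comm n 1,
    aux_add, aux_one]
  have e : 1 + n - n - 1 = 0 := by omega
  rw [e]
  simp only [Function.iterate_zero, deriv_id]
  ring

theorem aux_main (p q : Polynomial ℂ) (ε : ℂ) (n : ℕ) :
    ∃ U E : MvPolynomial (Fin 3) ℂ, ∀ s z w : ℂ,
      MvPolynomial.eval ![s, z, w] U = auxA p q ε n z w + s * MvPolynomial.eval ![s, z, w] E ∧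
      (s ≠ 0 →
        ((fun x : ℂ × ℂ => ((p.eval (s * x.1) + s * ε * x.2) / s, q.eval x.2))^[n]) (z, w) =
          ((fun z => p.eval z)^[n] 0 / s + MvPolynomial.eval ![s, z, w] U,
            (fun w => q.eval w)^[n] w)) := by
  induction n with
  | zero => exact ⟨MvPolynomial.X 1, 0, fun s z w => by simp [auxA]⟩
  | succ n ih =>
    obtain ⟨U, E, h⟩ := ih
    obtain ⟨Q, hQ⟩ := aux_Q q n
    set c := (fun z => p.eval z)^[n] 0 with hc
    obtain ⟨R, hR⟩ := aux_taylor p c U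
    refine ⟨MvPolynomial.C (p.derivative.eval c) * U + MvPolynomial.C ε * Q +
      MvPolynomial.X 0 * R, MvPolynomial.C (p.derivative.eval c) * E + R, fun s z w => ⟨?_, ?_⟩⟩
    · rw [auxA_succ, ← hc, ← hQ s z w]
      simp only [map_add, map_mul, MvPolynomial.eval_C, MvPolynomial.eval_X,
        Matrix.cons_val_zero, (h s z w).1]
      ring
    · intro hs
      rw [Function.iterate_succ_apply', (h s z w).2 hs, Function.iterate_succ_apply',
        Function.iterate_succ_apply', ← hc, ← hQ s z w]
      have e : s * (c / s + MvPolynomial.eval ![s, z, w] U) =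
          c + s * MvPolynomial.eval ![s, z, w] U := by field_simp
      simp only [e, hR, map_add, map_mul, MvPolynomial.eval_C, MvPolynomial.eval_X,
        Matrix.cons_val_zero]
      congr 1
      field_simp
      ring

/-- Proposition 4.2: if `0` is `m₀`-periodic for `p` with multiplier `ρ = (p^{m₀})'(0)`,
`m₁ = m₀ t₀`, and `bᵢ = (p^{m₁-i-1})'(p^{i+1}(0))`, then for each `l ≥ 1` the `(m₁ l)`-th
iterate of the renormalized skew product `g_s = φ_s⁻¹ ∘ f_s ∘ φ_s`,
where `f_s (z,w) = (p z + s ε w, q w)` and `φ_s (z,w) = (s z, w)`, is given by the explicit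
formula below, with an error term `s · E_l(s,z,w)` for a polynomial `E_l` independent of `s`. -/
theorem stmt_7 (p q : Polynomial ℂ) (m₀ : ℕ) (hm₀ : 1 ≤ m₀)
    (hp0 : (fun z => p.eval z)^[m₀] 0 = 0)
    (t₀ : ℕ) (ht₀ : 1 ≤ t₀) (ε : ℂ) (l : ℕ) (hl : 1 ≤ l) :
    ∃ E : MvPolynomial (Fin 3) ℂ,
      ∀ s : ℂ, s ≠ 0 → ∀ z w : ℂ,
        ((fun x : ℂ × ℂ => ((p.eval (s * x.1) + s * ε * x.2) / s, q.eval x.2))^[m₀ * t₀ * l])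
            (z, w) =
          (deriv ((fun z => p.eval z)^[m₀]) 0 ^ (t₀ * l) * z +
            ε * ∑ i ∈ Finset.range (m₀ * t₀),
              deriv ((fun z => p.eval z)^[m₀ * t₀ - i - 1]) ((fun z => p.eval z)^[i + 1] 0) *
                ∑ k ∈ Finset.range l,
                  deriv ((fun z => p.eval z)^[m₀]) 0 ^ (t₀ * k) *
                    (fun w => q.eval w)^[i + (l - 1 - k) * (m₀ * t₀)] w +
            s * MvPolynomial.eval ![s, z, w] E,
          (fun w => q.eval w)^[m₀ * t₀ * l] w) := by
  obtain ⟨U, E, h⟩ := aux_main p q ε (m₀ * t₀ * l)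
  refine ⟨E, fun s hs z w => ?_⟩
  have hz := aux_per p _ (aux_per p m₀ hp0 t₀)
  rw [(h s z w).2 hs, (h s z w).1, hz l, zero_div, zero_add]
  congr 2
  unfold auxA
  rw [mul_assoc m₀ t₀ l, aux_pow p m₀ hp0, ← mul_assoc m₀ t₀ l, aux_sum]
  congr 2
  refine Finset.sum_congr rfl fun i hi => ?_
  have hi := Finset.mem_range.1 hi
  rw [← Finset.sum_range_reflect, Finset.mul_sum]
  refine Finset.sum_congr rfl fun k hk => ?_
  have hk := Finset.mem_range.1 hk
  rw [← mul_assoc (deriv _ _)]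
  congr 1
  have e : m₀ * t₀ * l - (i + (l - 1 - k) * (m₀ * t₀)) - 1 =
      m₀ * t₀ * k + (m₀ * t₀ - i - 1) := by
    obtain ⟨d, rfl⟩ : ∃ d, l = k + 1 + d := ⟨l - (k + 1), by omega⟩
    have e1 : k + 1 + d - 1 - k = d := by omega
    rw [e1, Nat.mul_add, Nat.mul_add, mul_one, mul_comm d]
    omega
  have e2 : (fun z => p.eval z)^[i + (l - 1 - k) * (m₀ * t₀) + 1] 0 =
      (fun z => p.eval z)^[i + 1] 0 := by
    rw [add_right_comm, Function.iterate_add_apply, mul_comm, hz]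
  have e3 : m₀ * t₀ - i - 1 + (i + 1) = m₀ * t₀ := by omega
  rw [e, e2, aux_add, ← Function.iterate_add_apply, e3, aux_per p m₀ hp0, mul_assoc m₀ t₀ k,
    aux_pow p m₀ hp0, mul_comm]
end
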